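/- Let A be a finite set of positive integers such that δ_A > 1 − 5/312. Call an integer d ≥ 1 admissible for A if for every q ≥ 1 there exists d' ∈ D_A with d' ≡ d (mod q). Then #{d ∈ [1,N] : d is admissible for A and d ∉ D_A} = o(N) as N → ∞; that is, almost every admissible number is the denominator of a reduced fraction with all partial quotients in A. -/

import Mathlib

open Filter MeasureTheory

/-- The finite continued fraction `[a₁,…,a_k] = 1/(a₁ + 1/(a₂ + ⋯ + 1/a_k))`. -/
def cf : List ℤ → ℚ
  | [] => 0
  | a :: t => 1 / ((a : ℚ) + cf t)

/-- `d ∈ DA A` iff `d` is the bottom-right entry of some element of the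
multiplicative semigroup generated by the matrices `((0,1),(1,a))`, `a ∈ A`. -/
def DA (A : Set ℤ) : Set ℤ :=
  {d : ℤ | ∃ l : List ℤ, l ≠ [] ∧ (∀ a ∈ l, a ∈ A) ∧
    ((l.map fun a => !![(0 : ℤ), 1; 1, a]).prod) 1 1 = d}

/-- `CA A` is the set of real numbers whose infinite continued fraction
expansion has all partial quotients in `A`: the limits of the finite
convergents `[a₁,…,a_k]` with all `a_j ∈ A` as `k → ∞`. -/
def CA (A : Set ℤ) : Set ℝ :=
  {x : ℝ | ∃ a : ℕ → ℤ, (∀ n, a n ∈ A) ∧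
    Tendsto (fun k : ℕ => ((cf (List.ofFn fun i : Fin k => a i) : ℚ) : ℝ))
      atTop (nhds x)}

/-- `d` is admissible for the alphabet `A` if for every `q ≥ 1` there is
`d' ∈ DA A` with `d' ≡ d (mod q)`. -/
def AdmissibleZ (A : Set ℤ) (d : ℤ) : Prop :=
  ∀ q : ℤ, 1 ≤ q → ∃ d' ∈ DA A, d' ≡ d [ZMOD q]


/-! Part 1: basics on words. -/

def Mt (l : List ℤ) : Matrix (Fin 2) (Fin 2) ℤ := (l.map fun a => !![(0 : ℤ), 1; 1, a]).prod

def Pos (l : List ℤ) : Prop := ∀ a ∈ l, 1 ≤ a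

lemma Mt_nil : Mt [] = 1 := by simp [Mt]

lemma Mt_cons (a : ℤ) (l : List ℤ) : Mt (a :: l) = !![(0 : ℤ), 1; 1, a] * Mt l := by simp [Mt]

lemma Mt_append (l t : List ℤ) : Mt (l ++ t) = Mt l * Mt t := by simp [Mt]

lemma mm (A B : Matrix (Fin 2) (Fin 2) ℤ) (i j : Fin 2) :
    (A * B) i j = A i 0 * B 0 j + A i 1 * B 1 j := by
  simp [Matrix.mul_apply, Fin.sum_univ_two]

lemma Mt_app (l t : List ℤ) (i j : Fin 2) :
    Mt (l ++ t) i j = Mt l i 0 * Mt t 0 j + Mt l i 1 * Mt t 1 j := by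
  rw [Mt_append, mm]

lemma Mt_c0 (a : ℤ) (l : List ℤ) (j : Fin 2) : Mt (a :: l) 0 j = Mt l 1 j := by
  rw [Mt_cons, mm]; simp

lemma Mt_c1 (a : ℤ) (l : List ℤ) (j : Fin 2) : Mt (a :: l) 1 j = Mt l 0 j + a * Mt l 1 j := by
  rw [Mt_cons, mm]; simp

lemma Mt_reverse (l : List ℤ) : Mt l.reverse = (Mt l).transpose := by
  induction l with
  | nil => simp [Mt_nil]
  | cons a l ih =>
    rw [List.reverse_cons, Mt_append, ih, Mt_cons a l, Matrix.transpose_mul, Mt_cons a [], Mt_nil]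
    congr 1
    ext i j; fin_cases i <;> fin_cases j <;> simp

lemma Mt_det (l : List ℤ) : Mt l 0 0 * Mt l 1 1 - Mt l 0 1 * Mt l 1 0 = (-1) ^ l.length := by
  induction l with
  | nil => simp [Mt_nil]
  | cons a l ih =>
    rw [Mt_c0, Mt_c0, Mt_c1, Mt_c1, List.length_cons, pow_succ, ← ih]; ring

lemma Pos.tail {a : ℤ} {l : List ℤ} (h : Pos (a :: l)) : Pos l := fun x hx => h x (by simp [hx])

lemma Pos.head {a : ℤ} {l : List ℤ} (h : Pos (a :: l)) : 1 ≤ a := h a (by simp)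

lemma pos_nil : Pos [] := fun _ h => by simp at h

lemma Pos.append {l t : List ℤ} (h : Pos l) (h' : Pos t) : Pos (l ++ t) := by
  intro x hx
  rcases List.mem_append.1 hx with h1 | h1
  · exact h x h1
  · exact h' x h1

lemma Pos.rev {l : List ℤ} (h : Pos l) : Pos l.reverse := fun x hx => h x (by simpa using hx)

lemma Mt_basic {l : List ℤ} (h : Pos l) :
    0 ≤ Mt l 0 0 ∧ 0 ≤ Mt l 1 0 ∧ 0 ≤ Mt l 0 1 ∧ 1 ≤ Mt l 1 1 ∧ Mt l 1 0 ≤ Mt l 1 1 ∧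
      Mt l 0 1 ≤ Mt l 1 1 ∧ (l.length : ℤ) ≤ Mt l 1 1 := by
  have key : ∀ l : List ℤ, Pos l → 0 ≤ Mt l 0 0 ∧ 0 ≤ Mt l 1 0 ∧ 0 ≤ Mt l 0 1 ∧ 1 ≤ Mt l 1 1 ∧
      Mt l 0 1 ≤ Mt l 1 1 ∧ (l.length : ℤ) ≤ Mt l 1 1 ∧ (l ≠ [] → 1 ≤ Mt l 0 1) := by
    intro l h
    induction l with
    | nil => simp [Mt_nil]
    | cons a l ih =>
      obtain ⟨h0, h1, h2, h3, h4, h5, h6⟩ := ih h.tail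
      have ha := h.head
      simp only [Mt_c0, Mt_c1, List.length_cons, Nat.cast_add, Nat.cast_one]
      refine ⟨h1, by positivity, by omega, by nlinarith, by nlinarith, ?_, fun _ => h3⟩
      by_cases hl : l = []
      · subst hl; simp [Mt_nil]; omega
      · have := h6 hl; nlinarith
  obtain ⟨h0, h1, h2, h3, h4, h5, h6⟩ := key l h
  obtain ⟨k0, k1, k2, k3, k4, k5, k6⟩ := key l.reverse h.rev
  rw [Mt_reverse] at k4
  simp only [Matrix.transpose_apply] at k4
  exact ⟨h0, h1, h2, h3, k4, h4, h5⟩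

lemma Mt_basic2 {l : List ℤ} (h : Pos l) (hl : l ≠ []) :
    1 ≤ Mt l 0 1 ∧ 1 ≤ Mt l 1 0 ∧ Mt l 0 0 ≤ Mt l 0 1 ∧ Mt l 0 0 ≤ Mt l 1 0 := by
  have key : ∀ l : List ℤ, Pos l → l ≠ [] → 1 ≤ Mt l 0 1 ∧ Mt l 0 0 ≤ Mt l 0 1 := by
    intro l h hl
    cases l with
    | nil => exact absurd rfl hl
    | cons a l =>
      obtain ⟨h0, h1, h2, h3, h4, h5, h6⟩ := Mt_basic h.tail
      simp only [Mt_c0]; omega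
  have h1 := key l h hl
  have h2 := key l.reverse h.rev (by simpa using hl)
  rw [Mt_reverse] at h2
  simp only [Matrix.transpose_apply] at h2
  omega

lemma D_append {l t : List ℤ} (h : Pos l) (h' : Pos t) :
    Mt l 1 1 * Mt t 1 1 ≤ Mt (l ++ t) 1 1 ∧ Mt (l ++ t) 1 1 ≤ 2 * (Mt l 1 1 * Mt t 1 1) := by
  obtain ⟨h0, h1, h2, h3, h4, h5, h6⟩ := Mt_basic h
  obtain ⟨k0, k1, k2, k3, k4, k5, k6⟩ := Mt_basic h'
  rw [Mt_app]
  constructor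
  · nlinarith [mul_nonneg h1 k2]
  · nlinarith [mul_le_mul h4 k5 k2 (by omega)]

lemma Mt_inj {l t : List ℤ} (h : Pos l) (h' : Pos t) (e : Mt l = Mt t) : l = t := by
  induction l generalizing t with
  | nil =>
    by_contra hne
    have := (Mt_basic2 h' (Ne.symm hne)).1
    rw [← e, Mt_nil] at this; simp at this
  | cons a l ih =>
    cases t with
    | nil =>
      have := (Mt_basic2 h (by simp)).1
      rw [e, Mt_nil] at this; simp at this
    | cons b t =>
      have e0 : ∀ j, Mt l 1 j = Mt t 1 j := fun j => by
        rw [← Mt_c0 a l j, ← Mt_c0 b t j, e]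
      have e1 : ∀ j, Mt l 0 j + a * Mt l 1 j = Mt t 0 j + b * Mt l 1 j := fun j => by
        rw [e0 j, ← Mt_c1, ← e, Mt_c1, e0 j]
      have hab : a = b := by
        obtain ⟨h0, h1, h2, h3, h4, h5, h6⟩ := Mt_basic h.tail
        obtain ⟨k0, k1, k2, k3, k4, k5, k6⟩ := Mt_basic h'.tail
        have E1 := e1 1
        have E0 := e1 0
        have F1 := e0 1
        have F0 := e0 0
        rcases lt_trichotomy a b with hlt | heq | hlt
        · exfalso
          have hp : Mt t 0 1 = 0 := by nlinarith
          have ht : t = [] := by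
            by_contra hne; have := (Mt_basic2 h'.tail hne).1; omega
          subst ht
          have hm : Mt l 1 0 = 0 := by rw [F0, Mt_nil]; rfl
          have hl : l = [] := by
            by_contra hne; have := (Mt_basic2 h.tail hne).2.1; omega
          subst hl
          simp [Mt_nil] at E1; omega
        · exact heq
        · exfalso
          have hp : Mt l 0 1 = 0 := by nlinarith
          have ht : l = [] := by
            by_contra hne; have := (Mt_basic2 h.tail hne).1; omega
          subst ht
          have hm : Mt t 1 0 = 0 := by rw [← F0, Mt_nil]; rfl
          have hl : t = [] := by
            by_contra hne; have := (Mt_basic2 h'.tail hne).2.1; omega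
          subst hl
          simp [Mt_nil] at E1; omega
      subst hab
      congr 1
      apply ih h.tail h'.tail
      ext i j
      fin_cases i
      · have := e1 j; simp only [Fin.zero_eta]; rw [e0 j] at this; omega
      · exact e0 j

/-- row and parity determine the word -/
lemma row_inj {l t : List ℤ} (h : Pos l) (h' : Pos t) (e0 : Mt l 1 0 = Mt t 1 0)
    (e1 : Mt l 1 1 = Mt t 1 1) (hp : l.length % 2 = t.length % 2) : l = t := by
  have hdet : (-1 : ℤ) ^ l.length = (-1) ^ t.length := by
    rw [neg_one_pow_eq_pow_mod_two, hp, ← neg_one_pow_eq_pow_mod_two]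
  by_cases hl : l = []
  · subst hl
    by_contra hne
    have := (Mt_basic2 h' (Ne.symm hne)).2.1
    rw [← e0, Mt_nil] at this; simp at this
  by_cases ht : t = []
  · subst ht
    have := (Mt_basic2 h hl).2.1
    rw [e0, Mt_nil] at this; simp at this
  obtain ⟨h0, h1, h2, h3, h4, h5, h6⟩ := Mt_basic h
  obtain ⟨k0, k1, k2, k3, k4, k5, k6⟩ := Mt_basic h'
  obtain ⟨g1, g2, g3, g4⟩ := Mt_basic2 h hl
  obtain ⟨f1, f2, f3, f4⟩ := Mt_basic2 h' ht
  have d1 := Mt_det l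
  have d2 := Mt_det t
  rw [← hdet, ← e0, ← e1] at d2
  have hc : IsCoprime (Mt l 1 1) (Mt l 1 0) := by
    rcases neg_one_pow_eq_or ℤ l.length with hs | hs
    · exact ⟨Mt l 0 0, -Mt l 0 1, by rw [hs] at d1; linarith⟩
    · exact ⟨-Mt l 0 0, Mt l 0 1, by rw [hs] at d1; linarith⟩
  have hd : Mt l 1 1 ∣ (Mt l 0 1 - Mt t 0 1) * Mt l 1 0 :=
    ⟨Mt l 0 0 - Mt t 0 0, by linear_combination d2 - d1⟩
  have hd2 := hc.dvd_of_dvd_mul_right hd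
  have hz : Mt l 0 1 - Mt t 0 1 = 0 := by
    apply Int.eq_zero_of_abs_lt_dvd hd2
    rw [abs_lt]; constructor <;> omega
  have hz2 : Mt l 0 0 = Mt t 0 0 := by
    have : Mt l 0 1 = Mt t 0 1 := by omega
    rw [this] at d1
    have : (Mt l 0 0 - Mt t 0 0) * Mt l 1 1 = 0 := by linear_combination d1 - d2
    rcases mul_eq_zero.1 this with h | h <;> omega
  apply Mt_inj h h'
  ext i j
  fin_cases i <;> fin_cases j <;> simp <;> omega

lemma col_inj {l t : List ℤ} (h : Pos l) (h' : Pos t) (e0 : Mt l 0 1 = Mt t 0 1)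
    (e1 : Mt l 1 1 = Mt t 1 1) (hp : l.length % 2 = t.length % 2) : l = t := by
  have := row_inj h.rev h'.rev (by simpa [Mt_reverse] using e0) (by simpa [Mt_reverse] using e1)
    (by simpa using hp)
  simpa using this

lemma cf_eq {l : List ℤ} (h : Pos l) : cf l = (Mt l 0 1 : ℚ) / (Mt l 1 1 : ℚ) := by
  induction l with
  | nil => simp [cf, Mt_nil]
  | cons a l ih =>
    obtain ⟨h0, h1, h2, h3, h4, h5, h6⟩ := Mt_basic h.tail
    have h3' : (1 : ℚ) ≤ Mt l 1 1 := by exact_mod_cast h3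
    have h2' : (0 : ℚ) ≤ Mt l 0 1 := by exact_mod_cast h2
    have ha : (1 : ℚ) ≤ a := by exact_mod_cast h.head
    have : (0 : ℚ) < Mt l 0 1 + a * Mt l 1 1 := by nlinarith
    rw [cf, ih h.tail, Mt_c0, Mt_c1]
    push_cast
    have h3'' : (Mt l 1 1 : ℚ) ≠ 0 := by positivity
    rw [show (a : ℚ) + (Mt l 0 1 : ℚ) / Mt l 1 1 = (Mt l 0 1 + a * Mt l 1 1) / Mt l 1 1 by
      field_simp; ring, one_div_div]

lemma cf_close {l t : List ℤ} (h : Pos l) (h' : Pos t) :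
    |((cf (l ++ t) : ℚ) : ℝ) - ((Mt l 0 1 : ℤ) : ℝ) / ((Mt l 1 1 : ℤ) : ℝ)|
      ≤ 1 / ((Mt l 1 1 : ℤ) : ℝ) ^ 2 := by
  rw [cf_eq (h.append h')]
  obtain ⟨h0, h1, h2, h3, h4, h5, h6⟩ := Mt_basic h
  obtain ⟨k0, k1, k2, k3, k4, k5, k6⟩ := Mt_basic h'
  obtain ⟨d1, d2⟩ := D_append h h'
  have hdet := Mt_det l
  have hD : (1 : ℝ) ≤ Mt l 1 1 := by exact_mod_cast h3
  have hE : (1 : ℝ) ≤ Mt t 1 1 := by exact_mod_cast k3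
  have hF : (Mt l 1 1 * Mt t 1 1 : ℝ) ≤ Mt (l ++ t) 1 1 := by exact_mod_cast d1
  have hFp : (0 : ℝ) < Mt (l ++ t) 1 1 := by nlinarith
  push_cast
  have key : ((Mt (l ++ t) 0 1 : ℤ) : ℝ) / (Mt (l ++ t) 1 1 : ℤ) - (Mt l 0 1 : ℤ) / (Mt l 1 1 : ℤ)
      = ((-1) ^ l.length * (Mt t 0 1 : ℤ)) / ((Mt (l ++ t) 1 1 : ℤ) * (Mt l 1 1 : ℤ)) := by
    rw [div_sub_div _ _ hFp.ne' (by positivity)]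
    congr 1
    have : Mt (l ++ t) 0 1 * Mt l 1 1 - Mt (l ++ t) 1 1 * Mt l 0 1
      = (-1) ^ l.length * Mt t 0 1 := by
      rw [Mt_app, Mt_app, ← hdet]; ring
    exact_mod_cast this
  rw [key, abs_div, abs_mul, abs_pow, abs_neg, abs_one, one_pow, one_mul,
    abs_of_nonneg (by exact_mod_cast k2), abs_of_pos (by positivity),
    div_le_div_iff₀ (by positivity) (by positivity)]
  have : (Mt t 0 1 : ℝ) ≤ Mt t 1 1 := by exact_mod_cast k5
  have e2 : (0 : ℝ) ≤ ((Mt l 1 1 : ℤ) : ℝ) := by positivity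
  nlinarith [mul_le_mul_of_nonneg_right this (sq_nonneg ((Mt l 1 1 : ℤ) : ℝ)),
    mul_le_mul_of_nonneg_right hF e2]

/-- prefixes of sequences -/
def pre (a : ℕ → ℤ) (k : ℕ) : List ℤ := List.ofFn fun i : Fin k => a i

lemma pre_len (a : ℕ → ℤ) (k : ℕ) : (pre a k).length = k := by simp [pre]

lemma pre_mem {A : Set ℤ} {a : ℕ → ℤ} (h : ∀ n, a n ∈ A) (k : ℕ) : ∀ x ∈ pre a k, x ∈ A := by
  intro x hx
  simp only [pre, List.mem_ofFn] at hx
  obtain ⟨i, rfl⟩ := hx; exact h i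

lemma pre_add (a : ℕ → ℤ) (k m : ℕ) : pre a (k + m) = pre a k ++ pre (fun n => a (k + n)) m := by
  apply List.ext_getElem
  · simp [pre]
  · intro i h1 h2
    simp only [pre, List.getElem_ofFn, List.getElem_append]
    split_ifs with h
    · rfl
    · simp at h; simp [List.length_ofFn, h]

lemma CA_close {A : Set ℤ} (hpos : ∀ a ∈ A, 1 ≤ a) {x : ℝ} {a : ℕ → ℤ} (ha : ∀ n, a n ∈ A)
    (hx : Tendsto (fun k : ℕ => ((cf (pre a k) : ℚ) : ℝ)) atTop (nhds x)) (k : ℕ) :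
    |x - ((Mt (pre a k) 0 1 : ℤ) : ℝ) / ((Mt (pre a k) 1 1 : ℤ) : ℝ)|
      ≤ 1 / ((Mt (pre a k) 1 1 : ℤ) : ℝ) ^ 2 := by
  have h1 : Tendsto (fun m : ℕ => ((cf (pre a (k + m)) : ℚ) : ℝ)) atTop (nhds x) := by
    have := hx.comp (tendsto_add_atTop_nat k)
    refine this.congr fun m => ?_
    simp [Function.comp, add_comm]
  refine le_of_tendsto ((h1.sub_const _).abs) (Eventually.of_forall fun m => ?_)
  rw [pre_add]
  exact cf_close (fun x hx => hpos x (pre_mem ha _ x hx))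
    (fun x hx => hpos x (pre_mem (fun n => ha _) _ x hx))

lemma ediam_cb (x r : ℝ) : Metric.ediam (Metric.closedBall x r) = ENNReal.ofReal (2 * r) := by
  rw [Real.closedBall_eq_Icc, Real.ediam_Icc]; congr 1; ring

/-- covering criterion -/
lemma dim_key {A : Set ℤ} (hpos : ∀ a ∈ A, 1 ≤ a) {s : NNReal} (hs : (s : ENNReal) < dimH (CA A))
    (B : ℝ) : ∃ m : ℕ, ∀ F : Finset (List ℤ), (∀ l ∈ F, Pos l) →
      (∀ l ∈ F, (m : ℤ) ≤ Mt l 1 1) → (∀ a : ℕ → ℤ, (∀ n, a n ∈ A) → ∃ k, pre a k ∈ F) →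
      B < ∑ l ∈ F, ((Mt l 1 1 : ℤ) : ℝ) ^ (-(2 * (s : ℝ))) := by
  by_contra hcon
  push Not at hcon
  choose F hF1 hF2 hF3 hF4 using hcon
  have htop := hausdorffMeasure_of_lt_dimH hs
  have hD : ∀ n, ∀ l ∈ F n, (1 : ℝ) ≤ Mt l 1 1 := fun n l hl => by
    exact_mod_cast (Mt_basic (hF1 n l hl)).2.2.2.1
  have hle := Measure.hausdorffMeasure_le_liminf_sum (s : ℝ) (CA A) (l := atTop (α := ℕ))
    (fun n : ℕ => ENNReal.ofReal (2 / (n : ℝ) ^ 2)) (by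
      have h0 : Tendsto (fun n : ℕ => 2 / (n : ℝ) ^ 2) atTop (nhds 0) :=
        tendsto_const_nhds.div_atTop
          ((tendsto_pow_atTop (by norm_num)).comp tendsto_natCast_atTop_atTop)
      simpa using ENNReal.tendsto_ofReal h0)
    (fun n (l : F n) => Metric.closedBall (((Mt l 0 1 : ℤ) : ℝ) / ((Mt l 1 1 : ℤ) : ℝ))
      (1 / ((Mt l 1 1 : ℤ) : ℝ) ^ 2))
    (by
      filter_upwards [eventually_ge_atTop 1] with n hn l
      rw [ediam_cb]
      have h1 : (n : ℝ) ≤ Mt l.1 1 1 := by exact_mod_cast hF2 n l.1 l.2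
      have hn' : (1 : ℝ) ≤ n := by exact_mod_cast hn
      apply ENNReal.ofReal_le_ofReal
      rw [mul_one_div]
      gcongr)
    (by
      refine Eventually.of_forall fun n x hx => ?_
      obtain ⟨a, ha, hx⟩ := hx
      obtain ⟨k, hk⟩ := hF3 n a ha
      refine Set.mem_iUnion.2 ⟨⟨pre a k, hk⟩, ?_⟩
      rw [Metric.mem_closedBall, Real.dist_eq]
      exact CA_close hpos ha hx k)
  have hle2 : liminf (fun n : ℕ => ∑ l : F n, (Metric.ediam (Metric.closedBall
      (((Mt l 0 1 : ℤ) : ℝ) / ((Mt l 1 1 : ℤ) : ℝ))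
      (1 / ((Mt l 1 1 : ℤ) : ℝ) ^ 2))) ^ (s : ℝ)) atTop ≤ ENNReal.ofReal (2 ^ (s : ℝ) * B) := by
    refine liminf_le_of_frequently_le' (Frequently.of_forall fun n => ?_)
    have : ∀ l ∈ F n, (Metric.ediam (Metric.closedBall
      (((Mt l 0 1 : ℤ) : ℝ) / ((Mt l 1 1 : ℤ) : ℝ))
      (1 / ((Mt l 1 1 : ℤ) : ℝ) ^ 2))) ^ (s : ℝ) =
      ENNReal.ofReal (2 ^ (s : ℝ) * ((Mt l 1 1 : ℤ) : ℝ) ^ (-(2 * (s : ℝ)))) := fun l hl => by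
      have h1 := hD n l hl
      rw [ediam_cb, ENNReal.ofReal_rpow_of_nonneg (by positivity) (NNReal.coe_nonneg s)]
      congr 1
      rw [Real.mul_rpow (by norm_num) (by positivity), one_div, Real.inv_rpow (by positivity),
        ← Real.rpow_natCast, ← Real.rpow_mul (by positivity), Real.rpow_neg (by positivity)]
      norm_num
    rw [Finset.sum_coe_sort (F n) (fun l => (Metric.ediam (Metric.closedBall
      (((Mt l 0 1 : ℤ) : ℝ) / ((Mt l 1 1 : ℤ) : ℝ))
      (1 / ((Mt l 1 1 : ℤ) : ℝ) ^ 2))) ^ (s : ℝ)), Finset.sum_congr rfl this,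
      ← ENNReal.ofReal_sum_of_nonneg]
    · apply ENNReal.ofReal_le_ofReal
      rw [← Finset.mul_sum]
      have := hF4 n
      gcongr
    · intro l hl
      have := hD n l hl
      positivity
  rw [htop] at hle
  exact absurd (lt_of_le_of_lt (hle.trans hle2) ENNReal.ofReal_lt_top) (by simp)

def wl (A : Finset ℤ) : ℕ → Finset (List ℤ)
  | 0 => {[]}
  | k + 1 => (A ×ˢ wl A k).image fun p => p.1 :: p.2

lemma mem_wl {A : Finset ℤ} {k : ℕ} {l : List ℤ} :
    l ∈ wl A k ↔ l.length = k ∧ ∀ a ∈ l, a ∈ A := by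
  induction k generalizing l with
  | zero => simp only [wl, Finset.mem_singleton, List.length_eq_zero_iff]
            constructor
            · rintro rfl; simp
            · exact fun h => h.1
  | succ k ih =>
    simp only [wl, Finset.mem_image, Finset.mem_product, Prod.exists]
    constructor
    · rintro ⟨a, t, ⟨h1, h2⟩, rfl⟩
      rw [ih] at h2
      simp only [List.length_cons, List.mem_cons]
      exact ⟨by omega, by rintro b (rfl | hb); exacts [h1, h2.2 b hb]⟩
    · rintro ⟨h1, h2⟩
      cases l with
      | nil => simp at h1
      | cons a t =>
        exact ⟨a, t, ⟨h2 a (by simp), ih.2 ⟨by simpa using h1, fun b hb => h2 b (by simp [hb])⟩⟩, rfl⟩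

/-- transfer inequality -/
def TI (A : Finset ℤ) (e : ℝ) : Prop := ∀ x : ℝ, 0 ≤ x → x ≤ 1 →
  ∑ a ∈ A, ((a : ℝ) + x) ^ (e - 2) * (1 / (1 + 1 / ((a : ℝ) + x))) ≤ 1 / (1 + x)

lemma Z_bound {A : Finset ℤ} (hpos : ∀ a ∈ A, 1 ≤ a) {e : ℝ} (h : TI A e) (k : ℕ) :
    ∀ x : ℝ, 0 ≤ x → x ≤ 1 →
    ∑ l ∈ wl A k, (((Mt l 0 1 : ℤ) : ℝ) * x + ((Mt l 1 1 : ℤ) : ℝ)) ^ (e - 2) ≤ 2 / (1 + x) := by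
  induction k with
  | zero =>
    intro x h0 h1
    simp only [wl, Finset.sum_singleton, Mt_nil]
    rw [le_div_iff₀ (by positivity)]
    simp; linarith
  | succ k ih =>
    intro x h0 h1
    simp only [wl]
    rw [Finset.sum_image (by rintro ⟨a, l⟩ _ ⟨b, t⟩ _ h; simpa using h), Finset.sum_product]
    calc _ = ∑ a ∈ A, ((a : ℝ) + x) ^ (e - 2) * ∑ l ∈ wl A k,
          (((Mt l 0 1 : ℤ) : ℝ) * (1 / ((a : ℝ) + x)) + ((Mt l 1 1 : ℤ) : ℝ)) ^ (e - 2) := by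
          refine Finset.sum_congr rfl fun a ha => ?_
          rw [Finset.mul_sum]
          refine Finset.sum_congr rfl fun l hl => ?_
          have ha1 : (1 : ℝ) ≤ a := by exact_mod_cast hpos a ha
          have hP : Pos l := fun b hb => hpos b ((mem_wl.1 hl).2 b hb)
          have g1 : (0 : ℝ) ≤ Mt l 0 1 := by exact_mod_cast (Mt_basic hP).2.2.1
          have g2 : (1 : ℝ) ≤ Mt l 1 1 := by exact_mod_cast (Mt_basic hP).2.2.2.1
          rw [← Real.mul_rpow (by positivity) (by positivity)]
          simp only [Mt_c0, Mt_c1]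
          congr 1
          push_cast
          field_simp
          ring
      _ ≤ ∑ a ∈ A, ((a : ℝ) + x) ^ (e - 2) * (2 / (1 + 1 / ((a : ℝ) + x))) := by
          refine Finset.sum_le_sum fun a ha => ?_
          have ha1 : (1 : ℝ) ≤ a := by exact_mod_cast hpos a ha
          refine mul_le_mul_of_nonneg_left (ih _ (by positivity) ?_) (by positivity)
          rw [div_le_one (by positivity)]; linarith
      _ = 2 * ∑ a ∈ A, ((a : ℝ) + x) ^ (e - 2) * (1 / (1 + 1 / ((a : ℝ) + x))) := by
          rw [Finset.mul_sum]
          refine Finset.sum_congr rfl fun a ha => ?_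
          ring
      _ ≤ _ := by
          have := h x h0 h1
          calc _ ≤ 2 * (1 / (1 + x)) := by linarith
            _ = _ := by ring

lemma tele_term {e t : ℝ} (he : 0 ≤ e) (he1 : e < 1) (ht : 1 ≤ t) :
    t ^ (e - 2) * (1 / (1 + 1 / t)) ≤ (t ^ (e - 1) - (t + 1) ^ (e - 1)) / (1 - e) := by
  have hB : (1 + (-1 / (t + 1))) ^ (1 - e) ≤ 1 + (1 - e) * (-1 / (t + 1)) :=
    rpow_one_add_le_one_add_mul_self (by rw [le_div_iff₀ (by positivity)]; linarith)
      (by linarith) (by linarith)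
  have h1 : 1 + (-1 / (t + 1)) = t / (t + 1) := by field_simp; ring
  rw [h1, Real.div_rpow (by positivity) (by positivity)] at hB
  have h2 : t ^ (1 - e) / (t + 1) ^ (1 - e) * t ^ (e - 1) = (t + 1) ^ (e - 1) := by
    rw [show e - 1 = -(1 - e) by ring, Real.rpow_neg (by positivity), Real.rpow_neg (by positivity)]
    field_simp
  have h3 : t ^ (e - 2) = t ^ (e - 1) / t := by
    rw [show e - 2 = (e - 1) - 1 by ring, Real.rpow_sub_one (by positivity)]
  have hp : 0 < t ^ (e - 1) := by positivity
  rw [le_div_iff₀ (by linarith), h3, ← h2]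
  have := mul_le_mul_of_nonneg_right hB hp.le
  have h4 : t ^ (e - 1) / t * (1 / (1 + 1 / t)) * (1 - e) = (1 - e) * t ^ (e - 1) / (t + 1) := by
    field_simp
  rw [h4]
  have h5 : (1 + (1 - e) * (-1 / (t + 1))) * t ^ (e - 1)
    = t ^ (e - 1) - (1 - e) * t ^ (e - 1) / (t + 1) := by ring
  linarith

lemma tele_sum {A : Finset ℤ} {a0 : ℕ} (h0 : 1 ≤ a0) (hA : ∀ a ∈ A, (a0 : ℤ) ≤ a) {e x : ℝ}
    (he : 0 ≤ e) (he1 : e < 1) (hx : 0 ≤ x) :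
    ∑ a ∈ A, ((a : ℝ) + x) ^ (e - 2) * (1 / (1 + 1 / ((a : ℝ) + x)))
      ≤ ((a0 : ℝ) + x) ^ (e - 1) / (1 - e) := by
  have h0' : (1 : ℝ) ≤ a0 := by exact_mod_cast h0
  obtain ⟨n, hn⟩ : ∃ n : ℕ, A ⊆ (Finset.range n).image fun i : ℕ => ((a0 : ℤ) + i) := by
    obtain ⟨b, hb⟩ := A.bddAbove
    refine ⟨b.toNat + 1, fun a ha => ?_⟩
    rw [Finset.mem_image]
    have h1 := hA a ha
    have h2 : a ≤ b := hb ha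
    exact ⟨(a - a0).toNat, by rw [Finset.mem_range]; omega, by omega⟩
  calc _ ≤ ∑ a ∈ (Finset.range n).image fun i : ℕ => ((a0 : ℤ) + i),
        ((a : ℝ) + x) ^ (e - 2) * (1 / (1 + 1 / ((a : ℝ) + x))) := by
        refine Finset.sum_le_sum_of_subset_of_nonneg hn fun a ha _ => ?_
        rw [Finset.mem_image] at ha
        obtain ⟨i, _, rfl⟩ := ha
        push_cast
        positivity
    _ = ∑ i ∈ Finset.range n, ((a0 + i : ℝ) + x) ^ (e - 2) * (1 / (1 + 1 / ((a0 + i : ℝ) + x))) := by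
        rw [Finset.sum_image (by intro i _ j _ h; simpa using h)]
        push_cast; rfl
    _ ≤ ∑ i ∈ Finset.range n, ((((a0 + i : ℝ) + x) ^ (e - 1) / (1 - e))
          - (((a0 + (i + 1 : ℕ) : ℝ) + x) ^ (e - 1) / (1 - e))) := by
        refine Finset.sum_le_sum fun i _ => ?_
        have hi : (0 : ℝ) ≤ i := by positivity
        refine (tele_term he he1 (by linarith)).trans (le_of_eq ?_)
        rw [sub_div]; push_cast; ring_nf
    _ ≤ _ := by
        rw [Finset.sum_range_sub' (fun i : ℕ => ((a0 + i : ℝ) + x) ^ (e - 1) / (1 - e))]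
        have : 0 ≤ ((a0 + (n : ℕ) : ℝ) + x) ^ (e - 1) / (1 - e) :=
          div_nonneg (by positivity) (by linarith)
        simp only [Nat.cast_zero, add_zero]
        linarith

lemma TI_one {A : Finset ℤ} (hpos : ∀ a ∈ A, 1 ≤ a) (h1 : (1 : ℤ) ∉ A) : TI A (5 / 156) := by
  intro x hx0 hx1
  refine (tele_sum (a0 := 2) (by norm_num) (fun a ha => ?_) (by norm_num) (by norm_num) hx0).trans ?_
  · have := hpos a ha
    have : a ≠ 1 := fun h => h1 (h ▸ ha)
    push_cast; omega
  have hb : (1 + (1 + x)) ^ (5 / 156 : ℝ) ≤ 1 + (5 / 156) * (1 + x) :=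
    rpow_one_add_le_one_add_mul_self (by linarith) (by norm_num) (by norm_num)
  rw [Real.rpow_sub_one (by positivity), div_div, div_le_div_iff₀ (by positivity) (by positivity)]
  rw [show 1 + (1 + x) = 2 + x by ring] at hb
  push_cast
  nlinarith [mul_le_mul_of_nonneg_right hb (show 0 ≤ 1 + x by linarith)]

lemma TI_two {A : Finset ℤ} (hpos : ∀ a ∈ A, 1 ≤ a) (h2 : (2 : ℤ) ∉ A) : TI A (5 / 156) := by
  intro x hx0 hx1
  have hsplit : ∑ a ∈ A, ((a : ℝ) + x) ^ ((5 / 156 : ℝ) - 2) * (1 / (1 + 1 / ((a : ℝ) + x))) ≤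
      ∑ a ∈ A.erase 1, ((a : ℝ) + x) ^ ((5 / 156 : ℝ) - 2) * (1 / (1 + 1 / ((a : ℝ) + x))) +
      (1 + x) ^ ((5 / 156 : ℝ) - 2) * (1 / (1 + 1 / (1 + x))) := by
    by_cases h : (1 : ℤ) ∈ A
    · rw [← Finset.sum_erase_add _ _ h]; simp
    · rw [Finset.erase_eq_of_notMem h]
      have : 0 ≤ (1 + x) ^ ((5 / 156 : ℝ) - 2) * (1 / (1 + 1 / (1 + x))) := by positivity
      linarith
  have hs := tele_sum (A := A.erase 1) (a0 := 3) (x := x) (e := 5 / 156) (by norm_num)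
    (fun a ha => by
      have h3 := hpos a (Finset.mem_of_mem_erase ha)
      have h4 := Finset.ne_of_mem_erase ha
      have : a ≠ 2 := fun h => h2 (h ▸ Finset.mem_of_mem_erase ha)
      push_cast; omega) (by norm_num) (by norm_num) hx0
  have hb : (1 + (2 + x)) ^ (5 / 156 : ℝ) ≤ 1 + (5 / 156) * (2 + x) :=
    rpow_one_add_le_one_add_mul_self (by linarith) (by norm_num) (by norm_num)
  have hb2 : (1 + x) ^ (5 / 156 : ℝ) ≤ 1 + (5 / 156) * x :=
    rpow_one_add_le_one_add_mul_self (by linarith) (by norm_num) (by norm_num)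
  refine hsplit.trans ((add_le_add_left hs _).trans ?_)
  rw [Real.rpow_sub_one (by positivity), show (5 / 156 : ℝ) - 2 = 5 / 156 - 1 - 1 by ring,
    Real.rpow_sub_one (by positivity), Real.rpow_sub_one (by positivity)]
  rw [show 1 + (2 + x) = 3 + x by ring] at hb
  push_cast
  calc (3 + x) ^ (5 / 156 : ℝ) / (3 + x) / (1 - 5 / 156) +
      (1 + x) ^ (5 / 156 : ℝ) / (1 + x) / (1 + x) * (1 / (1 + 1 / (1 + x)))
      ≤ (1 + (5 / 156) * 3) / (3 + x) / (1 - 5 / 156) +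
      (1 + (5 / 156) * 1) / (1 + x) / (1 + x) * (1 / (1 + 1 / (1 + x))) := by
        gcongr
        · linarith
        · linarith
    _ = (171 / 151) / (3 + x) + (161 / 156) / ((1 + x) * (2 + x)) := by
        field_simp; ring
    _ ≤ 1 / (1 + x) := by
        rw [div_add_div _ _ (by positivity) (by positivity),
          div_le_div_iff₀ (by positivity) (by positivity)]
        nlinarith [mul_nonneg hx0 (show 0 ≤ 1 - x by linarith),
          mul_nonneg (mul_nonneg hx0 hx0) (show 0 ≤ 1 - x by linarith)]

noncomputable def sN : NNReal := 307 / 312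

lemma sN_coe : (sN : ℝ) = 307 / 312 := by simp [sN]

lemma one_two_mem {A : Finset ℤ} (hpos : ∀ a ∈ A, 1 ≤ a)
    (hs : (sN : ENNReal) < dimH (CA (A : Set ℤ))) : (1 : ℤ) ∈ A ∧ (2 : ℤ) ∈ A := by
  by_contra hcon
  have hTI : TI A (5 / 156) := by
    rw [not_and_or] at hcon
    rcases hcon with h | h
    · exact TI_one hpos h
    · exact TI_two hpos h
  obtain ⟨m, hm⟩ := dim_key (A := (A : Set ℤ)) (by simpa using hpos) hs 2
  have h1 := hm (wl A m) (fun l hl a ha => hpos a ((mem_wl.1 hl).2 a ha))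
    (fun l hl => by
      have := (Mt_basic (l := l) (fun a ha => hpos a ((mem_wl.1 hl).2 a ha))).2.2.2.2.2.2
      rw [(mem_wl.1 hl).1] at this; exact this)
    (fun a ha => ⟨m, mem_wl.2 ⟨pre_len a m, pre_mem ha m⟩⟩)
  have h2 := Z_bound hpos hTI m 0 le_rfl zero_le_one
  simp only [mul_zero, zero_add, add_zero, div_one] at h2
  rw [sN_coe] at h1
  norm_num at h1 h2
  linarith

/-- stopping words -/
def Stop (A : Finset ℤ) (M : ℕ) : Finset (List ℤ) :=
  ((Finset.range (M + 2)).biUnion (wl A)).filter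
    fun l => (M : ℤ) ≤ Mt l 1 1 ∧ Mt l.dropLast 1 1 < M

lemma mem_Stop {A : Finset ℤ} (hpos : ∀ a ∈ A, 1 ≤ a) {M : ℕ} {l : List ℤ} :
    l ∈ Stop A M ↔ (∀ a ∈ l, a ∈ A) ∧ (M : ℤ) ≤ Mt l 1 1 ∧ Mt l.dropLast 1 1 < M := by
  simp only [Stop, Finset.mem_filter, Finset.mem_biUnion, Finset.mem_range, mem_wl]
  constructor
  · rintro ⟨⟨k, _, _, h⟩, h2⟩; exact ⟨h, h2⟩
  · rintro ⟨h, h2⟩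
    refine ⟨⟨l.length, ?_, rfl, h⟩, h2⟩
    have := (Mt_basic (l := l.dropLast) (fun a ha => hpos a (h a (List.mem_of_mem_dropLast ha)))).2.2.2.2.2.2
    rw [List.length_dropLast] at this
    omega

lemma Stop_card {A : Finset ℤ} (hpos : ∀ a ∈ A, 1 ≤ a)
    (hs : (sN : ENNReal) < dimH (CA (A : Set ℤ))) :
    ∃ M0 : ℕ, ∀ M : ℕ, M0 ≤ M → (M : ℝ) ^ (307 / 156 : ℝ) ≤ (Stop A M).card := by
  obtain ⟨m, hm⟩ := dim_key (A := (A : Set ℤ)) (by simpa using hpos) hs 1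
  refine ⟨m + 2, fun M hM => ?_⟩
  have hP : ∀ l ∈ Stop A M, Pos l := fun l hl a ha => hpos a (((mem_Stop hpos).1 hl).1 a ha)
  have h1 := hm (Stop A M) hP (fun l hl => by have := ((mem_Stop hpos).1 hl).2.1; omega) (by
    intro a ha
    have hPa : ∀ k, Pos (pre a k) := fun k x hx => hpos x (pre_mem ha k x hx)
    have hex : ∃ k, (M : ℤ) ≤ Mt (pre a k) 1 1 := ⟨M, by
      have := (Mt_basic (hPa M)).2.2.2.2.2.2
      rwa [pre_len] at this⟩
    classical
    refine ⟨Nat.find hex, (mem_Stop hpos).2 ⟨pre_mem ha _, Nat.find_spec hex, ?_⟩⟩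
    obtain ⟨k, hk⟩ : ∃ k, Nat.find hex = k + 1 := by
      refine Nat.exists_eq_succ_of_ne_zero fun h0 => ?_
      have := Nat.find_spec hex
      rw [h0] at this
      simp [pre, Mt_nil] at this
      omega
    have hlt := Nat.find_min hex (m := k) (by omega)
    rw [hk, pre_add]
    have : pre (fun n => a (k + n)) 1 = [a k] := by simp [pre]
    rw [this, List.dropLast_concat]
    omega)
  have hM0 : (0 : ℝ) < M := by exact_mod_cast (by omega : 0 < M)
  have h2 : ∑ l ∈ Stop A M, ((Mt l 1 1 : ℤ) : ℝ) ^ (-(2 * (sN : ℝ)))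
      ≤ ∑ l ∈ Stop A M, (M : ℝ) ^ (-(307 / 156 : ℝ)) := by
    refine Finset.sum_le_sum fun l hl => ?_
    have h3 : (M : ℝ) ≤ Mt l 1 1 := by exact_mod_cast ((mem_Stop hpos).1 hl).2.1
    rw [sN_coe, show (2 * (307 / 312) : ℝ) = 307 / 156 by norm_num]
    exact Real.rpow_le_rpow_of_nonpos hM0 h3 (by norm_num)
  rw [Finset.sum_const, nsmul_eq_mul, Real.rpow_neg hM0.le, ← div_eq_mul_inv] at h2
  have h4 := h1.trans_le h2
  rw [lt_div_iff₀ (by positivity)] at h4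
  linarith

/-- prefix-free sets of words -/
def PF (S : Finset (List ℤ)) : Prop := ∀ l ∈ S, ∀ l' ∈ S, ∀ t t', l ++ t = l' ++ t' → l = l'

lemma Stop_PF {A : Finset ℤ} (hpos : ∀ a ∈ A, 1 ≤ a) (M : ℕ) : PF (Stop A M) := by
  have key : ∀ l ∈ Stop A M, ∀ l' ∈ Stop A M, l <+: l' → l = l' := by
    intro l hl l' hl' hp
    by_contra hne
    rw [mem_Stop hpos] at hl hl'
    obtain ⟨t, rfl⟩ := hp
    have ht : t ≠ [] := by rintro rfl; simp at hne
    have h1 := hl'.2.2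
    rw [List.dropLast_append_of_ne_nil ht] at h1
    have hP : Pos l := fun a ha => hpos a (hl.1 a ha)
    have hPt : Pos t.dropLast := fun a ha => hpos a (hl'.1 a (by
      simp [List.mem_of_mem_dropLast ha]))
    have h2 := (D_append hP hPt).1
    have h3 := (Mt_basic hPt).2.2.2.1
    nlinarith [hl.2.1, (Mt_basic hP).2.2.2.1]
  intro l hl l' hl' t t' h
  rcases List.prefix_or_prefix_of_prefix (List.prefix_append l t) (h ▸ List.prefix_append l' t')
    with h1 | h1
  · exact key _ hl _ hl' h1
  · exact (key _ hl' _ hl h1).symm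

lemma Stop_le {A : Finset ℤ} (hpos : ∀ a ∈ A, 1 ≤ a) :
    ∃ C : ℕ, 1 ≤ C ∧ ∀ M : ℕ, 2 ≤ M → ∀ l ∈ Stop A M, Mt l 1 1 ≤ C * M := by
  obtain ⟨b, hb⟩ := A.bddAbove
  refine ⟨b.toNat + 1, by omega, fun M hM l hl => ?_⟩
  have hl' := (mem_Stop hpos).1 hl
  have hne : l ≠ [] := by rintro rfl; simp [Mt_nil] at hl'; omega
  obtain ⟨t, a, rfl⟩ := List.eq_nil_or_concat l |>.resolve_left hne
  rw [List.concat_eq_append] at *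
  rw [List.dropLast_concat] at hl'
  have ha : a ≤ b := hb (hl'.1 a (by simp))
  have hP : Pos t := fun x hx => hpos x (hl'.1 x (by simp [hx]))
  obtain ⟨h0, h1, h2, h3, h4, h5, h6⟩ := Mt_basic hP
  rw [Mt_app, Mt_c0, Mt_c1, Mt_nil]
  have h7 := hl'.2.2
  have hab : a ≤ b.toNat := by omega
  have : Mt t 1 1 * a ≤ M * b.toNat := by
    have : 1 ≤ a := hpos a (hl'.1 a (by simp))
    exact mul_le_mul h7.le hab (by omega) (by positivity)
  simp only [Matrix.one_apply_eq, Matrix.one_apply_ne (show (0 : Fin 2) ≠ 1 by decide)]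
  push_cast at this ⊢
  nlinarith

lemma block {A : Finset ℤ} (hpos : ∀ a ∈ A, 1 ≤ a)
    (hs : (sN : ENNReal) < dimH (CA (A : Set ℤ))) :
    ∃ C : ℕ, 1 ≤ C ∧ ∃ M0 : ℕ, ∀ M : ℕ, M0 ≤ M → ∀ ρ : ℝ, 0 ≤ ρ → ρ ≤ 1 → ∀ n : ℕ, 1 ≤ n →
      ∃ Ξ ⊆ Stop A M, ∃ M' ρ1 : ℝ, (M : ℝ) ≤ M' ∧ M' ≤ C * M ∧ 0 ≤ ρ1 ∧ ρ1 ≤ 1 ∧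
        (M : ℝ) ^ (307 / 156 : ℝ) ≤ C * n ^ 2 * Ξ.card ∧
        (∀ b ∈ Ξ, Mt b 1 1 ≤ C * M) ∧
        (∀ b ∈ Ξ, M' ≤ ρ * (Mt b 0 1 : ℤ) + (Mt b 1 1 : ℤ) ∧
          ρ * (Mt b 0 1 : ℤ) + (Mt b 1 1 : ℤ) ≤ M' * (1 + 1 / n) ∧
          ρ1 * (Mt b 1 1 : ℤ) ≤ (Mt b 1 0 : ℤ) ∧
          (Mt b 1 0 : ℤ) ≤ (ρ1 + 1 / n) * (Mt b 1 1 : ℤ)) := by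
  obtain ⟨M0, hM0⟩ := Stop_card hpos hs
  obtain ⟨C0, hC1, hC0⟩ := Stop_le hpos
  refine ⟨6 * C0, by omega, M0 + 2, fun M hM ρ hρ0 hρ1 n hn => ?_⟩
  have hcard := hM0 M (by omega)
  have hMp : (2 : ℝ) ≤ M := by exact_mod_cast (by omega : 2 ≤ M)
  have hnp : (1 : ℝ) ≤ n := by exact_mod_cast hn
  have hCp : (1 : ℝ) ≤ C0 := by exact_mod_cast hC1
  have hst : ∀ b ∈ Stop A M, (0 : ℝ) ≤ Mt b 0 1 ∧ (0 : ℝ) ≤ Mt b 1 0 ∧ (Mt b 0 1 : ℝ) ≤ Mt b 1 1 ∧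
      (Mt b 1 0 : ℝ) ≤ Mt b 1 1 ∧ (M : ℝ) ≤ Mt b 1 1 ∧ (Mt b 1 1 : ℝ) ≤ C0 * M := by
    intro b hb
    have hb1 := (mem_Stop hpos).1 hb
    have hb2 := hC0 M (by omega) b hb
    obtain ⟨h0, h1, h2, h3, h4, h5, h6⟩ := Mt_basic (l := b) (fun a ha => hpos a (hb1.1 a ha))
    have hb3 := hb1.2.1
    refine ⟨?_, ?_, ?_, ?_, ?_, ?_⟩ <;> exact_mod_cast (by assumption)
  let f : List ℤ → ℕ × ℕ := fun b =>
    (⌊((ρ * (Mt b 0 1 : ℤ) + (Mt b 1 1 : ℤ)) / M - 1) * n⌋₊,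
      ⌊((Mt b 1 0 : ℤ) / (Mt b 1 1 : ℤ) : ℝ) * n⌋₊)
  have hmaps : ∀ b ∈ Stop A M, f b ∈ Finset.range (2 * C0 * n) ×ˢ Finset.range (n + 1) := by
    intro b hb
    obtain ⟨h1, h2, h3, h4, h5, h6⟩ := hst b hb
    have hbp : (0 : ℝ) < Mt b 1 1 := by linarith
    simp only [f, Finset.mem_product, Finset.mem_range]
    constructor
    · rw [Nat.floor_lt']
      · push_cast
        have : (ρ * (Mt b 0 1 : ℤ) + (Mt b 1 1 : ℤ)) / M ≤ 2 * C0 := by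
          rw [div_le_iff₀ (by linarith)]
          nlinarith
        nlinarith
      · positivity
    · rw [Nat.floor_lt' (by omega)]
      push_cast
      have : ((Mt b 1 0 : ℤ) / (Mt b 1 1 : ℤ) : ℝ) ≤ 1 := by rw [div_le_one hbp]; exact h4
      nlinarith
  obtain ⟨⟨i, j⟩, hy, hyc⟩ := Finset.exists_le_card_fiber_of_nsmul_le_card_of_maps_to
    (b := (M : ℝ) ^ (307 / 156 : ℝ) / ((2 * C0 * n) * (n + 1))) hmaps
    ⟨(0, 0), by simp; omega⟩ (by
      rw [Finset.card_product, Finset.card_range, Finset.card_range, nsmul_eq_mul]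
      push_cast
      rw [mul_div_cancel₀ _ (by positivity)]
      exact hcard)
  simp only [Finset.mem_product, Finset.mem_range] at hy
  refine ⟨{x ∈ Stop A M | f x = (i, j)}, Finset.filter_subset _ _, M * (1 + i / n), j / n,
    ?_, ?_, by positivity, ?_, ?_, ?_, ?_⟩
  · have : (0 : ℝ) ≤ i / n := by positivity
    nlinarith
  · have : (i : ℝ) / n ≤ 2 * C0 := by
      rw [div_le_iff₀ (by positivity)]
      exact_mod_cast hy.1.le
    push_cast
    nlinarith
  · rw [div_le_one (by positivity)]; exact_mod_cast (by omega : j ≤ n)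
  · rw [div_le_iff₀ (by positivity)] at hyc
    refine hyc.trans ?_
    push_cast
    have hc : (0 : ℝ) ≤ ({x ∈ Stop A M | f x = (i, j)}.card : ℝ) := by positivity
    have : (2 * C0 * n : ℝ) * (n + 1) ≤ 6 * C0 * n ^ 2 := by nlinarith [mul_pos (by linarith : (0 : ℝ) < C0) (by linarith : (0 : ℝ) < n)]
    nlinarith
  · intro b hb
    have := hC0 M (by omega) b (Finset.mem_filter.1 hb).1
    push_cast
    nlinarith [(by positivity : (0 : ℤ) ≤ C0 * M)]
  · intro b hb
    obtain ⟨hb, hf⟩ := Finset.mem_filter.1 hb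
    obtain ⟨h1, h2, h3, h4, h5, h6⟩ := hst b hb
    have hbp : (0 : ℝ) < Mt b 1 1 := by linarith
    simp only [f, Prod.mk.injEq] at hf
    have hMp' : (0 : ℝ) < M := by linarith
    have hv : 0 ≤ ((ρ * (Mt b 0 1 : ℤ) + (Mt b 1 1 : ℤ)) / M - 1) * n := by
      apply mul_nonneg _ (by positivity)
      rw [sub_nonneg, le_div_iff₀ hMp']
      nlinarith
    obtain ⟨f1, f2⟩ := (Nat.floor_eq_iff hv).1 hf.1
    obtain ⟨f3, f4⟩ := (Nat.floor_eq_iff (by positivity)).1 hf.2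
    set v : ℝ := ρ * (Mt b 0 1 : ℤ) + (Mt b 1 1 : ℤ) with hvdef
    have hnp' : (0 : ℝ) < n := by linarith
    refine ⟨?_, ?_, ?_, ?_⟩
    · rw [← div_le_iff₀ hnp', le_sub_iff_add_le, le_div_iff₀ hMp'] at f1
      linarith
    · rw [← lt_div_iff₀ hnp', sub_lt_iff_lt_add, div_lt_iff₀ hMp'] at f2
      have e : (M : ℝ) * (1 + i / n) * (1 + 1 / n) = ((i + 1) / n + 1) * M + M * (i / n) * (1 / n) := by ring
      have : (0 : ℝ) ≤ M * (i / n) * (1 / n) := by positivity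
      linarith
    · rw [← div_le_iff₀ hnp', le_div_iff₀ hbp] at f3
      exact f3
    · rw [← lt_div_iff₀ hnp', div_lt_iff₀ hbp] at f4
      rw [← add_div]; exact f4.le

def cat (S T : Finset (List ℤ)) : Finset (List ℤ) := Finset.image₂ (fun l t => l ++ t) S T

lemma mem_cat {S T : Finset (List ℤ)} {w : List ℤ} :
    w ∈ cat S T ↔ ∃ l ∈ S, ∃ t ∈ T, l ++ t = w := by simp [cat, Finset.mem_image₂]

lemma cat_assoc (S T U : Finset (List ℤ)) : cat (cat S T) U = cat S (cat T U) :=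
  Finset.image₂_assoc (fun a b c => List.append_assoc a b c)

lemma PF.inj {S T : Finset (List ℤ)} (h : PF S) :
    Set.InjOn (fun p : List ℤ × List ℤ => p.1 ++ p.2) (S ×ˢ T : Finset _) := by
  rintro ⟨l, t⟩ h1 ⟨l', t'⟩ h2 e
  simp only [Finset.coe_product, Set.mem_prod, Finset.mem_coe] at h1 h2
  have := h l h1.1 l' h2.1 t t' e
  subst this
  simpa using e

lemma cat_eq (S T : Finset (List ℤ)) :
    cat S T = (S ×ˢ T).image (fun p : List ℤ × List ℤ => p.1 ++ p.2) := by
  ext w; simp [mem_cat, Finset.mem_image]; tauto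

lemma PF.sum_cat {β : Type*} [AddCommMonoid β] {S T : Finset (List ℤ)} (h : PF S)
    (F : List ℤ → β) : ∑ w ∈ cat S T, F w = ∑ l ∈ S, ∑ t ∈ T, F (l ++ t) := by
  rw [cat_eq, Finset.sum_image (fun a ha b hb e => h.inj ha hb e), Finset.sum_product]

lemma PF.card_cat {S T : Finset (List ℤ)} (h : PF S) : (cat S T).card = S.card * T.card := by
  rw [cat_eq, Finset.card_image_of_injOn h.inj, Finset.card_product]

lemma PF.cat {S T : Finset (List ℤ)} (h : PF S) (h' : PF T) : PF (cat S T) := by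
  intro w hw w' hw' t t' e
  obtain ⟨l, hl, m, hm, rfl⟩ := mem_cat.1 hw
  obtain ⟨l', hl', m', hm', rfl⟩ := mem_cat.1 hw'
  rw [List.append_assoc, List.append_assoc] at e
  have := h l hl l' hl' _ _ e
  subst this
  rw [List.append_cancel_left_eq] at e
  rw [h' m hm m' hm' _ _ e]

structure Chn (A : Finset ℤ) (K j : ℕ) (Λ : Finset (List ℤ)) (P ρ : ℝ) : Prop where
  let_mem : ∀ l ∈ Λ, ∀ a ∈ l, a ∈ A
  pf : PF Λ
  hP : (K : ℝ) ^ j ≤ P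
  hρ0 : 0 ≤ ρ
  hρ1 : ρ ≤ 1
  hcard : P ^ (49 / 25 : ℝ) ≤ Λ.card
  hlow : ∀ l ∈ Λ, P ≤ (Mt l 1 1 : ℤ)
  hup : ∀ l ∈ Λ, (Mt l 1 1 : ℤ) ≤ (2 - (1 / 2) ^ j) * P
  hr1 : ∀ l ∈ Λ, ρ * (Mt l 1 1 : ℤ) ≤ (Mt l 1 0 : ℤ)
  hr2 : ∀ l ∈ Λ, (Mt l 1 0 : ℤ) ≤ (ρ + 3 / 2 ^ (j + 4)) * (Mt l 1 1 : ℤ)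

lemma Chn.zero (A : Finset ℤ) (K : ℕ) : Chn A K 0 {[]} 1 0 where
  let_mem := by simp
  pf := by intro l hl l' hl'; simp at hl hl'; simp [hl, hl']
  hP := by simp
  hρ0 := le_rfl
  hρ1 := zero_le_one
  hcard := by simp
  hlow := by simp [Mt_nil]
  hup := by simp [Mt_nil]; norm_num
  hr1 := by simp [Mt_nil]
  hr2 := by simp [Mt_nil]; norm_num

lemma blk_real {c d b00 b01 b10 b11 P M' ρ ρ1 ε : ℝ} (hM' : 0 < M') (hP : 0 < P) (hr0 : 0 ≤ ρ)
    (a1 : P ≤ d) (a2 : d ≤ (2 - ε) * P) (a3 : ρ * d ≤ c)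
    (a4 : c ≤ (ρ + 3 * (ε * (1 / 16))) * d) (a5 : c ≤ d) (a6 : 0 ≤ c)
    (b1 : M' ≤ ρ * b01 + b11) (b2 : ρ * b01 + b11 ≤ M' * (1 + ε * (1 / 32)))
    (b3 : ρ1 * b11 ≤ b10) (b4 : b10 ≤ (ρ1 + ε * (1 / 32)) * b11) (b5 : 1 ≤ b11) (b6 : 0 ≤ b01)
    (b7 : b01 ≤ b11) (hdet : b00 * b11 - b01 * b10 = 1 ∨ b00 * b11 - b01 * b10 = -1)
    (hε0 : 0 < ε) (hε1 : ε ≤ 1) (hε : 32 ≤ ε * b11) :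
    P * M' ≤ c * b01 + d * b11 ∧ c * b01 + d * b11 ≤ (2 - ε * (1 / 2)) * (P * M') ∧
    (ρ1 - ε * (1 / 32)) * (c * b01 + d * b11) ≤ c * b00 + d * b10 ∧
    c * b00 + d * b10 ≤ (ρ1 + 2 * (ε * (1 / 32))) * (c * b01 + d * b11) := by
  have hd0 : 0 < d := by linarith
  have hb0 : 0 < b11 := by linarith
  have hT : c ≤ c * b01 + d * b11 := by nlinarith [mul_nonneg a6 b6]
  have hT0 : 0 ≤ c * b01 + d * b11 := by linarith
  have h1 : 1 ≤ b11 * (ε * (1 / 32)) := by linarith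
  have g3 : c ≤ b11 * (ε * (1 / 32)) * (c * b01 + d * b11) :=
    hT.trans (le_mul_of_one_le_left hT0 h1)
  have g0 : b11 * (c * b00 + d * b10) =
    b10 * (c * b01 + d * b11) + c * (b00 * b11 - b01 * b10) := by ring
  refine ⟨?_, ?_, ?_, ?_⟩
  · calc P * M' ≤ d * (ρ * b01 + b11) := by gcongr
      _ ≤ c * b01 + d * b11 := by nlinarith
  · calc c * b01 + d * b11 ≤ d * ((ρ * b01 + b11) * (1 + 3 * (ε * (1 / 16)))) := by
          have e1 : c * b01 ≤ (ρ + 3 * (ε * (1 / 16))) * d * b01 := by gcongr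
          have e2 : 0 ≤ d * (3 * (ε * (1 / 16))) * (b11 - b01) :=
            mul_nonneg (by positivity) (by linarith)
          have e3 : 0 ≤ d * (ρ * b01) * (3 * (ε * (1 / 16))) := by positivity
          linarith
      _ ≤ ((2 - ε) * P) * ((M' * (1 + ε * (1 / 32))) * (1 + 3 * (ε * (1 / 16)))) := by
          have : 0 < 2 - ε := by linarith
          have : 0 ≤ ρ * b01 + b11 := by positivity
          gcongr
      _ = (P * M') * ((2 - ε) * ((1 + ε * (1 / 32)) * (1 + 3 * (ε * (1 / 16))))) := by ring
      _ ≤ (P * M') * (2 - ε * (1 / 2)) := by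
          gcongr
          have : (1 + ε * (1 / 32)) * (1 + 3 * (ε * (1 / 16))) ≤ 1 + ε * (1 / 4) := by nlinarith
          nlinarith
      _ = _ := by ring
  · have g1 : b10 * (c * b01 + d * b11) - c ≤ b11 * (c * b00 + d * b10) := by
      rw [g0]; rcases hdet with h | h <;> rw [h] <;> linarith
    have g2 : ρ1 * b11 * (c * b01 + d * b11) ≤ b10 * (c * b01 + d * b11) := by gcongr
    have e1 : 0 ≤ b11 * (c * b00 + d * b10 - (ρ1 - ε * (1 / 32)) * (c * b01 + d * b11)) := by
      linarith
    have := nonneg_of_mul_nonneg_right e1 hb0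
    linarith
  · have g1 : b11 * (c * b00 + d * b10) ≤ b10 * (c * b01 + d * b11) + c := by
      rw [g0]; rcases hdet with h | h <;> rw [h] <;> linarith
    have g2 : b10 * (c * b01 + d * b11) ≤ (ρ1 + ε * (1 / 32)) * b11 * (c * b01 + d * b11) := by
      gcongr
    have e1 : 0 ≤ b11 * ((ρ1 + 2 * (ε * (1 / 32))) * (c * b01 + d * b11) - (c * b00 + d * b10)) := by
      linarith
    have := nonneg_of_mul_nonneg_right e1 hb0
    linarith

lemma step {A : Finset ℤ} (hpos : ∀ a ∈ A, 1 ≤ a)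
    (hs : (sN : ENNReal) < dimH (CA (A : Set ℤ))) :
    ∃ C K : ℕ, 1 ≤ C ∧ 2 ≤ K ∧ ∀ (j : ℕ) (Λ : Finset (List ℤ)) (P ρ : ℝ), Chn A K j Λ P ρ →
      ∀ M : ℕ, K ^ (j + 1) ≤ M → ∃ (Ξ : Finset (List ℤ)) (M' ρ' : ℝ),
        (M : ℝ) ≤ M' ∧ M' ≤ C * M ∧ M' ^ (49 / 25 : ℝ) ≤ Ξ.card ∧
        (∀ b ∈ Ξ, (∀ a ∈ b, a ∈ A) ∧ (M : ℤ) ≤ Mt b 1 1 ∧ Mt b 1 1 ≤ C * M) ∧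
        Chn A K (j + 1) (cat Λ Ξ) (P * M') ρ' := by
  obtain ⟨C, hC1, M0, hB⟩ := block hpos hs
  have hC : (1 : ℝ) ≤ C := by exact_mod_cast hC1
  obtain ⟨K1, hK1⟩ : ∃ K1 : ℕ, ∀ x : ℝ, (K1 : ℝ) ≤ x → C ^ 3 * 2 ^ 12 ≤ x ^ (31 / 3900 : ℝ) := by
    have := (tendsto_rpow_atTop (show (0 : ℝ) < 31 / 3900 by norm_num)).eventually_ge_atTop
      ((C : ℝ) ^ 3 * 2 ^ 12)
    obtain ⟨B, hBB⟩ := eventually_atTop.1 this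
    exact ⟨⌈B⌉₊, fun x hx => hBB x ((Nat.le_ceil _).trans hx)⟩
  refine ⟨C, K1 + M0 + 64, hC1, by omega, fun j Λ P ρ hI M hM => ?_⟩
  set K := K1 + M0 + 64 with hK
  have hKM : K ≤ M := le_trans (by
    calc K = K ^ 1 := (pow_one K).symm
      _ ≤ K ^ (j + 1) := Nat.pow_le_pow_right (by omega) (by omega)) hM
  obtain ⟨Ξ, hΞ, M', ρ1, hM1, hM2, hρ0, hρ1, hc, hD, hb⟩ := hB M (by omega) ρ hI.hρ0 hI.hρ1
    (2 ^ (j + 5)) Nat.one_le_two_pow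
  have hMr : ((K : ℝ) ^ (j + 1)) ≤ M := by exact_mod_cast hM
  have hKr : (64 : ℝ) ≤ K := by exact_mod_cast (by omega : 64 ≤ K)
  have hMn : (2 : ℝ) ^ (j + 5) ≤ M := by
    refine le_trans ?_ hMr
    calc (2 : ℝ) ^ (j + 5) ≤ 64 ^ (j + 1) := by
          rw [show (64 : ℝ) = 2 ^ 6 by norm_num, ← pow_mul]
          exact pow_le_pow_right₀ (by norm_num) (by omega)
      _ ≤ _ := by gcongr
  have hMpos : (1 : ℝ) ≤ M := le_trans (by exact_mod_cast Nat.one_le_two_pow) hMn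
  have hM'pos : 0 < M' := by linarith
  have hPpos : (0 : ℝ) < P := lt_of_lt_of_le (by positivity) hI.hP
  have hΞc : M' ^ (49 / 25 : ℝ) ≤ Ξ.card := by
    have h1 : C ^ 3 * (2 ^ (j + 5)) ^ 2 ≤ (M : ℝ) ^ (31 / 3900 : ℝ) := by
      calc (C : ℝ) ^ 3 * (2 ^ (j + 5)) ^ 2 ≤ (C ^ 3 * 2 ^ 12) ^ (j + 1) := by
            rw [mul_pow]
            have : (C : ℝ) ^ 3 ≤ (C ^ 3) ^ (j + 1) := by
              calc (C : ℝ) ^ 3 = (C ^ 3) ^ 1 := by ring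
                _ ≤ _ := pow_le_pow_right₀ (one_le_pow₀ hC) (by omega)
            have h2 : ((2 : ℝ) ^ (j + 5)) ^ 2 ≤ (2 ^ 12) ^ (j + 1) := by
              rw [← pow_mul, ← pow_mul]
              exact pow_le_pow_right₀ (by norm_num) (by omega)
            gcongr
        _ ≤ ((K : ℝ) ^ (31 / 3900 : ℝ)) ^ (j + 1) := by
            have := hK1 K (by exact_mod_cast (by omega : K1 ≤ K))
            gcongr
        _ = ((K : ℝ) ^ (j + 1)) ^ (31 / 3900 : ℝ) := by
            rw [← Real.rpow_natCast, ← Real.rpow_natCast, ← Real.rpow_mul (by positivity),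
              ← Real.rpow_mul (by positivity), mul_comm]
        _ ≤ _ := by gcongr
    have h2 : (M : ℝ) ^ (307 / 156 : ℝ) = M ^ (49 / 25 : ℝ) * M ^ (31 / 3900 : ℝ) := by
      rw [← Real.rpow_add (by positivity)]; norm_num
    have h3 : M' ^ (49 / 25 : ℝ) ≤ C ^ 2 * (M : ℝ) ^ (49 / 25 : ℝ) := by
      calc M' ^ (49 / 25 : ℝ) ≤ (C * M : ℝ) ^ (49 / 25 : ℝ) := by gcongr
        _ = (C : ℝ) ^ (49 / 25 : ℝ) * (M : ℝ) ^ (49 / 25 : ℝ) :=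
            Real.mul_rpow (by positivity) (by positivity)
        _ ≤ _ := by
            gcongr
            rw [← Real.rpow_natCast]
            exact Real.rpow_le_rpow_of_exponent_le hC (by norm_num)
    rw [h2] at hc
    push_cast at hc
    have hx : 0 < (M : ℝ) ^ (49 / 25 : ℝ) := by positivity
    have h4 : (M : ℝ) ^ (49 / 25 : ℝ) * (C ^ 3 * (2 ^ (j + 5)) ^ 2) ≤
        C * (2 ^ (j + 5)) ^ 2 * (Ξ.card : ℝ) := le_trans (by gcongr) hc
    have h5 : (C * (2 ^ (j + 5)) ^ 2) * (C ^ 2 * (M : ℝ) ^ (49 / 25 : ℝ)) ≤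
        (C * (2 ^ (j + 5)) ^ 2) * (Ξ.card : ℝ) := by linarith
    exact h3.trans (le_of_mul_le_mul_left h5 (by positivity))
  have hbA : ∀ b ∈ Ξ, (∀ a ∈ b, a ∈ A) ∧ (M : ℤ) ≤ Mt b 1 1 := fun b hb =>
    ⟨((mem_Stop hpos).1 (hΞ hb)).1, ((mem_Stop hpos).1 (hΞ hb)).2.1⟩
  have hΞpf : PF Ξ := fun l hl l' hl' => Stop_PF hpos M l (hΞ hl) l' (hΞ hl')
  refine ⟨Ξ, M', max (ρ1 - 1 / 2 ^ (j + 5)) 0, hM1, hM2, hΞc,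
    fun b hb => ⟨(hbA b hb).1, (hbA b hb).2, hD b hb⟩, ?_⟩
  have hn0 : (0 : ℝ) < 1 / 2 ^ (j + 5) := by positivity
  have hn1 : (1 : ℝ) / 2 ^ (j + 5) = (1 / 2) ^ j * (1 / 32) := by
    rw [pow_add, one_div_pow]; norm_num; ring
  have hε1 : ((1 : ℝ) / 2) ^ j ≤ 1 := pow_le_one₀ (by norm_num) (by norm_num)
  have hε0 : (0 : ℝ) < (1 / 2) ^ j := by positivity
  -- facts for each product word
  have main : ∀ l ∈ Λ, ∀ b ∈ Ξ, P * M' ≤ (Mt (l ++ b) 1 1 : ℤ) ∧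
      (Mt (l ++ b) 1 1 : ℤ) ≤ (2 - (1 / 2) ^ (j + 1)) * (P * M') ∧
      (ρ1 - 1 / 2 ^ (j + 5)) * (Mt (l ++ b) 1 1 : ℤ) ≤ (Mt (l ++ b) 1 0 : ℤ) ∧
      (Mt (l ++ b) 1 0 : ℤ) ≤ (ρ1 + 2 / 2 ^ (j + 5)) * (Mt (l ++ b) 1 1 : ℤ) := by
    intro l hl b hbΞ
    have hPl : Pos l := fun a ha => hpos a (hI.let_mem l hl a ha)
    have hPb : Pos b := fun a ha => hpos a ((hbA b hbΞ).1 a ha)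
    have a1 := hI.hlow l hl
    have a2 := hI.hup l hl
    have a3 := hI.hr1 l hl
    have a4 := hI.hr2 l hl
    obtain ⟨b1, b2, b3, b4⟩ := hb b hbΞ
    push_cast at b2 b4
    have b5 : (M : ℝ) ≤ (Mt b 1 1 : ℤ) := by exact_mod_cast (hbA b hbΞ).2
    have b6 : (0 : ℝ) ≤ (Mt b 0 1 : ℤ) := by exact_mod_cast (Mt_basic hPb).2.2.1
    have b7 : ((Mt b 0 1 : ℤ) : ℝ) ≤ (Mt b 1 1 : ℤ) := by exact_mod_cast (Mt_basic hPb).2.2.2.2.2.1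
    have a5 : ((Mt l 1 0 : ℤ) : ℝ) ≤ (Mt l 1 1 : ℤ) := by exact_mod_cast (Mt_basic hPl).2.2.2.2.1
    have a6 : (0 : ℝ) ≤ (Mt l 1 0 : ℤ) := by exact_mod_cast (Mt_basic hPl).2.1
    have eD : ((Mt (l ++ b) 1 1 : ℤ) : ℝ) = (Mt l 1 0 : ℤ) * (Mt b 0 1 : ℤ) +
      (Mt l 1 1 : ℤ) * (Mt b 1 1 : ℤ) := by rw [Mt_app]; push_cast; rfl
    have eR : ((Mt (l ++ b) 1 0 : ℤ) : ℝ) = (Mt l 1 0 : ℤ) * (Mt b 0 0 : ℤ) +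
      (Mt l 1 1 : ℤ) * (Mt b 1 0 : ℤ) := by rw [Mt_app]; push_cast; rfl
    have hdet : ((Mt b 0 0 : ℤ) : ℝ) * (Mt b 1 1 : ℤ) - (Mt b 0 1 : ℤ) * (Mt b 1 0 : ℤ)
      = (-1) ^ b.length := by exact_mod_cast Mt_det b
    have hdet1 : |((-1 : ℝ)) ^ b.length| = 1 := by simp
    rw [← hdet, abs_eq (by norm_num)] at hdet1
    rw [eD, eR]
    have h16 : (3 : ℝ) / 2 ^ (j + 4) = 3 * ((1 / 2) ^ j * (1 / 16)) := by
      rw [pow_add, one_div_pow]; norm_num; ring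
    rw [h16] at a4
    rw [hn1] at b2 b4 ⊢
    have h2n : (2 : ℝ) / 2 ^ (j + 5) = 2 * ((1 / 2) ^ j * (1 / 32)) := by rw [← hn1]; ring
    rw [h2n]
    have hMn' : 32 ≤ (1 / 2 : ℝ) ^ j * (Mt b 1 1 : ℤ) := by
      have : (2 : ℝ) ^ j * 32 ≤ (Mt b 1 1 : ℤ) := by
        rw [pow_add] at hMn; norm_num at hMn; linarith
      rw [one_div_pow]
      rw [one_div, inv_mul_eq_div, le_div_iff₀ (by positivity)]; linarith
    rw [pow_succ (1 / 2 : ℝ) j]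
    exact blk_real hM'pos hPpos hI.hρ0 a1 a2 a3 a4 a5 a6 b1 b2 b3 b4 (by linarith) b6 b7 hdet1
      hε0 hε1 (by linarith)
  refine ⟨?_, hI.pf.cat hΞpf, ?_, le_max_right _ _, ?_, ?_, ?_, ?_, ?_, ?_⟩
  · intro w hw
    obtain ⟨l, hl, b, hb, rfl⟩ := mem_cat.1 hw
    intro a ha
    rcases List.mem_append.1 ha with h | h
    · exact hI.let_mem l hl a h
    · exact (hbA b hb).1 a h
  · have h1P : 1 ≤ P := le_trans (one_le_pow₀ (by linarith)) hI.hP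
    nlinarith
  · rw [max_le_iff]; constructor <;> linarith
  · rw [hI.pf.card_cat, Real.mul_rpow hPpos.le hM'pos.le]
    push_cast
    exact mul_le_mul hI.hcard hΞc (by positivity) (by positivity)
  · intro w hw
    obtain ⟨l, hl, b, hb, rfl⟩ := mem_cat.1 hw
    exact (main l hl b hb).1
  · intro w hw
    obtain ⟨l, hl, b, hb, rfl⟩ := mem_cat.1 hw
    exact (main l hl b hb).2.1
  · intro w hw
    obtain ⟨l, hl, b, hb, rfl⟩ := mem_cat.1 hw
    have hPw : Pos (l ++ b) := Pos.append (fun a ha => hpos a (hI.let_mem l hl a ha))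
      (fun a ha => hpos a ((hbA b hb).1 a ha))
    rcases max_cases (ρ1 - 1 / 2 ^ (j + 5)) 0 with h | h
    · rw [h.1]; exact (main l hl b hb).2.2.1
    · rw [h.1, zero_mul]; exact_mod_cast (Mt_basic hPw).2.1
  · intro w hw
    obtain ⟨l, hl, b, hb, rfl⟩ := mem_cat.1 hw
    have hPw : Pos (l ++ b) := Pos.append (fun a ha => hpos a (hI.let_mem l hl a ha))
      (fun a ha => hpos a ((hbA b hb).1 a ha))
    have h1 : (0 : ℝ) ≤ (Mt (l ++ b) 1 1 : ℤ) := by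
      exact_mod_cast (zero_le_one.trans (Mt_basic hPw).2.2.2.1)
    refine (main l hl b hb).2.2.2.trans (mul_le_mul_of_nonneg_right ?_ h1)
    have e1 := le_max_left (ρ1 - 1 / 2 ^ (j + 5)) 0
    have e2 : (3 : ℝ) / 2 ^ (j + 1 + 4) = 2 / 2 ^ (j + 5) + 1 / 2 ^ (j + 5) := by
      rw [show j + 1 + 4 = j + 5 by ring]; ring
    rw [e2]; linarith

structure CD (A : Finset ℤ) where
  C : ℕ
  K : ℕ
  Λ : ℕ → Finset (List ℤ)
  Ξ : ℕ → Finset (List ℤ)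
  P : ℕ → ℝ
  ρ : ℕ → ℝ
  hC : 1 ≤ C
  hK : 2 ≤ K
  hP0 : P 0 = 1
  chn : ∀ j, Chn A K j (Λ j) (P j) (ρ j)
  hΛ : ∀ j, Λ (j + 1) = cat (Λ j) (Ξ j)
  hP1 : ∀ j, P j ^ 2 ≤ P (j + 1)
  hP2 : ∀ j, P (j + 1) ≤ C * P j ^ 2
  hΞc : ∀ j, P j ^ (49 / 25 : ℝ) ≤ (Ξ j).card
  hΞm : ∀ j, ∀ b ∈ Ξ j, ∀ a ∈ b, a ∈ A
  hΞ1 : ∀ j, ∀ b ∈ Ξ j, P j ≤ (Mt b 1 1 : ℤ)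
  hΞ2 : ∀ j, ∀ b ∈ Ξ j, (Mt b 1 1 : ℤ) ≤ C * P j
  tuned : ∀ (J M : ℕ), K * P J ≤ M → ∃ (X : Finset (List ℤ)) (M' ρ' : ℝ),
    (M : ℝ) ≤ M' ∧ M' ≤ C * M ∧ (∀ b ∈ X, ∀ a ∈ b, a ∈ A) ∧
    Chn A K (J + 1) (cat (Λ J) X) (P J * M') ρ'

lemma CD.exists {A : Finset ℤ} (hpos : ∀ a ∈ A, 1 ≤ a)
    (hs : (sN : ENNReal) < dimH (CA (A : Set ℤ))) : Nonempty (CD A) := by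
  obtain ⟨C, K, hC, hK, hstep⟩ := step hpos hs
  have hCr : (1 : ℝ) ≤ C := by exact_mod_cast hC
  have hKr : (2 : ℝ) ≤ K := by exact_mod_cast hK
  have hM : ∀ {j : ℕ} {Λ : Finset (List ℤ)} {P ρ : ℝ} (M : ℕ), Chn A K j Λ P ρ → K * P ≤ M →
      K ^ (j + 1) ≤ M := by
    intro j Λ P ρ M h hM
    have h1 : (K : ℝ) ^ (j + 1) ≤ M := le_trans (by
      rw [pow_succ, mul_comm]
      exact mul_le_mul_of_nonneg_left h.hP (by positivity)) hM
    exact_mod_cast h1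
  let σ : ℕ → Type := fun j => {s : Finset (List ℤ) × ℝ × ℝ // Chn A K j s.1 s.2.1 s.2.2}
  have hnext : ∀ j (s : σ j), ∃ t : σ (j + 1), ∃ X : Finset (List ℤ),
      t.1.1 = cat s.1.1 X ∧ s.1.2.1 ^ 2 ≤ t.1.2.1 ∧ t.1.2.1 ≤ (2 * C * K : ℕ) * s.1.2.1 ^ 2 ∧
      s.1.2.1 ^ (49 / 25 : ℝ) ≤ X.card ∧ (∀ b ∈ X, ∀ a ∈ b, a ∈ A) ∧
      (∀ b ∈ X, s.1.2.1 ≤ (Mt b 1 1 : ℤ)) ∧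
      (∀ b ∈ X, (Mt b 1 1 : ℤ) ≤ (2 * C * K : ℕ) * s.1.2.1) := by
    rintro j ⟨⟨Λ, P, ρ⟩, h⟩
    simp only at h
    have hP1 : 1 ≤ P := le_trans (one_le_pow₀ (by linarith)) h.hP
    obtain ⟨Ξ, M', ρ', h1, h2, h3, h4, h5⟩ := hstep j Λ P ρ h ⌈(K * P : ℝ)⌉₊
      (hM _ h (Nat.le_ceil _))
    have hc1 : (K * P : ℝ) ≤ (⌈(K * P : ℝ)⌉₊ : ℝ) := Nat.le_ceil _
    have hc2 : (⌈(K * P : ℝ)⌉₊ : ℝ) ≤ 2 * (K * P) := by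
      have := Nat.ceil_lt_add_one (show (0 : ℝ) ≤ K * P by positivity)
      nlinarith
    have hPM : P ≤ (⌈(K * P : ℝ)⌉₊ : ℝ) := by nlinarith
    have hCM : (C : ℝ) * (⌈(K * P : ℝ)⌉₊ : ℝ) ≤ 2 * C * K * P := by nlinarith
    refine ⟨⟨⟨cat Λ Ξ, P * M', ρ'⟩, h5⟩, Ξ, rfl, ?_, ?_, ?_, fun b hb => (h4 b hb).1, ?_, ?_⟩
    · simp only; nlinarith
    · simp only; push_cast; nlinarith
    · refine le_trans ?_ h3
      simp only
      gcongr
      linarith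
    · intro b hb
      have : (((⌈(K * P : ℝ)⌉₊ : ℕ) : ℤ) : ℝ) ≤ (Mt b 1 1 : ℤ) := by exact_mod_cast (h4 b hb).2.1
      push_cast at this
      simp only; linarith
    · intro b hb
      have : ((Mt b 1 1 : ℤ) : ℝ) ≤ ((C * (⌈(K * P : ℝ)⌉₊ : ℕ) : ℤ) : ℝ) := by
        exact_mod_cast (h4 b hb).2.2
      push_cast at this
      simp only; push_cast; linarith
  choose nx X hX1 hX2 hX3 hX4 hX5 hX6 hX7 using hnext
  let st : ∀ j, σ j := fun j => Nat.rec (⟨⟨{[]}, 1, 0⟩, Chn.zero A K⟩ : σ 0) (fun j s => nx j s) j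
  have hst : ∀ j, st (j + 1) = nx j (st j) := fun j => rfl
  refine ⟨⟨2 * C * K, K, fun j => (st j).1.1, fun j => X j (st j), fun j => (st j).1.2.1,
    fun j => (st j).1.2.2, ?_, hK, rfl, fun j => (st j).2, fun j => ?_, fun j => ?_, fun j => ?_,
    fun j => hX4 j _, fun j => hX5 j _, fun j => hX6 j _, fun j => hX7 j _, ?_⟩⟩
  · nlinarith
  · rw [hst]; exact hX1 j _
  · rw [hst]; exact hX2 j _
  · rw [hst]; exact hX3 j _
  · intro J M hJ
    obtain ⟨Ξ, M', ρ', h1, h2, h3, h4, h5⟩ := hstep J _ _ _ (st J).2 M (hM _ (st J).2 hJ)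
    refine ⟨Ξ, M', ρ', h1, h2.trans ?_, fun b hb => (h4 b hb).1, h5⟩
    push_cast
    have : (0 : ℝ) ≤ C * M := by positivity
    nlinarith

lemma CD.fac {A : Finset ℤ} (c : CD A) (j i : ℕ) : ∃ S : Finset (List ℤ),
    (∀ b ∈ S, ∀ a ∈ b, a ∈ A) ∧ c.Λ (j + i) = cat (c.Λ j) S := by
  induction i with
  | zero => exact ⟨{[]}, by simp, by ext w; simp [mem_cat]⟩
  | succ i ih =>
    obtain ⟨S, h1, h2⟩ := ih
    refine ⟨cat S (c.Ξ (j + i)), ?_, ?_⟩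
    · intro w hw
      obtain ⟨l, hl, b, hb, rfl⟩ := mem_cat.1 hw
      intro a ha
      rcases List.mem_append.1 ha with h | h
      · exact h1 l hl a h
      · exact c.hΞm _ b hb a h
    · rw [← add_assoc, c.hΛ, h2, cat_assoc]

lemma CD.one_le {A : Finset ℤ} (c : CD A) (j : ℕ) : 1 ≤ c.P j :=
  le_trans (one_le_pow₀ (by exact_mod_cast (by have := c.hK; omega : 1 ≤ c.K))) (c.chn j).hP

lemma CD.tendsto {A : Finset ℤ} (c : CD A) : Tendsto c.P atTop atTop := by
  refine tendsto_atTop_mono (fun j => (c.chn j).hP) (tendsto_pow_atTop_atTop_of_one_lt ?_)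
  exact_mod_cast (by have := c.hK; omega : 1 < c.K)

/-- last index below a threshold -/
lemma CD.exists_max {A : Finset ℤ} (c : CD A) {x : ℝ} (hx : 1 ≤ x) :
    ∃ J, c.P J ≤ x ∧ x < c.P (J + 1) := by
  classical
  have hex : ∃ j, x < c.P j := (c.tendsto.eventually_gt_atTop x).exists
  obtain ⟨k, hk⟩ : ∃ k, Nat.find hex = k + 1 := by
    refine Nat.exists_eq_succ_of_ne_zero fun h0 => ?_
    have := Nat.find_spec hex
    rw [h0, c.hP0] at this; linarith
  refine ⟨k, ?_, hk ▸ Nat.find_spec hex⟩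
  have := Nat.find_min hex (m := k) (by omega)
  linarith

abbrev M2 (W : ℕ) := Matrix (Fin 2) (Fin 2) (ZMod W)

def uA (W : ℕ) (a : ZMod W) : (M2 W)ˣ :=
  ⟨!![0, 1; 1, a], !![-a, 1; 1, 0], by
    ext i j; fin_cases i <;> fin_cases j <;> simp [Matrix.mul_apply, Fin.sum_univ_two], by
    ext i j; fin_cases i <;> fin_cases j <;> simp [Matrix.mul_apply, Fin.sum_univ_two]⟩

def Kg (W : ℕ) : Subgroup (M2 W)ˣ := Subgroup.closure {uA W 1, uA W 2}

def uT (W : ℕ) (k : ZMod W) : (M2 W)ˣ :=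
  ⟨!![1, k; 0, 1], !![1, -k; 0, 1], by
    ext i j; fin_cases i <;> fin_cases j <;> simp [Matrix.mul_apply, Fin.sum_univ_two], by
    ext i j; fin_cases i <;> fin_cases j <;> simp [Matrix.mul_apply, Fin.sum_univ_two]⟩

lemma uT_one (W : ℕ) : (uA W 1)⁻¹ * uA W 2 = uT W 1 := by
  ext i j
  fin_cases i <;> fin_cases j <;> simp [uA, uT, Matrix.mul_apply, Fin.sum_univ_two]
  norm_num

lemma uT_pow (W : ℕ) (k : ℕ) : uT W 1 ^ k = uT W k := by
  induction k with
  | zero => ext i j; fin_cases i <;> fin_cases j <;> simp [uT]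
  | succ k ih =>
    rw [pow_succ, ih]
    ext i j
    fin_cases i <;> fin_cases j <;>
      simp [uT, Matrix.mul_apply, Fin.sum_univ_two, add_comm]

lemma uT_mem (W : ℕ) (k : ℕ) : uT W k ∈ Kg W := by
  rw [← uT_pow, ← uT_one]
  exact pow_mem (mul_mem (inv_mem (Subgroup.subset_closure (by simp)))
    (Subgroup.subset_closure (by simp))) k

lemma uA_mem (W : ℕ) [NeZero W] (a : ZMod W) : uA W a ∈ Kg W := by
  have h : uA W a = uA W 1 * uT W ((a - 1).val : ℕ) := by
    ext i j
    fin_cases i <;> fin_cases j <;> simp [uA, uT, Matrix.mul_apply, Fin.sum_univ_two]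
  rw [h]
  exact mul_mem (Subgroup.subset_closure (by simp)) (uT_mem W _)

lemma row_orbit (W : ℕ) [NeZero W] (m n : ℕ) (h : Nat.Coprime m n) :
    ∃ κ ∈ Kg W, (κ : M2 W) 1 0 = m ∧ (κ : M2 W) 1 1 = n := by
  induction m, n using Nat.gcd.induction with
  | H0 n =>
    rw [Nat.coprime_zero_left] at h
    subst h
    exact ⟨1, one_mem _, by simp, by simp⟩
  | H1 m n hm ih =>
    obtain ⟨κ, hκ, h1, h2⟩ := ih (by
      have : Nat.gcd m n = 1 := h
      rw [Nat.gcd_rec] at this; exact this)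
    refine ⟨κ * uA W 0 * uT W ((n / m : ℕ) : ZMod W), mul_mem (mul_mem hκ (uA_mem W 0))
      (uT_mem W _), ?_, ?_⟩
    · simp [uA, uT, Matrix.mul_apply, Fin.sum_univ_two, h2]
    · simp only [uA, uT, Units.val_mul, Matrix.mul_apply, Fin.sum_univ_two, h1, h2]
      simp
      have := Nat.mod_add_div n m
      calc (m : ZMod W) * ((n / m : ℕ) : ZMod W) + ((n % m : ℕ) : ZMod W)
          = ((n % m + m * (n / m) : ℕ) : ZMod W) := by push_cast; ring
        _ = n := by rw [this]

lemma lift_coprime {W n c : ℕ} (hW : 1 ≤ W) (hn : 1 ≤ n) (h : Nat.Coprime c (Nat.gcd n W)) :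
    ∃ c' : ℕ, Nat.Coprime c' n ∧ (c' : ZMod W) = c := by
  set m := Nat.gcd n W with hm
  have hmn : m ∣ n := Nat.gcd_dvd_left n W
  have : NeZero n := ⟨by omega⟩
  obtain ⟨v, hv⟩ := ZMod.unitsMap_surjective hmn (ZMod.unitOfCoprime c h)
  have hcop := ZMod.val_coe_unit_coprime v
  set c2 : ℕ := (v : ZMod n).val with hc2
  have hval : ((c2 : ℕ) : ZMod m) = (c : ZMod m) := by
    have := congrArg Units.val hv
    rw [ZMod.unitsMap_val, ZMod.coe_unitOfCoprime] at this
    rw [← this, hc2, ZMod.natCast_val]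
  have hdvd : (m : ℤ) ∣ (c : ℤ) - c2 := by
    rw [← ZMod.intCast_eq_intCast_iff_dvd_sub]
    push_cast; exact hval
  obtain ⟨z, hz⟩ := hdvd
  have hbez : (m : ℤ) = n * n.gcdA W + W * n.gcdB W := Nat.gcd_eq_gcd_ab n W
  -- integer c1 = c2 + z * gcdA * n
  let c1 : ℤ := c2 + z * n.gcdA W * n
  have e1 : c1 = c - z * n.gcdB W * W := by
    simp only [c1]; rw [hbez] at hz; linarith
  refine ⟨(c1 % (n * W)).toNat, ?_, ?_⟩
  · rw [← Nat.isCoprime_iff_coprime, Int.toNat_of_nonneg (Int.emod_nonneg _ (by positivity))]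
    have hc : IsCoprime (c2 : ℤ) n := by rw [Nat.isCoprime_iff_coprime]; exact hcop
    rw [Int.emod_def, show c1 - ↑n * ↑W * (c1 / (↑n * ↑W)) =
      c2 + n * (z * n.gcdA W - W * (c1 / (↑n * ↑W))) by simp only [c1]; ring]
    exact hc.add_mul_left_left _
  · have : (((c1 % (n * W)).toNat : ℤ) : ZMod W) = ((c : ℤ) : ZMod W) := by
      rw [Int.toNat_of_nonneg (Int.emod_nonneg _ (by positivity)),
        ZMod.intCast_eq_intCast_iff_dvd_sub, Int.emod_def, e1]
      exact ⟨z * n.gcdB W + n * ((↑c - z * n.gcdB ↑W * ↑W) / (↑n * ↑W)), by ring⟩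
    exact_mod_cast this

lemma count_coprime (m t : ℕ) : ((Finset.range (t * m)).filter fun c => Nat.Coprime c m).card
    = t * Nat.totient m := by
  induction t with
  | zero => simp
  | succ t ih =>
    have h1 : Finset.range ((t + 1) * m) = Finset.range (t * m) ∪ Finset.Ico (t * m) (t * m + m) := by
      rw [Finset.range_eq_Ico, Finset.range_eq_Ico, Finset.Ico_union_Ico_eq_Ico (Nat.zero_le _)
        (Nat.le_add_right _ _)]
      congr 1; ring
    have h2 : Disjoint (Finset.range (t * m)) (Finset.Ico (t * m) (t * m + m)) := by
      rw [Finset.range_eq_Ico]; exact Finset.Ico_disjoint_Ico_consecutive _ _ _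
    rw [h1, Finset.filter_union, Finset.card_union_of_disjoint (Finset.disjoint_filter_filter h2), ih]
    have h3 := Nat.filter_coprime_Ico_eq_totient m (t * m)
    simp only [Nat.coprime_comm] at h3 ⊢
    rw [h3]; ring

open Classical in
lemma Kg_count (W : ℕ) [NeZero W] (n : ℕ) (hn : 1 ≤ n) :
    Fintype.card (Kg W) * Nat.totient n ≤
      n * W * (Finset.univ.filter fun κ : Kg W => ((κ : (M2 W)ˣ) : M2 W) 1 1 = n).card := by
  have hW : 1 ≤ W := Nat.one_le_iff_ne_zero.2 (NeZero.ne W)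
  let r : Kg W → ZMod W × ZMod W := fun κ => (((κ : (M2 W)ˣ) : M2 W) 1 0, ((κ : (M2 W)ˣ) : M2 W) 1 1)
  -- fibers have equal size
  have hr : ∀ κ κ' : Kg W, r (κ * κ') = ((r κ).1 * ((κ' : (M2 W)ˣ) : M2 W) 0 0 + (r κ).2 * ((κ' : (M2 W)ˣ) : M2 W) 1 0,
      (r κ).1 * ((κ' : (M2 W)ˣ) : M2 W) 0 1 + (r κ).2 * ((κ' : (M2 W)ˣ) : M2 W) 1 1) := by
    intro κ κ'; simp [r, Matrix.mul_apply, Fin.sum_univ_two]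
  let s : ℕ := (Finset.univ.filter fun κ : Kg W => r κ = r 1).card
  have hfib : ∀ κ0 : Kg W, (Finset.univ.filter fun κ : Kg W => r κ = r κ0).card = s := by
    intro κ0
    symm
    refine Finset.card_bij (fun κ _ => κ * κ0) ?_ ?_ ?_
    · intro κ hκ
      simp only [Finset.mem_filter, Finset.mem_univ, true_and] at hκ ⊢
      rw [hr, hκ, ← hr, one_mul]
    · intro a _ b _ h; exact mul_right_cancel h
    · intro κ hκ
      simp only [Finset.mem_filter, Finset.mem_univ, true_and] at hκ
      refine ⟨κ * κ0⁻¹, ?_, by simp⟩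
      simp only [Finset.mem_filter, Finset.mem_univ, true_and]
      rw [hr, hκ, ← hr, mul_inv_cancel]
  have hs : Fintype.card (Kg W) ≤ W ^ 2 * s := by
    have := Finset.card_le_mul_card_image (s := (Finset.univ : Finset (Kg W))) (f := r) s (by
      intro b hb
      obtain ⟨κ, _, rfl⟩ := Finset.mem_image.1 hb
      exact (hfib κ).le)
    rw [Finset.card_univ] at this
    refine this.trans ?_
    have h2 : (Finset.univ.image r).card ≤ W ^ 2 := by
      refine (Finset.card_le_univ _).trans ?_
      rw [Fintype.card_prod, ZMod.card]; exact (sq W).ge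
    rw [mul_comm]; exact Nat.mul_le_mul_right _ h2
  set m := Nat.gcd n W with hm
  obtain ⟨t, ht⟩ : m ∣ W := Nat.gcd_dvd_right n W
  obtain ⟨q, hq⟩ : m ∣ n := Nat.gcd_dvd_left n W
  have hm0 : 0 < m := Nat.gcd_pos_of_pos_left _ hn
  let S := (Finset.range W).filter fun c => Nat.Coprime c m
  have hS : S.card = t * Nat.totient m := by
    simp only [S]
    have := count_coprime m t
    rwa [mul_comm t m, ← ht] at this
  have hcnt : S.card * s ≤
      (Finset.univ.filter fun κ : Kg W => ((κ : (M2 W)ˣ) : M2 W) 1 1 = n).card := by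
    rw [mul_comm]
    have hex : ∀ c ∈ S, ∃ κ : Kg W, r κ = ((c : ZMod W), (n : ZMod W)) := by
      intro c hc
      obtain ⟨c', h1, h2⟩ := lift_coprime hW hn (Finset.mem_filter.1 hc).2
      obtain ⟨κ, hκ, h3, h4⟩ := row_orbit W c' n h1
      exact ⟨⟨κ, hκ⟩, by simp [r, h3, h4, h2]⟩
    have hm : ∀ c ∈ S, s ≤ ((Finset.univ.filter fun κ : Kg W =>
        ((κ : (M2 W)ˣ) : M2 W) 1 1 = n).filter fun κ : Kg W => (((κ : (M2 W)ˣ) : M2 W) 1 0).val = c).card := by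
      intro c hc
      obtain ⟨κ0, hκ0⟩ := hex c hc
      rw [← hfib κ0]
      refine Finset.card_le_card fun κ hκ => ?_
      simp only [Finset.mem_filter, Finset.mem_univ, true_and] at hκ ⊢
      rw [hκ0] at hκ
      simp only [r, Prod.mk.injEq] at hκ
      refine ⟨hκ.2, ?_⟩
      rw [hκ.1, ZMod.val_natCast, Nat.mod_eq_of_lt (Finset.mem_range.1 (Finset.mem_filter.1 hc).1)]
    rw [mul_comm]
    have := Finset.card_nsmul_le_sum S _ s hm
    rw [smul_eq_mul] at this
    refine this.trans ?_
    rw [← Finset.card_biUnion]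
    · exact Finset.card_le_card (Finset.biUnion_subset.2 fun c _ => Finset.filter_subset _ _)
    · intro c _ c' _ hne
      rw [Function.onFun, Finset.disjoint_left]
      intro κ h1 h2
      exact hne ((Finset.mem_filter.1 h1).2.symm.trans (Finset.mem_filter.1 h2).2)
  have htot : Nat.totient n ≤ q * Nat.totient m := by
    rw [hq, mul_comm m q]
    rw [← count_coprime m q, Nat.totient_eq_card_coprime]
    refine Finset.card_le_card fun c hc => ?_
    simp only [Finset.mem_filter] at hc ⊢
    exact ⟨hc.1, (Nat.Coprime.coprime_dvd_left (Dvd.intro_left q rfl) hc.2).symm⟩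
  calc Fintype.card (Kg W) * Nat.totient n ≤ (W ^ 2 * s) * (q * Nat.totient m) :=
        Nat.mul_le_mul hs htot
    _ = n * W * (t * Nat.totient m * s) := by
        rw [sq]; nth_rw 1 [ht]; rw [hq]; ring
    _ ≤ _ := by rw [← hS]; exact Nat.mul_le_mul_left _ hcnt

noncomputable def Ar (a : ℝ) : Matrix (Fin 2) (Fin 2) ℝ := !![0, 1; 1, a]
noncomputable def Pr (x : ℝ) : Matrix (Fin 2) (Fin 2) ℝ :=
  !![1 / (1 + x ^ 2), x / (1 + x ^ 2); x / (1 + x ^ 2), x ^ 2 / (1 + x ^ 2)]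

lemma Ar_pow (a x : ℝ) (hx : 1 < x) (h : x ^ 2 = a * x + 1) (k : ℕ) :
    Ar a ^ k = x ^ k • (Pr x + ((-1) / x ^ 2) ^ k • (1 - Pr x)) := by
  have hx0 : x ≠ 0 := by positivity
  have h1 : (1 + x ^ 2) ≠ 0 := by positivity
  have e1 : Pr x * Ar a = x • Pr x := by
    ext i j
    fin_cases i <;> fin_cases j <;> simp [Pr, Ar, Matrix.mul_apply, Fin.sum_univ_two] <;>
      field_simp <;> nlinarith
  have e2 : (1 - Pr x) * Ar a = (-1 / x) • (1 - Pr x) := by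
    ext i j
    fin_cases i <;> fin_cases j <;> simp [Pr, Ar, Matrix.mul_apply, Fin.sum_univ_two] <;>
      field_simp <;> nlinarith
  induction k with
  | zero => simp
  | succ k ih =>
    rw [pow_succ, ih, Matrix.smul_mul, Matrix.add_mul, Matrix.smul_mul, e1, e2]
    simp only [smul_add, smul_smul]
    congr 2
    rw [pow_succ x k, pow_succ _ k]; field_simp

lemma Ar_lim (a x : ℝ) (hx : 1 < x) (h : x ^ 2 = a * x + 1) :
    Tendsto (fun k : ℕ => (x ^ k)⁻¹ • Ar a ^ k) atTop (nhds (Pr x)) := by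
  have : ∀ k : ℕ, (x ^ k)⁻¹ • Ar a ^ k = Pr x + ((-1) / x ^ 2) ^ k • (1 - Pr x) := by
    intro k
    rw [Ar_pow a x hx h, smul_smul, inv_mul_cancel₀ (by positivity), one_smul]
  simp_rw [this]
  have h2 : Tendsto (fun k : ℕ => ((-1) / x ^ 2) ^ k) atTop (nhds 0) := by
    apply tendsto_pow_atTop_nhds_zero_of_abs_lt_one
    rw [abs_div, abs_neg, abs_one, abs_of_pos (by positivity), div_lt_one (by positivity)]
    nlinarith
  simpa using (tendsto_const_nhds (x := Pr x)).add (h2.smul_const (1 - Pr x))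

noncomputable def fi : ℝ := (1 + √5) / 2
noncomputable def sg : ℝ := 1 + √2
lemma fi_sq : fi ^ 2 = 1 * fi + 1 := by
  have := Real.sq_sqrt (show (0:ℝ) ≤ 5 by norm_num)
  unfold fi; nlinarith
lemma sg_sq : sg ^ 2 = 2 * sg + 1 := by
  have := Real.sq_sqrt (show (0:ℝ) ≤ 2 by norm_num)
  unfold sg; nlinarith
lemma fi_gt : 1 < fi := by
  have : (2:ℝ) < √5 := by rw [Real.lt_sqrt] <;> norm_num
  unfold fi; linarith
lemma fi_lt : fi < 2 := by
  have : √5 < (3:ℝ) := by rw [Real.sqrt_lt'] <;> norm_num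
  unfold fi; linarith
lemma sg_gt : 1 < sg := by
  have : (1:ℝ) < √2 := by rw [Real.lt_sqrt] <;> norm_num
  unfold sg; linarith

noncomputable def xi (i : Fin 2) : ℝ := if i = 0 then 1 else fi
lemma xi_pos (i : Fin 2) : 0 < xi i := by
  have := fi_gt
  unfold xi; split_ifs <;> linarith

lemma glim (S : Matrix (Fin 2) (Fin 2) ℝ) (h0 : ∀ i j, 0 ≤ S i j) (h1 : 1 ≤ S 1 1) :
    ∃ c > 0, ∀ θ > 1, ∃ k0 : ℕ, ∀ k ≥ k0, ∀ l ≥ k0, ∀ i j,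
      c * (xi i * xi j) * (fi ^ k * sg ^ l * fi ^ k) ≤ θ * (Ar 1 ^ k * S * Ar 2 ^ l * Ar 1 ^ k) i j ∧
      (Ar 1 ^ k * S * Ar 2 ^ l * Ar 1 ^ k) i j ≤
        θ * (c * (xi i * xi j) * (fi ^ k * sg ^ l * fi ^ k)) := by
  have hf := fi_gt
  have hg := sg_gt
  let c : ℝ := (S 0 0 + S 0 1 * sg + fi * S 1 0 + fi * S 1 1 * sg) * (1 + sg * fi) /
    ((1 + fi ^ 2) ^ 2 * (1 + sg ^ 2))
  have hc : 0 < c := by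
    have := h0 0 0; have := h0 0 1; have := h0 1 0
    simp only [c]
    positivity
  have hlim : ∀ i j, (Pr fi * S * Pr sg * Pr fi) i j = c * (xi i * xi j) := by
    intro i j
    simp only [Matrix.mul_apply, Fin.sum_univ_two]
    fin_cases i <;> fin_cases j <;> simp [Pr, xi, c] <;>
      field_simp <;> ring
  have t1 : Tendsto (fun p : ℕ × ℕ => ((fi ^ p.1)⁻¹ • Ar 1 ^ p.1)) (atTop ×ˢ atTop) (nhds (Pr fi)) :=
    (Ar_lim 1 fi hf fi_sq).comp tendsto_fst
  have t2 : Tendsto (fun p : ℕ × ℕ => ((sg ^ p.2)⁻¹ • Ar 2 ^ p.2)) (atTop ×ˢ atTop) (nhds (Pr sg)) :=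
    (Ar_lim 2 sg hg sg_sq).comp tendsto_snd
  have t3 := ((t1.mul_const S).mul t2).mul t1
  have t4 : ∀ i j, Tendsto (fun p : ℕ × ℕ => (fi ^ p.1 * sg ^ p.2 * fi ^ p.1)⁻¹ *
      (Ar 1 ^ p.1 * S * Ar 2 ^ p.2 * Ar 1 ^ p.1) i j) (atTop ×ˢ atTop) (nhds (c * (xi i * xi j))) := by
    intro i j
    rw [← hlim]
    have := (tendsto_pi_nhds.1 (tendsto_pi_nhds.1 t3 i)) j
    refine this.congr fun p => ?_
    simp only [Matrix.smul_mul, Matrix.mul_smul, Matrix.smul_apply, smul_eq_mul, mul_inv]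
    ring
  refine ⟨c, hc, fun θ hθ => ?_⟩
  clear_value c
  have ev : ∀ᶠ p : ℕ × ℕ in atTop ×ˢ atTop, ∀ i j,
      c * (xi i * xi j) / θ < (fi ^ p.1 * sg ^ p.2 * fi ^ p.1)⁻¹ *
      (Ar 1 ^ p.1 * S * Ar 2 ^ p.2 * Ar 1 ^ p.1) i j ∧ (fi ^ p.1 * sg ^ p.2 * fi ^ p.1)⁻¹ *
      (Ar 1 ^ p.1 * S * Ar 2 ^ p.2 * Ar 1 ^ p.1) i j < θ * (c * (xi i * xi j)) := by
    rw [eventually_all]; intro i; rw [eventually_all]; intro j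
    have hp : 0 < c * (xi i * xi j) := mul_pos hc (mul_pos (xi_pos i) (xi_pos j))
    refine ((t4 i j).eventually (lt_mem_nhds ?_)).and ((t4 i j).eventually (gt_mem_nhds ?_))
    · rw [div_lt_iff₀ (by linarith)]; nlinarith
    · nlinarith
  rw [prod_atTop_atTop_eq, eventually_atTop] at ev
  obtain ⟨⟨a, b⟩, hab⟩ := ev
  refine ⟨max a b, fun k hk l hl i j => ?_⟩
  obtain ⟨g1, g2⟩ := hab (k, l) ⟨(le_max_left _ _).trans hk, (le_max_right _ _).trans hl⟩ i j
  have hpp : 0 < fi ^ k * sg ^ l * fi ^ k := by positivity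
  simp only at g1 g2
  rw [div_lt_iff₀ (by linarith), inv_mul_eq_div, div_mul_eq_mul_div, lt_div_iff₀ hpp] at g1
  rw [inv_mul_eq_div, div_lt_iff₀ hpp] at g2
  constructor
  · linarith
  · linarith

lemma sg_fi (m n : ℕ) (hm : 1 ≤ m) (hn : 1 ≤ n) : fi ^ m ≠ sg ^ n := by
  have key1 : ∀ m : ℕ, ∃ x y : ℚ, 0 < y ∧ 0 < x ∧ fi ^ (m + 1) = x + y * √5 := by
    intro m
    induction m with
    | zero => exact ⟨1/2, 1/2, by norm_num, by norm_num, by simp [fi]; ring⟩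
    | succ m ih =>
      obtain ⟨x, y, hy, hx, e⟩ := ih
      refine ⟨(x + 5 * y) / 2, (x + y) / 2, by positivity, by positivity, ?_⟩
      rw [pow_succ, e]
      have := Real.sq_sqrt (show (0:ℝ) ≤ 5 by norm_num)
      unfold fi; push_cast; linear_combination (y / 2 : ℝ) * this
  have key2 : ∀ m : ℕ, ∃ x y : ℚ, 0 < y ∧ 0 < x ∧ sg ^ (m + 1) = x + y * √2 := by
    intro m
    induction m with
    | zero => exact ⟨1, 1, by norm_num, by norm_num, by simp [sg]⟩
    | succ m ih =>
      obtain ⟨x, y, hy, hx, e⟩ := ih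
      refine ⟨x + 2 * y, x + y, by positivity, by positivity, ?_⟩
      rw [pow_succ, e]
      have := Real.sq_sqrt (show (0:ℝ) ≤ 2 by norm_num)
      unfold sg; push_cast; linear_combination (y : ℝ) * this
  intro h
  obtain ⟨m, rfl⟩ := Nat.exists_eq_add_of_le' hm
  obtain ⟨n, rfl⟩ := Nat.exists_eq_add_of_le' hn
  obtain ⟨x, y, hy, -, e⟩ := key1 m
  obtain ⟨z, w, hw, -, e'⟩ := key2 n
  rw [e, e'] at h
  have irr : Irrational (√10) := by norm_num
  apply irr
  refine ⟨(5 * y ^ 2 + 2 * w ^ 2 - (z - x) ^ 2) / (2 * y * w), ?_⟩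
  have h10 : √10 = √5 * √2 := by rw [← Real.sqrt_mul (by norm_num)]; norm_num
  have h5 := Real.sq_sqrt (show (0:ℝ) ≤ 5 by norm_num)
  have h2 := Real.sq_sqrt (show (0:ℝ) ≤ 2 by norm_num)
  rw [h10]
  push_cast
  have hy' : (0:ℝ) < y := by exact_mod_cast hy
  have hw' : (0:ℝ) < w := by exact_mod_cast hw
  rw [div_eq_iff (by positivity)]
  have h3 : (z - x : ℝ) = y * √5 - w * √2 := by linarith
  rw [h3]
  linear_combination (-y ^ 2 : ℝ) * h5 - (w ^ 2 : ℝ) * h2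

lemma irr_log : Irrational (Real.log fi / Real.log sg) := by
  rintro ⟨q, hq⟩
  have hf := Real.log_pos fi_gt
  have hg := Real.log_pos sg_gt
  have hq0 : 0 < q := by
    have : (0:ℝ) < q := by rw [hq]; positivity
    exact_mod_cast this
  have h1 : q.num.toNat * Real.log sg = q.den * Real.log fi := by
    have h2 : ((q.num.toNat : ℝ)) = q * q.den := by
      have h3 : ((q.num.toNat : ℤ)) = q.num := Int.toNat_of_nonneg (Rat.num_pos.2 hq0).le
      have h4 : ((q.num.toNat : ℝ)) = (q.num : ℝ) := by exact_mod_cast congrArg (Int.cast : ℤ → ℝ) h3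
      rw [h4]; exact_mod_cast (Rat.mul_den_eq_num q).symm
    rw [h2, hq]; field_simp
  have h5 : Real.log (sg ^ q.num.toNat) = Real.log (fi ^ q.den) := by
    rw [Real.log_pow, Real.log_pow, h1]
  have hnum := Rat.num_pos.2 hq0
  refine sg_fi q.den q.num.toNat q.den_pos (by omega) ?_
  exact (Real.log_injOn_pos (by have := fi_gt; simp; positivity) (by have := sg_gt; simp; positivity)
    h5.symm)

lemma kron (α β : ℝ) (hα : 0 < α) (h : Irrational (α / β)) (ε : ℝ) (hε : 0 < ε)
    (k0 : ℕ) : ∃ x0 : ℝ, ∀ x ≥ x0, ∃ k ≥ k0, ∃ l ≥ k0, x ≤ k * α + l * β ∧ k * α + l * β ≤ x + ε := by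
  have hd := dense_addSubgroupClosure_pair_iff.2 h
  obtain ⟨δ, hδ1, hδ2⟩ := hd.exists_mem_open isOpen_Ioo (Set.nonempty_Ioo.2 hε)
  obtain ⟨i, j, hij⟩ := AddSubgroup.mem_closure_pair.1 hδ1
  simp only [zsmul_eq_mul] at hij
  obtain ⟨m, hm⟩ := exists_nat_ge (α / δ)
  rw [div_le_iff₀ hδ2.1] at hm
  refine ⟨(m * |i| + k0) * α + (m * |j| + k0) * β, fun x hx => ?_⟩
  set x0 := ((m * |i| + k0) * α + (m * |j| + k0) * β : ℝ) with hx0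
  set s := ⌊(x - x0) / α⌋₊ with hs
  have hs0 : 0 ≤ (x - x0) / α := div_nonneg (by linarith) hα.le
  have hs1 := Nat.floor_le hs0
  have hs2 := Nat.lt_floor_add_one ((x - x0) / α)
  rw [← hs, le_div_iff₀ hα] at hs1
  rw [← hs, div_lt_iff₀ hα] at hs2
  set y := x - x0 - s * α with hy
  have hy0 : 0 ≤ y / δ := div_nonneg (by linarith) hδ2.1.le
  set r := ⌈y / δ⌉₊ with hr
  have hr1 := Nat.le_ceil (y / δ)
  have hr2 := Nat.ceil_lt_add_one hy0
  rw [← hr, div_le_iff₀ hδ2.1] at hr1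
  have hr3 : (r : ℝ) * δ < y + δ := by
    rw [← hr] at hr2
    calc (r : ℝ) * δ < (y / δ + 1) * δ := mul_lt_mul_of_pos_right hr2 hδ2.1
      _ = y + δ := by have := hδ2.1.ne'; field_simp
  have hrm : (r : ℤ) ≤ m := by
    have : r ≤ m := by
      rw [hr, Nat.ceil_le, div_le_iff₀ hδ2.1]; linarith
    exact_mod_cast this
  have hi : -(m * |i|) ≤ (r : ℤ) * i := by
    have := neg_abs_le i; have := abs_nonneg i; nlinarith
  have hj : -(m * |j|) ≤ (r : ℤ) * j := by
    have := neg_abs_le j; have := abs_nonneg j; nlinarith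
  have hk : ((m * |i| + k0 + s + r * i).toNat : ℤ) = m * |i| + k0 + s + r * i :=
    Int.toNat_of_nonneg (by linarith [Int.natCast_nonneg k0, Int.natCast_nonneg s])
  have hl : ((m * |j| + k0 + r * j).toNat : ℤ) = m * |j| + k0 + r * j :=
    Int.toNat_of_nonneg (by linarith [Int.natCast_nonneg k0])
  have hk' := congrArg (Int.cast : ℤ → ℝ) hk
  have hl' := congrArg (Int.cast : ℤ → ℝ) hl
  push_cast at hk' hl'
  refine ⟨(m * |i| + k0 + s + r * i).toNat, by zify; rw [hk]; linarith [Int.natCast_nonneg s],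
    (m * |j| + k0 + r * j).toNat, by zify; rw [hl]; linarith, ?_⟩
  rw [hk', hl']
  have e : ((m * |(i : ℝ)| + k0 + s + r * i) * α + (m * |(j : ℝ)| + k0 + r * j) * β)
      = x0 + s * α + r * δ := by rw [hx0, ← hij]; push_cast; ring
  rw [e]
  constructor
  · linarith
  · linarith [hδ2.2]

lemma Mt_real (l : List ℤ) : (Mt l).map (Int.cast : ℤ → ℝ) = (l.map fun a : ℤ => Ar (a : ℝ)).prod := by
  induction l with
  | nil => simp [Mt_nil]
  | cons a l ih =>
    rw [List.map_cons, List.prod_cons, ← ih]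
    ext i j
    rw [Matrix.map_apply]
    fin_cases i <;> simp [Mt_c0, Mt_c1, Ar, Matrix.mul_apply, Fin.sum_univ_two]

lemma Mt_mod (W : ℕ) (l : List ℤ) :
    (Mt l).map (Int.cast : ℤ → ZMod W) = (l.map fun a : ℤ => uA W a).prod := by
  induction l with
  | nil => simp [Mt_nil]
  | cons a l ih =>
    rw [List.map_cons, List.prod_cons, Units.val_mul, ← ih]
    ext i j
    rw [Matrix.map_apply]
    fin_cases i <;> simp [Mt_c0, Mt_c1, uA, Matrix.mul_apply, Fin.sum_univ_two]

lemma Mt_Kg (W : ℕ) [NeZero W] (l : List ℤ) :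
    (l.map fun a : ℤ => uA W a).prod ∈ Kg W := by
  apply Subgroup.list_prod_mem
  intro x hx
  obtain ⟨a, _, rfl⟩ := List.mem_map.1 hx
  exact uA_mem W _

lemma Kg_word (W : ℕ) [NeZero W] (κ : (M2 W)ˣ) (h : κ ∈ Kg W) : ∃ s : List ℤ,
    (∀ a ∈ s, a = 1 ∨ a = 2) ∧ (s.map fun a : ℤ => uA W a).prod = κ := by
  have h' : κ ∈ Submonoid.closure {uA W 1, uA W 2} := by
    rw [← Subgroup.closure_toSubmonoid_of_finite]; exact h
  induction h' using Submonoid.closure_induction with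
  | mem x hx =>
    rcases hx with rfl | hx
    · exact ⟨[1], by simp, by simp⟩
    · rw [Set.mem_singleton_iff] at hx
      subst hx
      exact ⟨[2], by simp, by simp⟩
  | one => exact ⟨[], by simp, by simp⟩
  | mul x y hx hy ihx ihy =>
    have cl : ∀ z, z ∈ Submonoid.closure {uA W 1, uA W 2} → z ∈ Kg W := by
      intro z hz; rw [← Subgroup.closure_toSubmonoid_of_finite] at hz; exact hz
    obtain ⟨s, hs, e⟩ := ihx (cl x hx)
    obtain ⟨t, ht, e'⟩ := ihy (cl y hy)
    refine ⟨s ++ t, ?_, by rw [List.map_append, List.prod_append, e, e']⟩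
    intro a ha
    rcases List.mem_append.1 ha with h | h
    exacts [hs a h, ht a h]

/-- the connecting words -/
lemma gwords (W : ℕ) [NeZero W] (η : ℝ) (hη : 0 < η) : ∃ L0 : ℝ, ∀ τ ≥ L0, ∀ κ ∈ Kg W,
    ∃ g : List ℤ, (∀ a ∈ g, a = 1 ∨ a = 2) ∧ (g.map fun a : ℤ => uA W a).prod = κ ∧
      ∀ i j, τ * (xi i * xi j) ≤ Mt g i j ∧ Mt g i j ≤ (1 + η) * τ * (xi i * xi j) := by
  classical
  have hf := fi_gt
  have hg := sg_gt
  obtain ⟨θ, hθ1, hθ3⟩ : ∃ θ : ℝ, 1 < θ ∧ θ ^ 3 ≤ 1 + η := by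
    refine ⟨1 + min 1 (η / 7), by have : 0 < min 1 (η / 7) := by positivity
                                  linarith, ?_⟩
    set t := min 1 (η / 7)
    have h1 : t ≤ 1 := min_le_left _ _
    have h2 : t ≤ η / 7 := min_le_right _ _
    have h0 : 0 < t := by positivity
    nlinarith [mul_pos h0 h0, mul_nonneg h0.le (sub_nonneg.2 h1)]
  choose! s hs1 hs2 using Kg_word W
  have one : ∀ κ : Kg W, ∃ L0 : ℝ, ∀ τ ≥ L0, ∃ g : List ℤ, (∀ a ∈ g, a = 1 ∨ a = 2) ∧
      (g.map fun a : ℤ => uA W a).prod = κ ∧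
      ∀ i j, τ * (xi i * xi j) ≤ Mt g i j ∧ Mt g i j ≤ (1 + η) * τ * (xi i * xi j) := by
    rintro ⟨κ, hκ⟩
    have hp : Pos (s κ) := fun a ha => by rcases hs1 κ hκ a ha with h | h <;> omega
    obtain ⟨b1, b2, b3, b4, -⟩ := Mt_basic hp
    obtain ⟨c, hc, hlim⟩ := glim ((Mt (s κ)).map (Int.cast : ℤ → ℝ)) (by
      intro i j
      fin_cases i <;> fin_cases j <;> simp <;> omega) (by simp; exact_mod_cast b4)
    obtain ⟨k0, hk0⟩ := hlim θ hθ1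
    set o := Fintype.card (M2 W)ˣ with ho
    have ho1 : 1 ≤ o := Fintype.card_pos
    have hlog : 0 < Real.log θ := Real.log_pos hθ1
    have hlf := Real.log_pos hf
    have hlg := Real.log_pos hg
    have ho0 : (0 : ℝ) < o := by exact_mod_cast ho1
    obtain ⟨x0, hx0⟩ := kron (2 * o * Real.log fi) (o * Real.log sg) (by positivity) (by
      rw [show 2 * o * Real.log fi / (o * Real.log sg) = (2 : ℕ) * (Real.log fi / Real.log sg) by
        push_cast; field_simp]
      exact irr_log.natCast_mul (by norm_num)) (Real.log θ) hlog k0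
    refine ⟨max 1 (Real.exp x0 * c), fun τ hτ => ?_⟩
    have hτ0 : 0 < τ := by linarith [le_max_left 1 (Real.exp x0 * c)]
    have hcτ : 0 < τ * θ / c := by positivity
    obtain ⟨k, hk, l, hl, h1, h2⟩ := hx0 (Real.log (τ * θ / c)) (by
      rw [ge_iff_le, Real.le_log_iff_exp_le hcτ, le_div_iff₀ hc]
      have := le_max_right 1 (Real.exp x0 * c)
      nlinarith)
    set Q := fi ^ (o * k) * sg ^ (o * l) * fi ^ (o * k) with hQ
    have hQ0 : 0 < Q := by positivity
    have hQl : Real.log Q = k * (2 * o * Real.log fi) + l * (o * Real.log sg) := by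
      rw [hQ, Real.log_mul (by positivity) (by positivity), Real.log_mul (by positivity)
        (by positivity), Real.log_pow, Real.log_pow]
      push_cast; ring
    rw [← hQl] at h1 h2
    rw [Real.log_le_log_iff hcτ hQ0, div_le_iff₀ hc] at h1
    rw [← Real.log_mul hcτ.ne' (by positivity), Real.log_le_log_iff hQ0 (by positivity),
      div_mul_eq_mul_div, le_div_iff₀ hc] at h2
    refine ⟨List.replicate (o * k) 1 ++ s κ ++ List.replicate (o * l) 2 ++ List.replicate (o * k) 1,
      ?_, ?_, ?_⟩
    · intro a ha
      simp only [List.mem_append, List.mem_replicate] at ha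
      rcases ha with ((h | h) | h) | h
      exacts [.inl h.2, hs1 κ hκ a h, .inr h.2, .inl h.2]
    · simp only [List.map_append, List.prod_append, List.map_replicate, List.prod_replicate,
        hs2 κ hκ, pow_mul, ho, pow_card_eq_one]
      simp
    · intro i j
      obtain ⟨g1, g2⟩ := hk0 (o * k) (hk.trans (Nat.le_mul_of_pos_left k ho1)) (o * l)
        (hl.trans (Nat.le_mul_of_pos_left l ho1)) i j
      have e : ((Mt (List.replicate (o * k) 1 ++ s κ ++ List.replicate (o * l) 2 ++
          List.replicate (o * k) 1)).map (Int.cast : ℤ → ℝ)) i j =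
          (Ar 1 ^ (o * k) * (Mt (s κ)).map (Int.cast : ℤ → ℝ) * Ar 2 ^ (o * l) * Ar 1 ^ (o * k)) i j := by
        simp only [Mt_real]
        simp only [List.map_append, List.prod_append, List.map_replicate, List.prod_replicate]
        simp
      rw [Matrix.map_apply] at e
      rw [e]
      rw [← hQ] at g1 g2
      set Z := (Ar 1 ^ (o * k) * (Mt (s κ)).map (Int.cast : ℤ → ℝ) * Ar 2 ^ (o * l) * Ar 1 ^ (o * k)) i j
      have hx : 0 < xi i * xi j := mul_pos (xi_pos i) (xi_pos j)
      constructor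
      · have : θ * (τ * (xi i * xi j)) ≤ θ * Z := by
          refine le_trans ?_ g1
          calc θ * (τ * (xi i * xi j)) = (τ * θ) * (xi i * xi j) := by ring
            _ ≤ (Q * c) * (xi i * xi j) := by gcongr
            _ = _ := by ring
        exact le_of_mul_le_mul_left this (by linarith)
      · refine g2.trans ?_
        calc θ * (c * (xi i * xi j) * Q) = θ * (xi i * xi j) * (Q * c) := by ring
          _ ≤ θ * (xi i * xi j) * (τ * θ * θ) := by gcongr
          _ = θ ^ 3 * τ * (xi i * xi j) := by ring
          _ ≤ _ := by gcongr
  choose L0 hL0 using one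
  refine ⟨∑ κ, |L0 κ|, fun τ hτ κ hκ => hL0 ⟨κ, hκ⟩ τ ?_⟩
  refine le_trans ((le_abs_self _).trans ?_) hτ
  exact Finset.single_le_sum (f := fun κ => |L0 κ|) (fun _ _ => abs_nonneg _) (Finset.mem_univ _)

noncomputable def ec (P : ℕ) (n : ℤ) : ℂ := Complex.exp ((2 * Real.pi * n / P : ℝ) * Complex.I)

lemma ec_add (P : ℕ) (m n : ℤ) : ec P (m + n) = ec P m * ec P n := by
  unfold ec; rw [← Complex.exp_add]; congr 1; push_cast; ring
lemma ec_zero (P : ℕ) : ec P 0 = 1 := by simp [ec]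
lemma ec_norm (P : ℕ) (n : ℤ) : ‖ec P n‖ = 1 := by
  unfold ec; exact Complex.norm_exp_ofReal_mul_I _
lemma ec_conj (P : ℕ) (n : ℤ) : (starRingEnd ℂ) (ec P n) = ec P (-n) := by
  unfold ec; rw [← Complex.exp_conj]; congr 1
  rw [map_mul, Complex.conj_ofReal, Complex.conj_I]; push_cast; ring
lemma ec_mul_nat (P : ℕ) (x : ℕ) (n : ℤ) : ec P (x * n) = ec P n ^ x := by
  unfold ec; rw [← Complex.exp_nat_mul]; congr 1; push_cast; ring
lemma ec_one_iff (P : ℕ) (hP : 1 ≤ P) (n : ℤ) : ec P n = 1 ↔ (P : ℤ) ∣ n := by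
  have hP' : (P : ℂ) ≠ 0 := by exact_mod_cast (by omega : P ≠ 0)
  have hpi := Complex.two_pi_I_ne_zero
  unfold ec
  rw [Complex.exp_eq_one_iff]
  constructor
  · rintro ⟨m, hm⟩
    refine ⟨m, ?_⟩
    push_cast at hm
    have h2 : (n : ℂ) * (2 * Real.pi * Complex.I) = (P * m : ℂ) * (2 * Real.pi * Complex.I) := by
      field_simp at hm; linear_combination (2 * Real.pi * Complex.I) * hm
    exact_mod_cast mul_right_cancel₀ hpi h2
  · rintro ⟨m, rfl⟩
    exact ⟨m, by push_cast; field_simp⟩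
lemma ec_sum (P : ℕ) (hP : 1 ≤ P) (v : ℤ) :
    ∑ x ∈ Finset.range P, ec P (x * v) = if (P : ℤ) ∣ v then (P : ℂ) else 0 := by
  simp_rw [ec_mul_nat]
  split_ifs with h
  · rw [(ec_one_iff P hP v).2 h]; simp
  · have h1 : ec P v ≠ 1 := fun h' => h ((ec_one_iff P hP v).1 h')
    rw [geom_sum_eq h1, ← ec_mul_nat, (ec_one_iff P hP _).2 (Dvd.intro v rfl)]; simp

/-- Dirichlet kernel -/
noncomputable def Dk (P : ℕ) (b : ℤ) (x : ℤ) : ℂ := ∑ u ∈ Finset.Icc (-b) b, ec P (x * u)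

lemma Dk_low (P : ℕ) (hP : 1 ≤ P) (X b x : ℤ) (hb0 : 0 ≤ b) (hb : 8 * X * b ≤ P) (hx0 : 0 ≤ x)
    (hx : x ≤ X) : ((2 * b + 1 : ℤ) : ℝ) / 2 ≤ ‖Dk P b x‖ := by
  refine le_trans ?_ (Complex.abs_re_le_norm _ |> (le_abs_self _).trans)
  unfold Dk
  rw [Complex.re_sum]
  have h1 : ∀ u ∈ Finset.Icc (-b) b, (1 / 2 : ℝ) ≤ (ec P (x * u)).re := by
    intro u hu
    rw [Finset.mem_Icc] at hu
    unfold ec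
    rw [Complex.exp_ofReal_mul_I_re]
    have hP' : (0 : ℝ) < P := by exact_mod_cast hP
    have h3 : |(x * u : ℤ)| * 8 ≤ (P : ℤ) := by
      rw [abs_mul, abs_of_nonneg hx0]
      have : |u| ≤ b := abs_le.2 hu
      nlinarith [abs_nonneg u]
    have h4 : (|((x * u : ℤ) : ℝ)|) * 8 ≤ P := by exact_mod_cast h3
    rw [← Real.cos_abs, ← Real.cos_pi_div_three]
    apply Real.cos_le_cos_of_nonneg_of_le_pi (abs_nonneg _) (by linarith [Real.pi_pos])
    rw [abs_div, abs_mul, abs_of_pos (by positivity : 0 < 2 * Real.pi), abs_of_pos hP',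
      div_le_iff₀ hP']
    nlinarith [Real.pi_pos]
  have := Finset.card_nsmul_le_sum _ _ _ h1
  rw [Int.card_Icc, nsmul_eq_mul] at this
  have e : (((b + 1 - -b).toNat : ℕ) : ℝ) = ((2 * b + 1 : ℤ) : ℝ) := by
    have : ((b + 1 - -b).toNat : ℤ) = 2 * b + 1 := by omega
    exact_mod_cast congrArg (Int.cast : ℤ → ℝ) this
  rw [e] at this
  linarith

noncomputable def Fh (P : ℕ) (b v : ℤ) : ℂ :=
  ∑ x ∈ Finset.range P, Dk P b x * (starRingEnd ℂ) (Dk P b x) * ec P (x * v)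

lemma Fh_bound (P : ℕ) (hP : 1 ≤ P) (b v : ℤ) (hb0 : 0 ≤ b) (hbP : 2 * b < P) :
    ‖Fh P b v‖ ≤ P * (2 * b + 1 : ℤ) ∧ (Fh P b v ≠ 0 → ∃ w : ℤ, |w| ≤ 2 * b ∧ (P : ℤ) ∣ v - w) := by
  have e : Fh P b v = ∑ u ∈ Finset.Icc (-b) b, ∑ u' ∈ Finset.Icc (-b) b,
      if (P : ℤ) ∣ (u - u' + v) then (P : ℂ) else 0 := by
    unfold Fh Dk
    simp_rw [map_sum, Finset.sum_mul_sum, Finset.sum_mul]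
    rw [Finset.sum_comm]
    refine Finset.sum_congr rfl fun u _ => ?_
    rw [Finset.sum_comm]
    refine Finset.sum_congr rfl fun u' _ => ?_
    rw [← ec_sum P hP]
    refine Finset.sum_congr rfl fun x _ => ?_
    rw [ec_conj, ← ec_add, ← ec_add]; congr 1; ring
  constructor
  · rw [e]
    refine (norm_sum_le _ _).trans ?_
    have h1 : ∀ u ∈ Finset.Icc (-b) b, ‖∑ u' ∈ Finset.Icc (-b) b,
      if (P : ℤ) ∣ (u - u' + v) then (P : ℂ) else 0‖ ≤ P := by
      intro u _
      rw [← Finset.sum_filter, Finset.sum_const, nsmul_eq_mul, norm_mul]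
      simp only [Complex.norm_natCast]
      have : ((Finset.Icc (-b) b).filter fun u' => (P : ℤ) ∣ (u - u' + v)).card ≤ 1 := by
        rw [Finset.card_le_one]
        intro s hs t ht
        simp only [Finset.mem_filter, Finset.mem_Icc] at hs ht
        have h5 : (P : ℤ) ∣ s - t := by
          have := dvd_sub ht.2 hs.2
          rwa [show u - t + v - (u - s + v) = s - t by ring] at this
        have h6 := Int.eq_zero_of_abs_lt_dvd h5 (by rw [abs_lt]; omega)
        omega
      have h2 : (((Finset.Icc (-b) b).filter fun u' => (P : ℤ) ∣ (u - u' + v)).card : ℝ) ≤ 1 := by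
        exact_mod_cast this
      have : (0 : ℝ) ≤ P := by positivity
      nlinarith
    refine (Finset.sum_le_sum h1).trans ?_
    rw [Finset.sum_const, Int.card_Icc, nsmul_eq_mul]
    have e : (((b + 1 - -b).toNat : ℕ) : ℝ) = ((2 * b + 1 : ℤ) : ℝ) := by
      have : ((b + 1 - -b).toNat : ℤ) = 2 * b + 1 := by omega
      exact_mod_cast congrArg (Int.cast : ℤ → ℝ) this
    rw [e, mul_comm]
  · intro h
    by_contra hcon
    push Not at hcon
    apply h
    rw [e]
    refine Finset.sum_eq_zero fun u hu => Finset.sum_eq_zero fun u' hu' => ?_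
    rw [Finset.mem_Icc] at hu hu'
    rw [if_neg]
    have := hcon (u' - u) (by rw [abs_le]; omega)
    rwa [show u - u' + v = v - (u' - u) by ring]

def Close (P : ℕ) (X v : ℤ) : Prop := ∃ w : ℤ, 4 * X * |w| ≤ P ∧ (P : ℤ) ∣ v - w

open Classical in
lemma LSdual {α β : Type*} (P : ℕ) (X : ℤ) (hX : 1 ≤ X) (hXP : X < P)
    (U : Finset α) (x1 x2 : α → ℤ)
    (h1 : ∀ a ∈ U, 0 ≤ x1 a ∧ x1 a ≤ X) (h2 : ∀ a ∈ U, 0 ≤ x2 a ∧ x2 a ≤ X)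
    (hinj : ∀ u v : ℤ, (U.filter fun a => x1 a = u ∧ x2 a = v).card ≤ 2)
    (Z : Finset β) (c : β → ℂ) (f1 f2 : β → ℤ) :
    ∑ a ∈ U, ‖∑ z ∈ Z, c z * ec P (x1 a * f1 z + x2 a * f2 z)‖ ^ 2 ≤
      2048 * X ^ 2 * ∑ z ∈ Z, ∑ z' ∈ Z, if Close P X (f1 z - f1 z') ∧ Close P X (f2 z - f2 z') then
        ‖c z‖ * ‖c z'‖ else 0 := by
  have hP : 1 ≤ P := by omega
  have hPr : (0 : ℝ) < P := by exact_mod_cast hP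
  have hXr : (1 : ℝ) ≤ X := by exact_mod_cast hX
  set b : ℤ := P / (8 * X) with hb
  have hb0 : 0 ≤ b := Int.ediv_nonneg (by omega) (by omega)
  have hb1 : 8 * X * b ≤ P := Int.mul_ediv_self_le (by omega)
  have hb2 : (P : ℤ) < 8 * X * (b + 1) := by
    have := Int.lt_ediv_add_one_mul_self (P : ℤ) (show 0 < 8 * X by omega)
    rw [← hb] at this; linarith
  have hbP : 2 * b < P := by nlinarith
  set nI : ℝ := ((2 * b + 1 : ℤ) : ℝ) with hnI
  have hnI0 : 0 < nI := by rw [hnI]; exact_mod_cast (by omega : (0:ℤ) < 2 * b + 1)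
  have hnI1 : P ≤ 8 * X * nI := by
    rw [hnI]; exact_mod_cast (by nlinarith : (P : ℤ) ≤ 8 * X * (2 * b + 1))
  let T : ℤ → ℤ → ℂ := fun s t => ∑ z ∈ Z, c z * ec P (s * f1 z + t * f2 z)
  let G : ℤ × ℤ → ℝ := fun p => ‖Dk P b p.1‖ ^ 2 * ‖Dk P b p.2‖ ^ 2 * ‖T p.1 p.2‖ ^ 2
  have hG0 : ∀ p, 0 ≤ G p := fun p => by positivity
  -- step 1
  have s1 : ∑ a ∈ U, ‖T (x1 a) (x2 a)‖ ^ 2 ≤ 16 / nI ^ 4 * ∑ a ∈ U, G (x1 a, x2 a) := by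
    rw [Finset.mul_sum]
    refine Finset.sum_le_sum fun a ha => ?_
    have d1 := Dk_low P hP X b (x1 a) hb0 hb1 (h1 a ha).1 (h1 a ha).2
    have d2 := Dk_low P hP X b (x2 a) hb0 hb1 (h2 a ha).1 (h2 a ha).2
    rw [← hnI] at d1 d2
    have d3 : (nI / 2) ^ 2 * (nI / 2) ^ 2 ≤ ‖Dk P b (x1 a)‖ ^ 2 * ‖Dk P b (x2 a)‖ ^ 2 := by gcongr
    have d4 : 1 ≤ 16 / nI ^ 4 * (‖Dk P b (x1 a)‖ ^ 2 * ‖Dk P b (x2 a)‖ ^ 2) := by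
      calc (1 : ℝ) = 16 / nI ^ 4 * ((nI / 2) ^ 2 * (nI / 2) ^ 2) := by field_simp; norm_num
        _ ≤ _ := by gcongr
    calc ‖T (x1 a) (x2 a)‖ ^ 2 = 1 * ‖T (x1 a) (x2 a)‖ ^ 2 := by ring
      _ ≤ (16 / nI ^ 4 * (‖Dk P b (x1 a)‖ ^ 2 * ‖Dk P b (x2 a)‖ ^ 2)) * ‖T (x1 a) (x2 a)‖ ^ 2 := by
        gcongr
      _ = _ := by simp only [G]; ring
  -- step 2
  have s2 : ∑ a ∈ U, G (x1 a, x2 a) ≤ 2 * ∑ s ∈ Finset.range P, ∑ t ∈ Finset.range P,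
      G ((s : ℤ), (t : ℤ)) := by
    rw [Finset.sum_comp G (fun a => (x1 a, x2 a)), ← Finset.sum_product',
      Finset.mul_sum]
    calc ∑ p ∈ U.image (fun a => (x1 a, x2 a)), (U.filter fun a => (x1 a, x2 a) = p).card • G p
        ≤ ∑ p ∈ U.image (fun a => (x1 a, x2 a)), 2 * G p := by
          refine Finset.sum_le_sum fun p _ => ?_
          rw [nsmul_eq_mul]
          refine mul_le_mul_of_nonneg_right ?_ (hG0 p)
          have := hinj p.1 p.2
          simp only [Prod.ext_iff]
          exact_mod_cast this
      _ ≤ ∑ p ∈ (Finset.range P ×ˢ Finset.range P).image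
            (fun p : ℕ × ℕ => ((p.1 : ℤ), (p.2 : ℤ))), 2 * G p := by
          refine Finset.sum_le_sum_of_subset_of_nonneg ?_ fun p _ _ => by have := hG0 p; positivity
          intro p hp
          obtain ⟨a, ha, rfl⟩ := Finset.mem_image.1 hp
          refine Finset.mem_image.2 ⟨((x1 a).toNat, (x2 a).toNat), ?_, ?_⟩
          · have := h1 a ha; have := h2 a ha
            simp only [Finset.mem_product, Finset.mem_range]; omega
          · have := h1 a ha; have := h2 a ha
            simp only [Prod.mk.injEq]; omega
      _ = _ := by
          rw [Finset.sum_image]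
          intro p _ q _ h
          simp only [Prod.mk.injEq, Nat.cast_inj] at h
          exact Prod.ext h.1 h.2
  -- step 3
  have s3 : ((∑ s ∈ Finset.range P, ∑ t ∈ Finset.range P, G ((s : ℤ), (t : ℤ)) : ℝ) : ℂ) =
      ∑ z ∈ Z, ∑ z' ∈ Z, c z * (starRingEnd ℂ) (c z') * (Fh P b (f1 z - f1 z') *
        Fh P b (f2 z - f2 z')) := by
    have e1 : ∀ s t : ℤ, ((G (s, t) : ℝ) : ℂ) = ∑ z ∈ Z, ∑ z' ∈ Z, c z * (starRingEnd ℂ) (c z') *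
        ((Dk P b s * (starRingEnd ℂ) (Dk P b s) * ec P (s * (f1 z - f1 z'))) *
         (Dk P b t * (starRingEnd ℂ) (Dk P b t) * ec P (t * (f2 z - f2 z')))) := by
      intro s t
      simp only [G]
      push_cast
      rw [← Complex.mul_conj', ← Complex.mul_conj', ← Complex.mul_conj']
      simp only [T]
      rw [map_sum, Finset.sum_mul_sum, Finset.mul_sum]
      refine Finset.sum_congr rfl fun z _ => ?_
      rw [Finset.mul_sum]
      refine Finset.sum_congr rfl fun z' _ => ?_
      have e2 : ec P (s * f1 z + t * f2 z) * ec P (-(s * f1 z' + t * f2 z')) =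
          ec P (s * (f1 z - f1 z')) * ec P (t * (f2 z - f2 z')) := by
        rw [← ec_add, ← ec_add]; congr 1; ring
      rw [map_mul, ec_conj]
      linear_combination (Dk P b s * (starRingEnd ℂ) (Dk P b s) * (Dk P b t *
        (starRingEnd ℂ) (Dk P b t)) * (c z * (starRingEnd ℂ) (c z'))) * e2
    push_cast
    simp_rw [e1]
    calc _ = ∑ s ∈ Finset.range P, ∑ z ∈ Z, ∑ t ∈ Finset.range P, _ :=
          Finset.sum_congr rfl fun s _ => Finset.sum_comm
      _ = ∑ z ∈ Z, ∑ s ∈ Finset.range P, ∑ t ∈ Finset.range P, _ := Finset.sum_comm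
      _ = _ := by
        refine Finset.sum_congr rfl fun z _ => ?_
        calc _ = ∑ s ∈ Finset.range P, ∑ z' ∈ Z, ∑ t ∈ Finset.range P, _ :=
              Finset.sum_congr rfl fun s _ => Finset.sum_comm
          _ = ∑ z' ∈ Z, ∑ s ∈ Finset.range P, ∑ t ∈ Finset.range P, _ := Finset.sum_comm
          _ = _ := by
            refine Finset.sum_congr rfl fun z' _ => ?_
            rw [Fh, Fh, Finset.sum_mul_sum]; simp only [Finset.mul_sum]
  have s4 : ∑ s ∈ Finset.range P, ∑ t ∈ Finset.range P, G ((s : ℤ), (t : ℤ)) ≤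
      (P * nI) ^ 2 * ∑ z ∈ Z, ∑ z' ∈ Z,
        if Close P X (f1 z - f1 z') ∧ Close P X (f2 z - f2 z') then ‖c z‖ * ‖c z'‖ else 0 := by
    have hn : 0 ≤ ∑ s ∈ Finset.range P, ∑ t ∈ Finset.range P, G ((s : ℤ), (t : ℤ)) :=
      Finset.sum_nonneg fun _ _ => Finset.sum_nonneg fun _ _ => hG0 _
    rw [← Complex.norm_of_nonneg hn, s3, Finset.mul_sum]
    refine (norm_sum_le _ _).trans (Finset.sum_le_sum fun z _ => ?_)
    rw [Finset.mul_sum]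
    refine (norm_sum_le _ _).trans (Finset.sum_le_sum fun z' _ => ?_)
    rw [norm_mul, norm_mul, norm_mul, RCLike.norm_conj]
    have hcl : ∀ v, Fh P b v ≠ 0 → Close P X v := by
      intro v hv
      obtain ⟨w, hw, hd⟩ := (Fh_bound P hP b v hb0 hbP).2 hv
      exact ⟨w, by nlinarith, hd⟩
    have b1 := (Fh_bound P hP b (f1 z - f1 z') hb0 hbP).1
    have b2 := (Fh_bound P hP b (f2 z - f2 z') hb0 hbP).1
    rw [← hnI] at b1 b2
    split_ifs with hcc
    · calc ‖c z‖ * ‖c z'‖ * (‖Fh P b (f1 z - f1 z')‖ * ‖Fh P b (f2 z - f2 z')‖)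
          ≤ ‖c z‖ * ‖c z'‖ * ((P * nI) * (P * nI)) := by gcongr
        _ = _ := by ring
    · by_cases hz1 : Fh P b (f1 z - f1 z') = 0
      · simp [hz1]
      · by_cases hz2 : Fh P b (f2 z - f2 z') = 0
        · simp [hz2]
        · exact absurd ⟨hcl _ hz1, hcl _ hz2⟩ hcc
  set Q := ∑ z ∈ Z, ∑ z' ∈ Z,
        if Close P X (f1 z - f1 z') ∧ Close P X (f2 z - f2 z') then ‖c z‖ * ‖c z'‖ else 0 with hQ
  have hQ0 : 0 ≤ Q := Finset.sum_nonneg fun _ _ => Finset.sum_nonneg fun _ _ => by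
    split_ifs <;> positivity
  calc _ ≤ 16 / nI ^ 4 * (2 * ((P * nI) ^ 2 * Q)) := s1.trans (by gcongr; exact s2.trans (by gcongr))
    _ = 32 / nI ^ 2 * P ^ 2 * Q := by field_simp; ring
    _ ≤ 32 / nI ^ 2 * (8 * X * nI) ^ 2 * Q := by gcongr
    _ = _ := by field_simp; ring

open Classical in
lemma LS {α β : Type*} (P : ℕ) (X : ℤ) (hX : 1 ≤ X) (hXP : X < P)
    (U : Finset α) (x1 x2 : α → ℤ)
    (h1 : ∀ a ∈ U, 0 ≤ x1 a ∧ x1 a ≤ X) (h2 : ∀ a ∈ U, 0 ≤ x2 a ∧ x2 a ≤ X)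
    (hinj : ∀ u v : ℤ, (U.filter fun a => x1 a = u ∧ x2 a = v).card ≤ 2)
    (V : Finset β) (y1 y2 : β → ℤ) (E : Finset ℕ) (K : ℝ) (hK0 : 0 ≤ K)
    (hK : ∀ k ∈ E, ∑ b ∈ V, ∑ b' ∈ V, ((E.filter fun k' : ℕ => Close P X (k * y1 b - k' * y1 b') ∧
      Close P X (k * y2 b - k' * y2 b')).card : ℝ) ≤ K) :
    ∑ k ∈ E, ‖∑ a ∈ U, ∑ b ∈ V, ec P (k * (x1 a * y1 b + x2 a * y2 b))‖ ^ 2 ≤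
      2048 * U.card * X ^ 2 * K := by
  set S : ℕ → ℂ := fun k => ∑ a ∈ U, ∑ b ∈ V, ec P (k * (x1 a * y1 b + x2 a * y2 b)) with hS
  set Q : ℝ := ∑ k ∈ E, ‖S k‖ ^ 2 with hQ
  have hQ0 : 0 ≤ Q := Finset.sum_nonneg fun _ _ => by positivity
  let c : ℕ × β → ℂ := fun z => (starRingEnd ℂ) (S z.1)
  let T : α → ℂ := fun a => ∑ z ∈ E ×ˢ V, c z * ec P (x1 a * (z.1 * y1 z.2) + x2 a * (z.1 * y2 z.2))
  have e1 : (Q : ℂ) = ∑ a ∈ U, T a := by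
    rw [hQ]; push_cast
    simp_rw [← Complex.conj_mul']
    simp only [T, c]
    rw [Finset.sum_comm, Finset.sum_product]
    refine Finset.sum_congr rfl fun k _ => ?_
    nth_rw 2 [hS]
    simp only
    rw [Finset.sum_comm, Finset.mul_sum]
    refine Finset.sum_congr rfl fun b _ => ?_
    rw [Finset.mul_sum]
    refine Finset.sum_congr rfl fun a _ => ?_
    congr 2; ring
  have e2 : Q ≤ ∑ a ∈ U, ‖T a‖ := by
    rw [← Complex.norm_of_nonneg hQ0, e1]; exact norm_sum_le _ _
  have e3 : Q ^ 2 ≤ U.card * ∑ a ∈ U, ‖T a‖ ^ 2 :=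
    (pow_le_pow_left₀ hQ0 e2 2).trans (sq_sum_le_card_mul_sum_sq)
  have e4 := LSdual P X hX hXP U x1 x2 h1 h2 hinj (E ×ˢ V) c (fun z => z.1 * y1 z.2)
    (fun z => z.1 * y2 z.2)
  have csym : ∀ v, Close P X v → Close P X (-v) := by
    rintro v ⟨w, hw, hd⟩
    exact ⟨-w, by rwa [abs_neg], by rw [← dvd_neg, show -(-v - -w) = v - w by ring]; exact hd⟩
  let Cl : ℕ × β → ℕ × β → Prop := fun z z' => Close P X (z.1 * y1 z.2 - z'.1 * y1 z'.2) ∧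
    Close P X (z.1 * y2 z.2 - z'.1 * y2 z'.2)
  have clsym : ∀ z z', Cl z z' → Cl z' z := by
    rintro z z' ⟨p, q⟩
    refine ⟨?_, ?_⟩
    · have := csym _ p; rwa [neg_sub] at this
    · have := csym _ q; rwa [neg_sub] at this
  have e5 : ∑ z ∈ E ×ˢ V, ∑ z' ∈ E ×ˢ V, (if Cl z z' then ‖c z‖ * ‖c z'‖ else 0) ≤ Q * K := by
    have g1 : ∑ z ∈ E ×ˢ V, ∑ z' ∈ E ×ˢ V, (if Cl z z' then ‖c z‖ * ‖c z'‖ else 0) ≤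
        ∑ z ∈ E ×ˢ V, ∑ z' ∈ E ×ˢ V, ((if Cl z z' then ‖c z‖ ^ 2 / 2 else 0) +
          (if Cl z z' then ‖c z'‖ ^ 2 / 2 else 0)) := by
      refine Finset.sum_le_sum fun z _ => Finset.sum_le_sum fun z' _ => ?_
      split_ifs
      · nlinarith [sq_nonneg (‖c z‖ - ‖c z'‖)]
      · simp
    simp_rw [Finset.sum_add_distrib] at g1
    have g2 : ∑ z ∈ E ×ˢ V, ∑ z' ∈ E ×ˢ V, (if Cl z z' then ‖c z'‖ ^ 2 / 2 else 0) =
        ∑ z ∈ E ×ˢ V, ∑ z' ∈ E ×ˢ V, (if Cl z z' then ‖c z‖ ^ 2 / 2 else 0) := by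
      rw [Finset.sum_comm]
      refine Finset.sum_congr rfl fun z _ => Finset.sum_congr rfl fun z' _ => ?_
      exact if_congr ⟨clsym _ _, clsym _ _⟩ rfl rfl
    rw [g2, ← two_mul] at g1
    refine g1.trans ?_
    have g3 : ∀ z ∈ E ×ˢ V, ∑ z' ∈ E ×ˢ V, (if Cl z z' then ‖c z‖ ^ 2 / 2 else 0) =
        ‖S z.1‖ ^ 2 / 2 * ∑ b' ∈ V, ((E.filter fun k' : ℕ => Cl z (k', b')).card : ℝ) := by
      intro z _
      rw [Finset.sum_product_right, Finset.mul_sum]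
      refine Finset.sum_congr rfl fun b' _ => ?_
      rw [← Finset.sum_filter, Finset.sum_const, nsmul_eq_mul, mul_comm]
      simp only [c, RCLike.norm_conj]
    rw [Finset.sum_congr rfl g3, Finset.sum_product, hQ, Finset.sum_mul, Finset.mul_sum]
    refine Finset.sum_le_sum fun k hk => ?_
    simp only [← Finset.mul_sum]
    have := hK k hk
    rw [← mul_assoc, mul_div_cancel₀ _ (two_ne_zero)]
    exact mul_le_mul_of_nonneg_left this (by positivity)
  rcases hQ0.eq_or_lt with h0 | h0
  · rw [← h0]
    positivity
  · have e6 : Q * Q ≤ Q * (2048 * U.card * X ^ 2 * K) := by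
      calc Q * Q = Q ^ 2 := by ring
        _ ≤ U.card * (2048 * X ^ 2 * (Q * K)) := e3.trans (by
            refine mul_le_mul_of_nonneg_left (e4.trans ?_) (by positivity)
            refine mul_le_mul_of_nonneg_left ?_ (by positivity)
            exact e5)
        _ = _ := by ring
    exact le_of_mul_le_mul_left e6 h0

structure Arc (P k : ℕ) (q a r : ℤ) : Prop where
  q1 : 1 ≤ q
  cop : IsCoprime a q
  eq : r = k * q - a * P

lemma arc_exists (P : ℕ) (hP : 1 ≤ P) (k : ℕ) : ∃ q a r : ℤ, Arc P k q a r ∧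
    q ^ 2 ≤ P ∧ r ^ 2 ≤ P := by
  set n := Nat.sqrt P with hn
  have hn0 : 0 < n := Nat.sqrt_pos.2 hP
  obtain ⟨t, ht, hd⟩ := Real.exists_rat_abs_sub_le_and_den_le ((k : ℝ) / P) hn0
  have hPr : (0 : ℝ) < P := by exact_mod_cast hP
  have hden : (0 : ℝ) < t.den := by exact_mod_cast t.den_pos
  have hr : |(k : ℝ) * t.den - t.num * P| ≤ P / (n + 1) := by
    have e : (k : ℝ) * t.den - t.num * P = ((k : ℝ) / P - t) * (P * t.den) := by
      have : (t : ℝ) = t.num / t.den := Rat.cast_def t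
      rw [this]; field_simp
    rw [e, abs_mul, abs_of_pos (by positivity : (0:ℝ) < P * t.den)]
    calc |(k : ℝ) / P - t| * (P * t.den) ≤ 1 / ((n + 1) * t.den) * (P * t.den) := by gcongr
      _ = _ := by field_simp
  refine ⟨t.den, t.num, k * t.den - t.num * P, ⟨by exact_mod_cast t.den_pos, ?_, rfl⟩, ?_, ?_⟩
  · exact (Int.isCoprime_iff_gcd_eq_one.2 (by simpa [Int.gcd] using t.reduced))
  · have : t.den ^ 2 ≤ P := (Nat.pow_le_pow_left hd 2).trans (Nat.sqrt_le' P)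
    exact_mod_cast this
  · have h1 : P < (n + 1) ^ 2 := Nat.lt_succ_sqrt' P
    have h2 : ((P : ℝ)) ≤ (n + 1) ^ 2 := by exact_mod_cast h1.le
    have h3 : ((k : ℝ) * t.den - t.num * P) ^ 2 ≤ P := by
      rw [← sq_abs]
      calc |(k : ℝ) * t.den - t.num * P| ^ 2 ≤ ((P : ℝ) / ((n : ℝ) + 1)) ^ 2 := by gcongr
        _ = (P : ℝ) * ((P : ℝ) / ((n : ℝ) + 1) ^ 2) := by rw [div_pow]; ring
        _ ≤ (P : ℝ) * 1 := by gcongr; rw [div_le_one (by positivity)]; exact h2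
        _ = P := mul_one _
    exact_mod_cast h3

lemma kcount (P : ℕ) (T : Finset ℕ) (hT : ∀ k ∈ T, k < P) (Dc : ℝ) (hDc : 0 ≤ Dc)
    (h : ∀ k ∈ T, ∀ k' ∈ T, ∃ s : ℤ, |((k : ℤ) - k' - s * P : ℤ)| ≤ Dc) :
    (T.card : ℝ) ≤ 2 * Dc + 1 := by
  rcases T.eq_empty_or_nonempty with rfl | ⟨k0, hk0⟩
  · simp; positivity
  choose! s hs using h
  have : T.card ≤ (Finset.Icc (-⌊Dc⌋) ⌊Dc⌋).card := by
    refine Finset.card_le_card_of_injOn (fun k => (k : ℤ) - k0 - s k k0 * P) ?_ ?_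
    · intro k hk
      have h1 := hs k hk k0 hk0
      have h2 : |(k : ℤ) - k0 - s k k0 * P| ≤ ⌊Dc⌋ := by
        rw [Int.le_floor]; exact_mod_cast h1
      rw [Finset.mem_coe, Finset.mem_Icc]; exact abs_le.1 h2
    · intro k hk k' hk' e
      simp only at e
      have h1 := hT k hk; have h2 := hT k' hk'
      have h3 : (P : ℤ) ∣ (k : ℤ) - k' := ⟨s k k0 - s k' k0, by linarith⟩
      have := Int.eq_zero_of_abs_lt_dvd h3 (by rw [abs_lt]; omega)
      omega
  rw [Int.card_Icc] at this
  have h0 : 0 ≤ ⌊Dc⌋ := Int.floor_nonneg.2 hDc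
  have h1 : (T.card : ℤ) ≤ 2 * ⌊Dc⌋ + 1 := by omega
  have h2 : (T.card : ℝ) ≤ 2 * ⌊Dc⌋ + 1 := by exact_mod_cast h1
  linarith [Int.floor_le Dc]

lemma cop_dvd {q m y1 y2 : ℤ} (h : IsCoprime y1 y2) (h1 : q ∣ m * y1) (h2 : q ∣ m * y2) : q ∣ m := by
  obtain ⟨u, v, e⟩ := h
  have : m = u * (m * y1) + v * (m * y2) := by linear_combination (-m) * e
  rw [this]; exact dvd_add (h1.mul_left u) (h2.mul_left v)

lemma close_arc {P k k' : ℕ} {q a r q' a' r' X : ℤ} (hP : 1 ≤ P) (hX : 1 ≤ X) (A : Arc P k q a r)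
    (A' : Arc P k' q' a' r') (y1 y2 y1' y2' : ℤ) (hy1 : 0 ≤ y1) (hy2 : 0 ≤ y2)
    (hy1' : 0 ≤ y1') (hy2' : 0 ≤ y2') (hc : IsCoprime y1 y2) (hc' : IsCoprime y1' y2') (Y : ℝ)
    (b1 : y1 ≤ Y) (b2 : y2 ≤ Y) (b1' : y1' ≤ Y) (b2' : y2' ≤ Y) (M : ℝ) (hq : q ≤ M) (hq' : q' ≤ M)
    (hr : |r| ≤ M) (hr' : |r'| ≤ M) (hM : M ^ 2 * (P / (4 * X) + 2 * Y) < P)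
    (c1 : Close P X (k * y1 - k' * y1')) (c2 : Close P X (k * y2 - k' * y2')) :
    q = q' ∧ ∃ n1 n2 v1 v2 : ℤ, a * y1 - a' * y1' = q * n1 ∧ a * y2 - a' * y2' = q * n2 ∧
      q * v1 = r * y1 - r' * y1' ∧ q * v2 = r * y2 - r' * y2' ∧
      4 * X * |v1| ≤ P ∧ 4 * X * |v2| ≤ P := by
  have hPr : (0 : ℝ) < P := by exact_mod_cast hP
  have hXr : (1 : ℝ) ≤ X := by exact_mod_cast hX
  have main : ∀ y y' : ℤ, 0 ≤ y → 0 ≤ y' → y ≤ Y → y' ≤ Y → Close P X (k * y - k' * y') →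
      ∃ n v : ℤ, 4 * X * |v| ≤ P ∧ q' * a * y - q * a' * y' = q * q' * n ∧
        q * q' * v = q' * r * y - q * r' * y' := by
    rintro y y' hy hy' hyY hyY' ⟨v, hv, n, hn⟩
    have e : (P : ℤ) * (q' * a * y - q * a' * y' - q * q' * n) =
        q * q' * v - q' * r * y + q * r' * y' := by
      rw [A.eq, A'.eq]; linear_combination (q * q') * hn
    have hB : |q * q' * v - q' * r * y + q * r' * y'| < (P : ℤ) := by
      have hvr : |(v : ℝ)| ≤ P / (4 * X) := by
        rw [le_div_iff₀ (by positivity)]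
        have : (4 * X * |v| : ℝ) ≤ P := by exact_mod_cast hv
        push_cast at this; linarith
      have hq0 : (0 : ℝ) ≤ q := by exact_mod_cast (by have := A.q1; omega : (0 : ℤ) ≤ q)
      have hq0' : (0 : ℝ) ≤ q' := by exact_mod_cast (by have := A'.q1; omega : (0 : ℤ) ≤ q')
      have hyr : (0 : ℝ) ≤ y := by exact_mod_cast hy
      have hyr' : (0 : ℝ) ≤ y' := by exact_mod_cast hy'
      have hM0 : 0 ≤ M := hq0.trans hq
      rw [Int.cast_abs] at hr hr'
      have : |(q * q' * v - q' * r * y + q * r' * y' : ℝ)| < P := by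
        refine lt_of_le_of_lt ?_ hM
        calc |(q * q' * v - q' * r * y + q * r' * y' : ℝ)|
            ≤ |(q * q' * v - q' * r * y : ℝ)| + |(q * r' * y' : ℝ)| := abs_add_le _ _
          _ ≤ |(q * q' * v : ℝ)| + |(q' * r * y : ℝ)| + |(q * r' * y' : ℝ)| := by
              gcongr; exact abs_sub _ _
          _ = q * q' * |(v : ℝ)| + q' * |(r : ℝ)| * y + q * |(r' : ℝ)| * y' := by
              simp only [abs_mul, abs_of_nonneg hq0, abs_of_nonneg hq0', abs_of_nonneg hyr,
                abs_of_nonneg hyr']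
          _ ≤ M * M * (P / (4 * X)) + M * M * Y + M * M * Y := by gcongr
          _ = _ := by ring
      exact_mod_cast this
    have hz := Int.eq_zero_of_abs_lt_dvd (Dvd.intro _ e) hB
    rw [hz] at e
    rcases mul_eq_zero.1 e with h | h
    · exfalso; omega
    · exact ⟨n, v, hv, by linarith, by linarith⟩
  obtain ⟨n1, v1, hv1, e1, f1⟩ := main y1 y1' hy1 hy1' b1 b1' c1
  obtain ⟨n2, v2, hv2, e2, f2⟩ := main y2 y2' hy2 hy2' b2 b2' c2
  have hq1 := A.q1
  have hq1' := A'.q1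
  have d1 : q ∣ q' := by
    have h1 : q ∣ (q' * a) * y1 := ⟨a' * y1' + q' * n1, by linarith⟩
    have h2 : q ∣ (q' * a) * y2 := ⟨a' * y2' + q' * n2, by linarith⟩
    exact A.cop.symm.dvd_of_dvd_mul_right (cop_dvd hc h1 h2)
  have d2 : q' ∣ q := by
    have h1 : q' ∣ (q * a') * y1' := ⟨a * y1 - q * n1, by linarith⟩
    have h2 : q' ∣ (q * a') * y2' := ⟨a * y2 - q * n2, by linarith⟩
    exact A'.cop.symm.dvd_of_dvd_mul_right (cop_dvd hc' h1 h2)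
  have hqq : q = q' := Int.dvd_antisymm (by omega) (by omega) d1 d2
  subst hqq
  have hq0 : q ≠ 0 := by omega
  refine ⟨rfl, n1, n2, v1, v2, ?_, ?_, ?_, ?_, hv1, hv2⟩ <;> apply mul_left_cancel₀ hq0 <;> linarith

lemma wedge_arc {P k : ℕ} {q a r a' r' X : ℤ} (hX : 1 ≤ X) (A : Arc P k q a r)
    {y1 y2 y1' y2' n1 n2 v1 v2 : ℤ} (h1 : 0 ≤ y1') (h2 : y1' ≤ y2')
    (e1 : a * y1 - a' * y1' = q * n1) (e2 : a * y2 - a' * y2' = q * n2)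
    (f1 : q * v1 = r * y1 - r' * y1') (f2 : q * v2 = r * y2 - r' * y2')
    (g1 : 4 * X * |v1| ≤ P) (g2 : 4 * X * |v2| ≤ P) :
    q ∣ y1 * y2' - y2 * y1' ∧ 2 * X * (|r| * |y1 * y2' - y2 * y1'|) ≤ q * P * y2' := by
  constructor
  · refine A.cop.symm.dvd_of_dvd_mul_left (?_ : q ∣ a * (y1 * y2' - y2 * y1'))
    exact ⟨n1 * y2' - n2 * y1', by linear_combination y2' * e1 - y1' * e2⟩
  · rw [← abs_mul]
    have e : r * (y1 * y2' - y2 * y1') = q * (v1 * y2' - v2 * y1') := by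
      linear_combination (-y2') * f1 + y1' * f2
    have hq := A.q1
    rw [e, abs_mul, abs_of_nonneg (by omega : 0 ≤ q)]
    have h3 : |v1 * y2' - v2 * y1'| ≤ |v1| * y2' + |v2| * y2' := by
      refine (abs_sub _ _).trans ?_
      rw [abs_mul, abs_mul, abs_of_nonneg h1, abs_of_nonneg (h1.trans h2)]
      gcongr
    have h4 : 4 * X * |v1 * y2' - v2 * y1'| ≤ 2 * P * y2' := by
      calc 4 * X * |v1 * y2' - v2 * y1'| ≤ 4 * X * (|v1| * y2' + |v2| * y2') := by gcongr
        _ = (4 * X * |v1|) * y2' + (4 * X * |v2|) * y2' := by ring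
        _ ≤ P * y2' + P * y2' := by
          have := h1.trans h2
          gcongr
        _ = _ := by ring
    nlinarith

lemma kclose {P k1 k2 : ℕ} {q a r a1 r1 a2 r2 X : ℤ} (hX : 1 ≤ X) (A1 : Arc P k1 q a1 r1)
    (A2 : Arc P k2 q a2 r2) {y1 y2 y1' y2' n1 n2 v2 m1 m2 w2 : ℤ} (h2 : 1 ≤ y2')
    (hc' : IsCoprime y1' y2')
    (e1 : a * y1 - a1 * y1' = q * n1) (e2 : a * y2 - a1 * y2' = q * n2)
    (f2 : q * v2 = r * y2 - r1 * y2') (g2 : 4 * X * |v2| ≤ P)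
    (e1' : a * y1 - a2 * y1' = q * m1) (e2' : a * y2 - a2 * y2' = q * m2)
    (f2' : q * w2 = r * y2 - r2 * y2') (g2' : 4 * X * |w2| ≤ P) :
    ∃ s : ℤ, 2 * X * y2' * |(k1 : ℤ) - k2 - s * P| ≤ P := by
  obtain ⟨s, hs⟩ : q ∣ a1 - a2 := cop_dvd hc' (⟨m1 - n1, by linear_combination e1' - e1⟩)
    (⟨m2 - n2, by linear_combination e2' - e2⟩)
  refine ⟨s, ?_⟩
  have hq := A1.q1
  have e : ((k1 : ℤ) - k2 - s * P) * y2' = w2 - v2 := by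
    apply mul_left_cancel₀ (show q ≠ 0 by omega)
    have := A1.eq; have := A2.eq
    linear_combination (-y2') * A1.eq + y2' * A2.eq + f2 - f2' + (P * y2') * hs
  have h3 : |(k1 : ℤ) - k2 - s * P| * y2' ≤ |w2| + |v2| := by
    rw [← abs_of_nonneg (by omega : 0 ≤ y2'), ← abs_mul, e]; exact abs_sub _ _
  nlinarith

open Classical in
lemma pair_bound {P k : ℕ} {q a r X : ℤ} (hP : 1 ≤ P) (hX : 1 ≤ X) (A : Arc P k q a r)
    (E : Finset ℕ) (M Y : ℝ)
    (hE : ∀ k ∈ E, k < P ∧ ∃ q a r : ℤ, Arc P k q a r ∧ q ≤ M ∧ |r| ≤ M)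
    (hq : q ≤ M) (hr : |r| ≤ M) (y1 y2 y1' y2' : ℤ) (hy1 : 0 ≤ y1) (hy2 : y1 ≤ y2)
    (hy1' : 0 ≤ y1') (hy2' : y1' ≤ y2') (hy : 1 ≤ y2') (hc : IsCoprime y1 y2)
    (hc' : IsCoprime y1' y2') (b2 : y2 ≤ Y) (b2' : y2' ≤ Y)
    (hM : M ^ 2 * (P / (4 * X) + 2 * Y) < P) :
    ((E.filter fun k' : ℕ => Close P X (k * y1 - k' * y1') ∧
      Close P X (k * y2 - k' * y2')).card : ℝ) ≤
    if q ∣ y1 * y2' - y2 * y1' ∧ 2 * X * (|r| * |y1 * y2' - y2 * y1'|) ≤ q * P * y2' then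
      2 * ((P : ℝ) / (2 * X * y2')) + 1 else 0 := by
  set T := E.filter fun k' : ℕ => Close P X (k * y1 - k' * y1') ∧
      Close P X (k * y2 - k' * y2') with hT
  have hXr : (1 : ℝ) ≤ X := by exact_mod_cast hX
  have hyr : (1 : ℝ) ≤ y2' := by exact_mod_cast hy
  have b1 : (y1 : ℝ) ≤ Y := le_trans (by exact_mod_cast hy2) b2
  have b1' : (y1' : ℝ) ≤ Y := le_trans (by exact_mod_cast hy2') b2'
  have key : ∀ k' ∈ T, ∃ a' r' : ℤ, Arc P k' q a' r' ∧ ∃ n1 n2 v1 v2 : ℤ,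
      a * y1 - a' * y1' = q * n1 ∧ a * y2 - a' * y2' = q * n2 ∧
      q * v1 = r * y1 - r' * y1' ∧ q * v2 = r * y2 - r' * y2' ∧
      4 * X * |v1| ≤ P ∧ 4 * X * |v2| ≤ P := by
    intro k' hk'
    rw [hT, Finset.mem_filter] at hk'
    obtain ⟨hkE, c1, c2⟩ := hk'
    obtain ⟨hkP, q', a', r', A', hq', hr'⟩ := hE k' hkE
    obtain ⟨e, h⟩ := close_arc hP hX A A' y1 y2 y1' y2' hy1 (hy1.trans hy2) hy1' (hy1'.trans hy2')
      hc hc' Y b1 b2 b1' b2' M hq hq' hr hr' hM c1 c2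
    subst e
    exact ⟨a', r', A', h⟩
  rcases T.eq_empty_or_nonempty with h0 | ⟨k', hk'⟩
  · rw [h0]
    split_ifs <;> simp
    positivity
  · obtain ⟨a', r', A', n1, n2, v1, v2, e1, e2, f1, f2, g1, g2⟩ := key k' hk'
    rw [if_pos (wedge_arc hX A hy1' hy2' e1 e2 f1 f2 g1 g2)]
    refine kcount P T (fun k hk => (hE k (Finset.mem_filter.1 hk).1).1) _ (by positivity) ?_
    intro k1 hk1 k2 hk2
    obtain ⟨a1, r1, A1, n1, n2, v1, v2, e1, e2, f1, f2, g1, g2⟩ := key k1 hk1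
    obtain ⟨a2, r2, A2, m1, m2, w1, w2, e1', e2', f1', f2', g1', g2'⟩ := key k2 hk2
    obtain ⟨s, hs⟩ := kclose hX A1 A2 hy hc' e1 e2 f2 g2 e1' e2' f2' g2'
    refine ⟨s, ?_⟩
    rw [le_div_iff₀ (by positivity), mul_comm]
    exact_mod_cast hs

lemma line_count (q B α1 α2 : ℤ) (hq : 1 ≤ q) (hB : 0 ≤ B) (hα : IsCoprime α1 α2)
    (T : Finset (ℤ × ℤ)) (hT : ∀ z ∈ T, 0 ≤ z.1 ∧ z.1 ≤ B ∧ 0 ≤ z.2 ∧ z.2 ≤ B ∧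
      q ∣ α1 * z.1 + α2 * z.2) : (T.card : ℤ) ≤ q * (B / q + 1) ^ 2 := by
  obtain ⟨u, v, e⟩ := hα
  have h0 : 0 ≤ B / q := Int.ediv_nonneg hB (by omega)
  have : T.card ≤ (Finset.Ico 0 q ×ˢ Finset.Icc 0 (B / q) ×ˢ Finset.Icc 0 (B / q)).card := by
    refine Finset.card_le_card_of_injOn (fun z => ((v * z.1 - u * z.2) % q, z.1 / q, z.2 / q)) ?_ ?_
    · intro z hz
      obtain ⟨h1, h2, h3, h4, -⟩ := hT z hz
      simp only [Finset.mem_coe, Finset.mem_product, Finset.mem_Ico, Finset.mem_Icc]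
      exact ⟨⟨Int.emod_nonneg _ (by omega), Int.emod_lt_of_pos _ (by omega)⟩,
        ⟨Int.ediv_nonneg h1 (by omega), Int.ediv_le_ediv (by omega) h2⟩,
        ⟨Int.ediv_nonneg h3 (by omega), Int.ediv_le_ediv (by omega) h4⟩⟩
    · rintro ⟨z1, z2⟩ hz ⟨w1, w2⟩ hw h
      obtain ⟨c, hc⟩ := (hT _ hz).2.2.2.2
      obtain ⟨d, hd⟩ := (hT _ hw).2.2.2.2
      simp only [Prod.mk.injEq] at h hc hd
      obtain ⟨g1, g2, g3⟩ := h
      obtain ⟨m, hm⟩ := Int.ModEq.dvd g1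
      have k1 : q ∣ z1 - w1 := ⟨u * (c - d) - α2 * m, by
        linear_combination (-(z1 - w1)) * e + u * hc - u * hd - α2 * hm⟩
      have k2 : q ∣ z2 - w2 := ⟨v * (c - d) + α1 * m, by
        linear_combination (-(z2 - w2)) * e + v * hc - v * hd + α1 * hm⟩
      have m1 : z1 % q = w1 % q := (Int.emod_eq_emod_iff_emod_sub_eq_zero.2 (Int.emod_eq_zero_of_dvd k1))
      have m2 : z2 % q = w2 % q := Int.emod_eq_emod_iff_emod_sub_eq_zero.2 (Int.emod_eq_zero_of_dvd k2)
      have r1 := Int.emod_add_mul_ediv z1 q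
      have r2 := Int.emod_add_mul_ediv w1 q
      have r3 := Int.emod_add_mul_ediv z2 q
      have r4 := Int.emod_add_mul_ediv w2 q
      rw [m1, g2] at r1
      rw [m2, g3] at r3
      ext <;> simp <;> linarith
  rw [Finset.card_product, Finset.card_product, Int.card_Ico, Int.card_Icc] at this
  zify at this
  rw [Int.toNat_of_nonneg (by omega), Int.toNat_of_nonneg (by omega)] at this
  calc (T.card : ℤ) ≤ _ := this
    _ = _ := by ring

lemma sep_count {α : Type*} (T : Finset α) (f : α → ℝ) (x ℓ s : ℝ) (hs : 0 < s) (hℓ : 0 ≤ ℓ)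
    (h1 : ∀ a ∈ T, |f a - x| ≤ ℓ) (h2 : ∀ a ∈ T, ∀ b ∈ T, a ≠ b → s ≤ |f a - f b|) :
    (T.card : ℝ) ≤ 2 * ℓ / s + 1 := by
  have : T.card ≤ (Finset.Icc 0 ⌊2 * ℓ / s⌋).card := by
    refine Finset.card_le_card_of_injOn (fun a => ⌊(f a - (x - ℓ)) / s⌋) ?_ ?_
    · intro a ha
      obtain ⟨l1, l2⟩ := abs_le.1 (h1 a ha)
      rw [Finset.mem_coe, Finset.mem_Icc]
      refine ⟨Int.floor_nonneg.2 (div_nonneg (by linarith) hs.le), Int.floor_le_floor ?_⟩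
      gcongr; linarith
    · intro a ha b hb e
      by_contra hne
      have h3 := h2 a ha b hb hne
      have h4 := Int.abs_sub_lt_one_of_floor_eq_floor e
      rw [← sub_div, abs_div, abs_of_pos hs, div_lt_one hs] at h4
      have : f a - (x - ℓ) - (f b - (x - ℓ)) = f a - f b := by ring
      rw [this] at h4; linarith
  rw [Int.card_Icc] at this
  have h0 : 0 ≤ ⌊2 * ℓ / s⌋ := Int.floor_nonneg.2 (by positivity)
  have h1 : (T.card : ℤ) ≤ ⌊2 * ℓ / s⌋ + 1 := by omega
  have h2 : (T.card : ℝ) ≤ ⌊2 * ℓ / s⌋ + 1 := by exact_mod_cast h1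
  linarith [Int.floor_le (2 * ℓ / s)]

lemma par_card {β : Type*} [DecidableEq β] (T : Finset (List ℤ)) (f : List ℤ → β)
    (h : ∀ l ∈ T, ∀ t ∈ T, f l = f t → l.length % 2 = t.length % 2 → l = t) :
    T.card ≤ 2 * (T.image f).card := by
  have : T.card ≤ (T.image f ×ˢ Finset.range 2).card := by
    refine Finset.card_le_card_of_injOn (fun l => (f l, l.length % 2)) ?_ ?_
    · intro l hl
      simp only [Finset.mem_coe, Finset.mem_product, Finset.mem_range]
      exact ⟨Finset.mem_image_of_mem _ hl, Nat.mod_lt _ (by norm_num)⟩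
    · intro l hl t ht e
      simp only [Prod.mk.injEq] at e
      exact h l hl t ht e.1 e.2
  rw [Finset.card_product, Finset.card_range] at this
  omega

lemma col_cop (l : List ℤ) : IsCoprime (Mt l 0 1) (Mt l 1 1) := by
  rcases neg_one_pow_eq_or ℤ l.length with h | h
  · exact ⟨-Mt l 1 0, Mt l 0 0, by rw [← h, ← Mt_det l]; ring⟩
  · exact ⟨Mt l 1 0, -Mt l 0 0, by have := Mt_det l; rw [h] at this; linarith⟩

open Classical in
lemma row_count (q α1 α2 : ℤ) (p : ℝ) (hq : 1 ≤ q) (hqp : q ≤ 2 * p) (hα : IsCoprime α1 α2)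
    (T : Finset (List ℤ)) (hT : ∀ l ∈ T, Pos l ∧ Mt l 1 1 ≤ 2 * p ∧
      q ∣ α1 * Mt l 1 0 + α2 * Mt l 1 1) : (T.card : ℝ) ≤ 32 * p ^ 2 / q := by
  have hq' : (1 : ℝ) ≤ q := by exact_mod_cast hq
  have h1 := par_card T (fun l => (Mt l 1 0, Mt l 1 1)) (by
    intro l hl t ht e hp
    simp only [Prod.mk.injEq] at e
    exact row_inj (hT l hl).1 (hT t ht).1 e.1 e.2 hp)
  have h2 := line_count q ⌊2 * p⌋ α1 α2 hq (Int.floor_nonneg.2 (by linarith)) hα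
    (T.image (fun l => (Mt l 1 0, Mt l 1 1))) (by
      intro z hz
      obtain ⟨l, hl, rfl⟩ := Finset.mem_image.1 hz
      obtain ⟨g1, g2, g3⟩ := hT l hl
      obtain ⟨-, b1, -, b2, b3, -⟩ := Mt_basic g1
      have := Int.le_floor.2 g2
      exact ⟨b1, by omega, by omega, this, g3⟩)
  have h3 : (((⌊2 * p⌋ / q : ℤ)) : ℝ) ≤ 2 * p / q := by
    rw [le_div_iff₀ (by linarith)]
    calc _ ≤ ((⌊2 * p⌋ : ℤ) : ℝ) := by exact_mod_cast Int.ediv_mul_le _ (by omega)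
      _ ≤ _ := Int.floor_le _
  have h30 : (0 : ℝ) ≤ ((⌊2 * p⌋ / q : ℤ) : ℝ) := by
    exact_mod_cast Int.ediv_nonneg (Int.floor_nonneg.2 (by linarith)) (by omega)
  have h4 : ((T.image (fun l => (Mt l 1 0, Mt l 1 1))).card : ℝ) ≤
      q * ((⌊2 * p⌋ / q : ℤ) + 1) ^ 2 := by exact_mod_cast h2
  have h5 : 1 ≤ 2 * p / q := by rw [le_div_iff₀ (by linarith)]; linarith
  calc (T.card : ℝ) ≤ 2 * (T.image (fun l => (Mt l 1 0, Mt l 1 1))).card := by exact_mod_cast h1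
    _ ≤ 2 * (q * ((⌊2 * p⌋ / q : ℤ) + 1) ^ 2) := by gcongr
    _ ≤ 2 * (q * (2 * p / q + 2 * p / q) ^ 2) := by gcongr
    _ = _ := by field_simp; ring

open Classical in
lemma frac_count (x ℓ B : ℝ) (hℓ : 0 ≤ ℓ) (T : Finset (List ℤ)) (hT : ∀ l ∈ T, Pos l ∧
    Mt l 1 1 ≤ B ∧ |(Mt l 0 1 : ℝ) / Mt l 1 1 - x| ≤ ℓ) :
    (T.card : ℝ) ≤ 2 * (2 * ℓ * B ^ 2 + 1) := by
  rcases T.eq_empty_or_nonempty with rfl | ⟨l0, hl0⟩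
  · simp; positivity
  have hB : (1 : ℝ) ≤ B := le_trans (by exact_mod_cast (Mt_basic (hT l0 hl0).1).2.2.2.1) (hT l0 hl0).2.1
  have h1 := par_card T (fun l => (Mt l 0 1, Mt l 1 1)) (by
    intro l hl t ht e hp
    simp only [Prod.mk.injEq] at e
    exact col_inj (hT l hl).1 (hT t ht).1 e.1 e.2 hp)
  have h2 := sep_count (T.image (fun l => (Mt l 0 1, Mt l 1 1))) (fun z => (z.1 : ℝ) / z.2) x ℓ
    (1 / B ^ 2) (by positivity) hℓ (by
      intro z hz
      obtain ⟨l, hl, rfl⟩ := Finset.mem_image.1 hz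
      exact (hT l hl).2.2) (by
      intro z hz w hw hne
      obtain ⟨l, hl, rfl⟩ := Finset.mem_image.1 hz
      obtain ⟨t, ht, rfl⟩ := Finset.mem_image.1 hw
      obtain ⟨g1, g2, -⟩ := hT l hl
      obtain ⟨g1', g2', -⟩ := hT t ht
      have d1 := (Mt_basic g1).2.2.2.1
      have d2 := (Mt_basic g1').2.2.2.1
      have r1 : (1 : ℝ) ≤ Mt l 1 1 := by exact_mod_cast d1
      have r2 : (1 : ℝ) ≤ Mt t 1 1 := by exact_mod_cast d2
      have hw : Mt l 0 1 * Mt t 1 1 - Mt l 1 1 * Mt t 0 1 ≠ 0 := by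
        intro h0
        have k1 : Mt l 1 1 ∣ Mt t 1 1 := (col_cop l).symm.dvd_of_dvd_mul_left
          ⟨Mt t 0 1, by linarith⟩
        have k2 : Mt t 1 1 ∣ Mt l 1 1 := (col_cop t).symm.dvd_of_dvd_mul_left
          ⟨Mt l 0 1, by linarith⟩
        have k3 := Int.dvd_antisymm (by omega) (by omega) k1 k2
        apply hne
        rw [k3] at h0 ⊢
        have : Mt l 0 1 = Mt t 0 1 := mul_right_cancel₀ (by omega : Mt t 1 1 ≠ 0) (by linarith)
        rw [this]
      have hw1 : (1 : ℝ) ≤ |(Mt l 0 1 * Mt t 1 1 - Mt l 1 1 * Mt t 0 1 : ℝ)| := by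
        exact_mod_cast Int.one_le_abs hw
      simp only
      rw [div_sub_div _ _ (by positivity) (by positivity), abs_div,
        abs_of_pos (by positivity : (0 : ℝ) < Mt l 1 1 * Mt t 1 1), sq]
      gcongr)
  calc (T.card : ℝ) ≤ 2 * (T.image (fun l => (Mt l 0 1, Mt l 1 1))).card := by exact_mod_cast h1
    _ ≤ 2 * (2 * ℓ / (1 / B ^ 2) + 1) := by gcongr
    _ = _ := by field_simp

lemma split_p (p n : ℝ) (hp : 1 ≤ p) (hn : p ^ (49 / 25 : ℝ) ≤ n) : p ^ 2 ≤ p ^ (1 / 25 : ℝ) * n := by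
  have h0 : 0 < p := by linarith
  calc p ^ 2 = p ^ (1 / 25 : ℝ) * p ^ (49 / 25 : ℝ) := by
        rw [← Real.rpow_add h0, ← Real.rpow_natCast]; norm_num
    _ ≤ _ := by gcongr

open Classical in
lemma wedge_count {B : Type*} (P : ℕ) (p H c0 C : ℝ) (Λ Ξ : Finset (List ℤ)) (𝓑 : Finset B)
    (β : B → List ℤ) (q r X y1' y2' : ℤ) (hP : 1 ≤ P)
    (hH : 1 ≤ H) (hp : 9 * H ^ 2 < p) (hc0 : 0 < c0) (hc1 : c0 ≤ 1) (hC : 1 ≤ C)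
    (hΛ : ∀ l ∈ Λ, Pos l ∧ p ≤ Mt l 1 1 ∧ Mt l 1 1 ≤ 2 * p)
    (hΞ : ∀ l ∈ Ξ, Pos l ∧ p ≤ Mt l 1 1 ∧ Mt l 1 1 ≤ C * p)
    (hβ : ∀ t ∈ 𝓑, Pos (β t))
    (hΛc : p ^ (49 / 25 : ℝ) ≤ Λ.card) (hΞc : p ^ (49 / 25 : ℝ) ≤ Ξ.card)
    (hD : ∀ ξ ∈ Ξ, ∀ t ∈ 𝓑, ∀ b ∈ Λ, c0 * P ≤ 4 * p * Mt (ξ ++ (β t ++ b.reverse)) 1 1)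
    (hq : 1 ≤ q) (hq2 : q ≤ 2 * H) (hqr : H ≤ q ∨ H ≤ |r|) (hX : p ≤ X)
    (hy2 : 1 ≤ y2') (hc : IsCoprime y1' y2') :
    ∑ ξ ∈ Ξ, ∑ t ∈ 𝓑, ∑ b ∈ Λ,
      (if q ∣ Mt (ξ ++ (β t ++ b.reverse)) 0 1 * y2' - Mt (ξ ++ (β t ++ b.reverse)) 1 1 * y1' ∧
        2 * X * (|r| * |Mt (ξ ++ (β t ++ b.reverse)) 0 1 * y2' -
          Mt (ξ ++ (β t ++ b.reverse)) 1 1 * y1'|) ≤ q * P * y2' then (1 : ℝ) else 0) ≤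
      32 * C ^ 2 / c0 * (Ξ.card * (𝓑.card * Λ.card)) * p ^ (1 / 25 : ℝ) / √H := by
  have hp1 : 1 ≤ p := by nlinarith
  have hp0 : 0 < p := by linarith
  have hs0 : 0 < √H := Real.sqrt_pos.2 (by linarith)
  have hs1 : 1 ≤ √H := Real.one_le_sqrt.2 hH
  have hss : √H * √H = H := Real.mul_self_sqrt (by linarith)
  have hq' : (1 : ℝ) ≤ q := by exact_mod_cast hq
  have hCc : 1 ≤ C ^ 2 / c0 := by rw [le_div_iff₀ hc0]; nlinarith
  by_cases hcase : √H ≤ q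
  · have inner : ∀ ξ ∈ Ξ, ∀ t ∈ 𝓑, ∑ b ∈ Λ,
      (if q ∣ Mt (ξ ++ (β t ++ b.reverse)) 0 1 * y2' - Mt (ξ ++ (β t ++ b.reverse)) 1 1 * y1' ∧
        2 * X * (|r| * |Mt (ξ ++ (β t ++ b.reverse)) 0 1 * y2' -
          Mt (ξ ++ (β t ++ b.reverse)) 1 1 * y1'|) ≤ q * P * y2' then (1 : ℝ) else 0) ≤
          32 * (p ^ (1 / 25 : ℝ) * Λ.card) / √H := by
      intro ξ hξ t ht
      rw [Finset.sum_boole]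
      set G := Mt (ξ ++ β t) with hG
      have hdet := Mt_det (ξ ++ β t)
      rw [← hG] at hdet
      obtain ⟨u, v, huv⟩ := hc
      have hα : IsCoprime (G 0 0 * y2' - G 1 0 * y1') (G 0 1 * y2' - G 1 1 * y1') := by
        rcases neg_one_pow_eq_or ℤ (ξ ++ β t).length with h | h
        · rw [h] at hdet
          exact ⟨u * G 0 1 + v * G 1 1, -(u * G 0 0 + v * G 1 0), by
            linear_combination (u * y1' + v * y2') * hdet + huv⟩
        · rw [h] at hdet
          exact ⟨-(u * G 0 1 + v * G 1 1), (u * G 0 0 + v * G 1 0), by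
            linear_combination (-(u * y1' + v * y2')) * hdet + huv⟩
      refine (row_count q _ _ p hq (by nlinarith) hα _ ?_).trans ?_
      · intro b hb
        obtain ⟨hb, hd, -⟩ := Finset.mem_filter.1 hb
        obtain ⟨g1, g2, g3⟩ := hΛ b hb
        refine ⟨g1, g3, ?_⟩
        rw [← List.append_assoc, Mt_app _ b.reverse, Mt_app _ b.reverse, Mt_reverse, ← hG] at hd
        simp only [Matrix.transpose_apply] at hd
        convert hd using 1; ring
      · gcongr
        exact split_p p _ hp1 hΛc
    calc _ ≤ ∑ ξ ∈ Ξ, ∑ t ∈ 𝓑, 32 * (p ^ (1 / 25 : ℝ) * Λ.card) / √H :=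
          Finset.sum_le_sum fun ξ hξ => Finset.sum_le_sum fun t ht => inner ξ hξ t ht
      _ = 1 * (32 * (Ξ.card * (𝓑.card * Λ.card)) * p ^ (1 / 25 : ℝ) / √H) := by
          simp only [Finset.sum_const, nsmul_eq_mul]; ring
      _ ≤ C ^ 2 / c0 * (32 * (Ξ.card * (𝓑.card * Λ.card)) * p ^ (1 / 25 : ℝ) / √H) := by gcongr
      _ = _ := by ring
  · push Not at hcase
    have hrH : H ≤ |r| := by
      rcases hqr with h | h
      · exfalso; nlinarith
      · exact h
    have hXr : (1 : ℝ) ≤ X := hp1.trans hX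
    have hPr : (1 : ℝ) ≤ P := by exact_mod_cast hP
    have hyr : (1 : ℝ) ≤ y2' := by exact_mod_cast hy2
    have inner : ∀ t ∈ 𝓑, ∀ b ∈ Λ, ∑ ξ ∈ Ξ,
      (if q ∣ Mt (ξ ++ (β t ++ b.reverse)) 0 1 * y2' - Mt (ξ ++ (β t ++ b.reverse)) 1 1 * y1' ∧
        2 * X * (|r| * |Mt (ξ ++ (β t ++ b.reverse)) 0 1 * y2' -
          Mt (ξ ++ (β t ++ b.reverse)) 1 1 * y1'|) ≤ q * P * y2' then (1 : ℝ) else 0) ≤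
          32 * (C ^ 2 / c0) * (p ^ (1 / 25 : ℝ) * Ξ.card) / √H := by
      intro t ht b hb
      rw [Finset.sum_boole]
      have hps : √H ≤ p ^ 2 := by nlinarith
      refine (frac_count ((y1' : ℝ) / y2') (3 / (c0 * √H)) (C * p) (by positivity) _ ?_).trans ?_
      · intro ξ hξ
        obtain ⟨hξ, -, hd⟩ := Finset.mem_filter.1 hξ
        obtain ⟨g1, g2, g3⟩ := hΞ ξ hξ
        refine ⟨g1, g3, ?_⟩
        have hD' := hD ξ hξ t ht b hb
        have hw : Pos (β t ++ b.reverse) := (hβ t ht).append (hΛ b hb).1.rev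
        have hdet := Mt_det ξ
        rw [Mt_app ξ, Mt_app ξ] at hd
        rw [Mt_app ξ] at hD'
        obtain ⟨-, w1, w2, w3, -, w4, -⟩ := Mt_basic hw
        obtain ⟨f0, f1, f2, f3, f4, f5, -⟩ := Mt_basic g1
        set u := Mt (β t ++ b.reverse) 0 1
        set v := Mt (β t ++ b.reverse) 1 1
        set y1 := Mt ξ 0 0 * u + Mt ξ 0 1 * v with hy1
        set y2 := Mt ξ 1 0 * u + Mt ξ 1 1 * v with hy2'
        have hy2p : Mt ξ 1 1 * v ≤ y2 := by nlinarith
        have hpr : (0 : ℝ) < Mt ξ 1 1 := by linarith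
        have hvr : (1 : ℝ) ≤ v := by exact_mod_cast w3
        have hy2r : (Mt ξ 1 1 * v : ℝ) ≤ y2 := by exact_mod_cast hy2p
        have hy0 : (0 : ℝ) < y2 := by nlinarith
        have s1 : |(Mt ξ 0 1 : ℝ) / Mt ξ 1 1 - y1 / y2| ≤ 1 / p ^ 2 := by
          rw [div_sub_div _ _ hpr.ne' hy0.ne', abs_div, abs_of_pos (by positivity : (0:ℝ) < Mt ξ 1 1 * y2)]
          have e : Mt ξ 0 1 * y2 - Mt ξ 1 1 * y1 = - ((-1) ^ ξ.length * u) := by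
            rw [← hdet, hy1, hy2']; ring
          have e2 : |Mt ξ 0 1 * y2 - Mt ξ 1 1 * y1| = u := by
            rw [e, abs_neg, abs_mul, abs_pow]; simp [abs_of_nonneg w2]
          have e3 : |(Mt ξ 0 1 * y2 - Mt ξ 1 1 * y1 : ℝ)| = u := by exact_mod_cast e2
          rw [e3, div_le_div_iff₀ (by positivity) (by positivity), one_mul]
          have huv : (u : ℝ) ≤ v := by exact_mod_cast w4
          calc (u : ℝ) * p ^ 2 ≤ (v : ℝ) * ((Mt ξ 1 1 : ℤ) : ℝ) ^ 2 := by gcongr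
            _ = ((Mt ξ 1 1 : ℤ) : ℝ) * (((Mt ξ 1 1 : ℤ) : ℝ) * (v : ℝ)) := by ring
            _ ≤ _ := by gcongr
        have s2 : |(y1 : ℝ) / y2 - y1' / y2'| ≤ 2 / (c0 * √H) := by
          rw [div_sub_div _ _ hy0.ne' (by positivity), abs_div, abs_of_pos (by positivity : (0:ℝ) < y2 * y2'),
            div_le_div_iff₀ (by positivity) (by positivity)]
          have hdr : (2 * X * (|r| * |y1 * y2' - y2 * y1'|) : ℝ) ≤ q * P * y2' := by exact_mod_cast hd
          push_cast at hdr hrH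
          have hD'' : c0 * P ≤ 4 * p * y2 := hD'
          set w := |(y1 * y2' - y2 * y1' : ℝ)| with hw
          have hw0 : 0 ≤ w := abs_nonneg _
          have t1 : 2 * p * (H * w) ≤ √H * P * y2' := by
            calc 2 * p * (H * w) ≤ 2 * X * (|(r : ℝ)| * w) := by gcongr
              _ ≤ q * P * y2' := hdr
              _ ≤ _ := by gcongr
          have t2 : 2 * p * √H * w ≤ P * y2' := by
            have t0 : √H * (2 * p * √H * w) ≤ √H * (P * y2') := by
              calc √H * (2 * p * √H * w) = 2 * p * ((√H * √H) * w) := by ring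
                _ ≤ _ := by rw [hss]; linarith
            exact le_of_mul_le_mul_left t0 hs0
          have t3 : 2 * p * (c0 * √H * w) ≤ 2 * p * (2 * (y2 * y2')) := by
            calc 2 * p * (c0 * √H * w) = c0 * (2 * p * √H * w) := by ring
              _ ≤ c0 * (P * y2') := by gcongr
              _ = (c0 * P) * y2' := by ring
              _ ≤ (4 * p * y2) * y2' := by gcongr
              _ = _ := by ring
          have := le_of_mul_le_mul_left t3 (by positivity)
          linarith
        have s3 : 1 / p ^ 2 ≤ 1 / (c0 * √H) := by
          apply one_div_le_one_div_of_le (by positivity)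
          nlinarith
        calc _ ≤ |(Mt ξ 0 1 : ℝ) / Mt ξ 1 1 - y1 / y2| + |(y1 : ℝ) / y2 - y1' / y2'| := abs_sub_le _ _ _
          _ ≤ 1 / (c0 * √H) + 2 / (c0 * √H) := by linarith
          _ = _ := by ring
      · have h1 : (1 : ℝ) ≤ (C ^ 2 / c0) * p ^ 2 / √H := by
          rw [le_div_iff₀ hs0]; nlinarith
        calc 2 * (2 * (3 / (c0 * √H)) * (C * p) ^ 2 + 1)
            ≤ 2 * (2 * (3 / (c0 * √H)) * (C * p) ^ 2 + (C ^ 2 / c0) * p ^ 2 / √H) := by gcongr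
          _ = 14 * (C ^ 2 / c0) * p ^ 2 / √H := by field_simp; ring
          _ ≤ 32 * (C ^ 2 / c0) * (p ^ (1 / 25 : ℝ) * Ξ.card) / √H := by
            have := split_p p _ hp1 hΞc
            gcongr
            norm_num
    calc _ = ∑ t ∈ 𝓑, ∑ b ∈ Λ, ∑ ξ ∈ Ξ, _ := by
          rw [Finset.sum_comm]
          refine Finset.sum_congr rfl fun t _ => ?_
          rw [Finset.sum_comm]
      _ ≤ ∑ t ∈ 𝓑, ∑ b ∈ Λ, 32 * (C ^ 2 / c0) * (p ^ (1 / 25 : ℝ) * Ξ.card) / √H :=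
          Finset.sum_le_sum fun t ht => Finset.sum_le_sum fun b hb => inner t ht b hb
      _ = _ := by
          simp only [Finset.sum_const, nsmul_eq_mul]; ring

open Classical in
lemma shellS {B : Type*} (P : ℕ) (p H c0 C : ℝ) (Λ Ξ : Finset (List ℤ)) (𝓑 : Finset B)
    (β : B → List ℤ) (E : Finset ℕ)
    (hH : 1 ≤ H) (hp : 9 * H ^ 2 < p) (hc0 : 0 < c0) (hc1 : c0 ≤ 1) (hC : 1 ≤ C) (hPp : 2 * p < P)
    (hΛ : ∀ l ∈ Λ, Pos l ∧ p ≤ Mt l 1 1 ∧ Mt l 1 1 ≤ 2 * p)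
    (hΞ : ∀ l ∈ Ξ, Pos l ∧ p ≤ Mt l 1 1 ∧ Mt l 1 1 ≤ C * p)
    (hβ : ∀ t ∈ 𝓑, Pos (β t))
    (hΛc : p ^ (49 / 25 : ℝ) ≤ Λ.card) (hΞc : p ^ (49 / 25 : ℝ) ≤ Ξ.card)
    (hD : ∀ a ∈ Λ, ∀ ξ ∈ Ξ, ∀ t ∈ 𝓑, ∀ b ∈ Λ,
      c0 * P ≤ Mt (a ++ (ξ ++ (β t ++ b.reverse))) 1 1 ∧ Mt (a ++ (ξ ++ (β t ++ b.reverse))) 1 1 ≤ (P : ℝ))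
    (hE : ∀ k ∈ E, k < P ∧ ∃ q a r : ℤ, Arc P k q a r ∧ q ≤ 2 * H ∧ |r| ≤ 2 * H ∧ (H ≤ q ∨ H ≤ |r|)) :
    ∑ k ∈ E, ‖∑ a ∈ Λ, ∑ b ∈ Ξ ×ˢ 𝓑 ×ˢ Λ,
      ec P (k * Mt (a ++ (b.1 ++ (β b.2.1 ++ b.2.2.reverse))) 1 1)‖ ^ 2 ≤
      2000000 * C ^ 2 / c0 ^ 2 * (Λ.card * (Ξ.card * (𝓑.card * Λ.card))) ^ 2 *
        p ^ (2 / 25 : ℝ) / √H := by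
  have hp1 : 1 ≤ p := by nlinarith
  have hp0 : 0 < p := by linarith
  have hPr : (1 : ℝ) ≤ P := by linarith
  have hs0 : 0 < √H := Real.sqrt_pos.2 (by linarith)
  set X : ℤ := ⌊2 * p⌋ with hX
  have hXp : (X : ℝ) ≤ 2 * p := Int.floor_le _
  have hpX : p ≤ X := by have := Int.lt_floor_add_one (2 * p); linarith
  have hX1 : 1 ≤ X := by exact_mod_cast hp1.trans hpX
  obtain ⟨a0, ha0⟩ : Λ.Nonempty := by
    rw [← Finset.card_pos]
    have : (0 : ℝ) < Λ.card := lt_of_lt_of_le (by positivity) hΛc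
    exact_mod_cast this
  have hy : ∀ ξ ∈ Ξ, ∀ t ∈ 𝓑, ∀ b ∈ Λ, Pos (ξ ++ (β t ++ b.reverse)) := fun ξ hξ t ht b hb =>
    (hΞ ξ hξ).1.append ((hβ t ht).append (hΛ b hb).1.rev)
  have hlo : ∀ ξ ∈ Ξ, ∀ t ∈ 𝓑, ∀ b ∈ Λ, c0 * P ≤ 4 * p * Mt (ξ ++ (β t ++ b.reverse)) 1 1 := by
    intro ξ hξ t ht b hb
    have h1 := (hD a0 ha0 ξ hξ t ht b hb).1
    have h2 := (D_append (hΛ a0 ha0).1 (hy ξ hξ t ht b hb)).2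
    have h3 : (Mt (a0 ++ (ξ ++ (β t ++ b.reverse))) 1 1 : ℝ) ≤
      2 * (Mt a0 1 1 * Mt (ξ ++ (β t ++ b.reverse)) 1 1) := by exact_mod_cast h2
    have h4 := (hΛ a0 ha0).2.2
    have h5 : (1 : ℝ) ≤ Mt (ξ ++ (β t ++ b.reverse)) 1 1 := by
      exact_mod_cast (Mt_basic (hy ξ hξ t ht b hb)).2.2.2.1
    nlinarith
  have hhi : ∀ ξ ∈ Ξ, ∀ t ∈ 𝓑, ∀ b ∈ Λ, (Mt (ξ ++ (β t ++ b.reverse)) 1 1 : ℝ) ≤ P / p := by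
    intro ξ hξ t ht b hb
    have h1 := (hD a0 ha0 ξ hξ t ht b hb).2
    have h2 := (D_append (hΛ a0 ha0).1 (hy ξ hξ t ht b hb)).1
    have h3 : (Mt a0 1 1 * Mt (ξ ++ (β t ++ b.reverse)) 1 1 : ℝ) ≤
      Mt (a0 ++ (ξ ++ (β t ++ b.reverse))) 1 1 := by exact_mod_cast h2
    have h4 := (hΛ a0 ha0).2.1
    have h5 : (1 : ℝ) ≤ Mt (ξ ++ (β t ++ b.reverse)) 1 1 := by
      exact_mod_cast (Mt_basic (hy ξ hξ t ht b hb)).2.2.2.1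
    rw [le_div_iff₀ hp0]
    nlinarith
  set V := Ξ ×ˢ 𝓑 ×ˢ Λ with hV
  set yy : List ℤ × B × List ℤ → List ℤ := fun b => b.1 ++ (β b.2.1 ++ b.2.2.reverse) with hyy
  set Q : ℝ := 32 * C ^ 2 / c0 * (Ξ.card * (𝓑.card * Λ.card)) * p ^ (1 / 25 : ℝ) / √H with hQ
  have hQ0 : 0 ≤ Q := by positivity
  have hVc : (V.card : ℝ) = Ξ.card * (𝓑.card * Λ.card) := by
    rw [hV, Finset.card_product, Finset.card_product]; push_cast; ring
  have main := LS P X hX1 (by have : (X : ℝ) < P := by linarith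
                              exact_mod_cast this) Λ (fun a => Mt a 1 0) (fun a => Mt a 1 1)
    (by
      intro a ha
      obtain ⟨-, b1, -, -, b3, -⟩ := Mt_basic (hΛ a ha).1
      have := Int.le_floor.2 (hΛ a ha).2.2
      exact ⟨b1, by omega⟩)
    (by
      intro a ha
      obtain ⟨-, b1, -, b2, b3, -⟩ := Mt_basic (hΛ a ha).1
      have := Int.le_floor.2 (hΛ a ha).2.2
      exact ⟨by omega, by omega⟩)
    (by
      intro u v
      refine (par_card _ (fun _ => ()) ?_).trans ?_
      · intro l hl t ht _ hpar
        obtain ⟨hl, l1, l2⟩ := Finset.mem_filter.1 hl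
        obtain ⟨ht, t1, t2⟩ := Finset.mem_filter.1 ht
        exact row_inj (hΛ l hl).1 (hΛ t ht).1 (l1.trans t1.symm) (l2.trans t2.symm) hpar
      · have := Finset.card_le_univ ((Λ.filter fun a => Mt a 1 0 = u ∧ Mt a 1 1 = v).image (fun _ => ()))
        simp at this ⊢
        omega)
    V (fun b => Mt (yy b) 0 1) (fun b => Mt (yy b) 1 1) E (5 / c0 * Q * V.card) (by positivity) (by
      intro k hk
      obtain ⟨hkP, q, a, r, A, hq, hr, hqr⟩ := hE k hk
      rw [Finset.sum_comm]
      have hb : ∀ b' ∈ V, ∑ b ∈ V, ((E.filter fun k' : ℕ =>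
          Close P X (k * Mt (yy b) 0 1 - k' * Mt (yy b') 0 1) ∧
          Close P X (k * Mt (yy b) 1 1 - k' * Mt (yy b') 1 1)).card : ℝ) ≤ 5 / c0 * Q := by
        rintro ⟨ξ', t', b'⟩ hb'
        simp only [hV, Finset.mem_product] at hb'
        obtain ⟨i1, i2, i3⟩ := hb'
        obtain ⟨-, -, k2, k3, -, k5, -⟩ := Mt_basic (hy ξ' i1 t' i2 b' i3)
        have hcnt := wedge_count P p H c0 C Λ Ξ 𝓑 β q r X (Mt (yy (ξ', t', b')) 0 1)
          (Mt (yy (ξ', t', b')) 1 1) (by exact_mod_cast hPr) hH hp hc0 hc1 hC hΛ hΞ hβ hΛc hΞc hlo A.q1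
          hq hqr hpX k3 (col_cop _)
        rw [hV, Finset.sum_product]
        simp only [Finset.sum_product]
        calc _ ≤ ∑ ξ ∈ Ξ, ∑ t ∈ 𝓑, ∑ b ∈ Λ, 5 / c0 * _ := by
              refine Finset.sum_le_sum fun ξ hξ => Finset.sum_le_sum fun t ht =>
                Finset.sum_le_sum fun b hb => ?_
              obtain ⟨-, -, l2, l3, -, l5, -⟩ := Mt_basic (hy ξ hξ t ht b hb)
              refine (pair_bound (by exact_mod_cast hPr) hX1 A E (2 * H) (P / p) ?_ hq hr _ _ _ _ l2 l5
                k2 k5 k3 (col_cop _) (col_cop _) (hhi ξ hξ t ht b hb) (hhi ξ' i1 t' i2 b' i3) ?_).trans ?_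
              · intro k hk
                obtain ⟨hkP, q, a, r, A, hq, hr, hqr⟩ := hE k hk
                exact ⟨hkP, q, a, r, A, hq, hr⟩
              · calc (2 * H) ^ 2 * (P / (4 * X) + 2 * (P / p)) ≤
                      (2 * H) ^ 2 * (P / (4 * p) + 2 * (P / p)) := by gcongr
                  _ = (9 * H ^ 2) * (P / p) := by field_simp; ring
                  _ < p * (P / p) := by gcongr
                  _ = P := by field_simp
              · rw [← mul_boole]
                have := hlo ξ' i1 t' i2 b' i3
                have k3r : (1 : ℝ) ≤ Mt (ξ' ++ (β t' ++ b'.reverse)) 1 1 := by exact_mod_cast k3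
                refine mul_le_mul_of_nonneg_right ?_ (by positivity)
                have h1 : (P : ℝ) / (2 * X * Mt (ξ' ++ (β t' ++ b'.reverse)) 1 1) ≤ 2 / c0 := by
                  rw [div_le_div_iff₀ (by positivity) hc0]
                  nlinarith
                have h2 : 1 ≤ 1 / c0 := by rw [le_div_iff₀ hc0]; linarith
                calc _ ≤ 2 * (2 / c0) + 1 / c0 := by gcongr
                  _ = _ := by ring
          _ ≤ _ := by
              simp only [← Finset.mul_sum]
              gcongr
      calc _ ≤ ∑ b' ∈ V, 5 / c0 * Q := Finset.sum_le_sum hb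
        _ = _ := by simp; ring)
  have e : ∀ k : ℕ, ∀ a : List ℤ, ∀ b : List ℤ × B × List ℤ,
      (k * Mt (a ++ (b.1 ++ (β b.2.1 ++ b.2.2.reverse))) 1 1 : ℤ) =
      k * (Mt a 1 0 * Mt (yy b) 0 1 + Mt a 1 1 * Mt (yy b) 1 1) := by
    intro k a b; rw [Mt_app a]
  simp only [e]
  refine main.trans ?_
  have hX2 : (X : ℝ) ^ 2 ≤ 4 * (p ^ (1 / 25 : ℝ) * Λ.card) := by
    have := split_p p _ hp1 hΛc
    have h0 : (0 : ℝ) ≤ X := by linarith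
    nlinarith
  have hpp : p ^ (1 / 25 : ℝ) * p ^ (1 / 25 : ℝ) = p ^ (2 / 25 : ℝ) := by
    rw [← Real.rpow_add hp0]; norm_num
  calc 2048 * (Λ.card : ℝ) * (X : ℝ) ^ 2 * (5 / c0 * Q * V.card)
      ≤ 2048 * Λ.card * (4 * (p ^ (1 / 25 : ℝ) * Λ.card)) * (5 / c0 * Q * V.card) := by gcongr
    _ = 1310720 * C ^ 2 / c0 ^ 2 * (Λ.card * (Ξ.card * (𝓑.card * Λ.card))) ^ 2 *
        (p ^ (1 / 25 : ℝ) * p ^ (1 / 25 : ℝ)) / √H := by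
        rw [hQ, hVc]; field_simp; ring
    _ ≤ _ := by rw [hpp]; gcongr; norm_num

lemma int_card {α : Type*} (T : Finset α) (f : α → ℤ) (B : ℝ) (hB : 0 ≤ B)
    (hf : ∀ a ∈ T, |(f a : ℝ)| ≤ B) (hi : ∀ a ∈ T, ∀ b ∈ T, f a = f b → a = b) :
    (T.card : ℝ) ≤ 2 * B + 1 := by
  have : T.card ≤ (Finset.Icc (-⌊B⌋) ⌊B⌋).card := by
    refine Finset.card_le_card_of_injOn f ?_ (fun a ha b hb e => hi a ha b hb e)
    intro k hk
    have h2 : |f k| ≤ ⌊B⌋ := by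
      rw [Int.le_floor]; exact_mod_cast hf k hk
    rw [Finset.mem_coe, Finset.mem_Icc]; exact abs_le.1 h2
  rw [Int.card_Icc] at this
  have h0 : 0 ≤ ⌊B⌋ := Int.floor_nonneg.2 hB
  have h1 : (T.card : ℤ) ≤ 2 * ⌊B⌋ + 1 := by omega
  have h2 : (T.card : ℝ) ≤ 2 * ⌊B⌋ + 1 := by exact_mod_cast h1
  linarith [Int.floor_le B]

lemma card_fib {α β : Type*} [DecidableEq β] (T : Finset α) (f : α → β) (n m : ℝ) (hn : 0 ≤ n)
    (h1 : ∀ a ∈ T, ((T.filter fun x => f x = f a).card : ℝ) ≤ n)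
    (h2 : ((T.image f).card : ℝ) ≤ m) : (T.card : ℝ) ≤ n * m := by
  have : T.card ≤ ⌊n⌋₊ * (T.image f).card := by
    refine Finset.card_le_mul_card_image T _ ?_
    intro b hb
    obtain ⟨a, ha, rfl⟩ := Finset.mem_image.1 hb
    exact Nat.le_floor (h1 a ha)
  calc (T.card : ℝ) ≤ ⌊n⌋₊ * (T.image f).card := by exact_mod_cast this
    _ ≤ n * m := by gcongr; exact Nat.floor_le hn

lemma Dt_count (P k : ℕ) (q a r : ℤ) (A : Arc P k q a r) (hP : 1 ≤ P) (X Y C1 H : ℝ) (hX : 0 < X)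
    (hY : 0 < Y) (hC : 1 ≤ C1) (hXY : P ≤ C1 * X * Y) (hq2 : (q : ℝ) ^ 2 ≤ P) (hr2 : (r : ℝ) ^ 2 ≤ P)
    (hH : 1 ≤ H) (hqr : H ≤ q ∨ H ≤ |(r : ℝ)|) (hH2 : H ^ 2 ≤ P) (hYH : Y ^ 2 * H ≤ P) (hHY : H ≤ Y ^ 2)
    (T : Finset ℤ) (hT : ∀ D ∈ T, |(D : ℝ)| ≤ Y ^ 2 ∧ ∃ n v : ℤ, k * D = P * n + v ∧
      |(v : ℝ)| ≤ P * Y / (2 * X)) : (T.card : ℝ) ≤ 25 * C1 ^ 2 * Y ^ 2 / H := by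
  choose! hT1 n v hnv hv using hT
  have hPr : (1 : ℝ) ≤ P := by exact_mod_cast hP
  have hP0 : (0 : ℝ) < P := by linarith
  have hq1 : (1 : ℝ) ≤ q := by exact_mod_cast A.q1
  have hH0 : 0 < H := by linarith
  set h : ℝ := max (q : ℝ) |(r : ℝ)| with hh
  have hqh : (q : ℝ) ≤ h := le_max_left _ _
  have hrh : |(r : ℝ)| ≤ h := le_max_right _ _
  have hh0 : 0 < h := by linarith
  have hHh : H ≤ h := by rcases hqr with h | h <;> linarith
  have hh2 : h ^ 2 ≤ P := by
    rcases max_choice (q : ℝ) |(r : ℝ)| with e | e <;> rw [hh, e]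
    · exact hq2
    · rw [sq_abs]; exact hr2
  have eδ : ∀ D ∈ T, (P : ℤ) * (D * a - q * n D) = q * v D - D * r := by
    intro D hD
    have := hnv D hD
    rw [A.eq]; linear_combination q * this
  have hPXY : P * Y / X ≤ C1 * Y ^ 2 := by
    rw [div_le_iff₀ hX]; nlinarith
  set Δ : ℝ := 2 * C1 * h * Y ^ 2 / P with hΔ
  set S : ℝ := 2 * C1 * Y ^ 2 / h with hS
  have hS0 : 0 ≤ S := by positivity
  have i1 : ∀ D ∈ T, |((D * a - q * n D : ℤ) : ℝ)| ≤ Δ := by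
    intro D hD
    have e : (P : ℝ) * ((D * a - q * n D : ℤ) : ℝ) = q * v D - D * r := by exact_mod_cast eδ D hD
    have e2 : (P : ℝ) * |((D * a - q * n D : ℤ) : ℝ)| = |(q * v D - D * r : ℝ)| := by
      rw [← e, abs_mul, abs_of_pos hP0]
    rw [hΔ, le_div_iff₀ hP0, mul_comm, e2]
    calc |(q * v D - D * r : ℝ)| ≤ |(q * v D : ℝ)| + |(D * r : ℝ)| := abs_sub _ _
      _ = q * |(v D : ℝ)| + |(D : ℝ)| * |(r : ℝ)| := by
        rw [abs_mul, abs_mul, abs_of_pos (by linarith : (0:ℝ) < q)]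
      _ ≤ h * (P * Y / (2 * X)) + Y ^ 2 * h := by
        have := hv D hD; have := hT1 D hD
        gcongr
      _ = h * (P * Y / X) / 2 + Y ^ 2 * h := by field_simp
      _ ≤ h * (C1 * Y ^ 2) / 2 + 1 * (Y ^ 2 * h) := by rw [one_mul]; gcongr
      _ ≤ h * (C1 * Y ^ 2) / 2 + C1 * (Y ^ 2 * h) := by gcongr
      _ ≤ _ := by have : 0 ≤ C1 * (Y ^ 2 * h) := by positivity
                  nlinarith
  have i2 : ∀ D0 ∈ T, ((T.filter fun D => D * a - q * n D = D0 * a - q * n D0).card : ℝ) ≤ 2 * S + 1 := by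
    intro D0 h0
    have hd : ∀ D ∈ T.filter (fun D => D * a - q * n D = D0 * a - q * n D0), q ∣ D - D0 := by
      intro D hD
      obtain ⟨hD, e⟩ := Finset.mem_filter.1 hD
      exact A.cop.symm.dvd_of_dvd_mul_right ⟨n D - n D0, by linear_combination e⟩
    refine int_card _ (fun D => (D - D0) / q) S (by positivity) ?_ ?_
    · intro D hD
      obtain ⟨s, hs⟩ := hd D hD
      obtain ⟨hD, e⟩ := Finset.mem_filter.1 hD
      have hq0 : q ≠ 0 := by have := A.q1; omega
      simp only [hs, Int.mul_ediv_cancel_left _ hq0]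
      have b1 : q * |(s : ℝ)| ≤ 2 * Y ^ 2 := by
        have : (q : ℝ) * s = D - D0 := by exact_mod_cast hs.symm
        rw [← abs_of_pos (by linarith : (0:ℝ) < q), ← abs_mul, this]
        refine (abs_sub _ _).trans ?_
        linarith [hT1 D hD, hT1 D0 h0]
      have b2 : |(r : ℝ)| * |(s : ℝ)| ≤ C1 * Y ^ 2 := by
        have e3 : r * s = v D - v D0 := by
          apply mul_left_cancel₀ hq0
          have := eδ D hD; have h2 := eδ D0 h0
          rw [e] at this
          linear_combination (-r) * hs + this - h2
        have e4 : (r : ℝ) * s = v D - v D0 := by exact_mod_cast e3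
        rw [← abs_mul, e4]
        refine (abs_sub _ _).trans ?_
        have e5 : P * Y / (2 * X) + P * Y / (2 * X) = P * Y / X := by field_simp; ring
        linarith [hv D hD, hv D0 h0]
      rw [hS, le_div_iff₀ hh0, mul_comm]
      have hY2 : 0 < Y ^ 2 := by positivity
      rcases max_choice (q : ℝ) |(r : ℝ)| with e | e <;> rw [hh, e]
      · nlinarith
      · nlinarith
    · intro D hD D' hD' e
      have := Int.ediv_mul_cancel (hd D hD)
      have h2 := Int.ediv_mul_cancel (hd D' hD')
      rw [e] at this
      omega
  have h1 := card_fib T (fun D => D * a - q * n D) (2 * S + 1) (2 * Δ + 1) (by positivity) i2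
    (int_card _ id Δ (by positivity) (by
      intro x hx
      obtain ⟨D, hD, rfl⟩ := Finset.mem_image.1 hx
      exact i1 D hD) (fun a _ b _ e => e))
  refine h1.trans ?_
  have e : (2 * S + 1) * (2 * Δ + 1) = 16 * C1 ^ 2 * Y ^ 2 * (Y ^ 2 / P) + 4 * C1 * Y ^ 2 * (1 / h) +
      4 * C1 * Y ^ 2 * (h / P) + 1 := by rw [hS, hΔ]; field_simp; ring
  have g1 : Y ^ 2 / P ≤ 1 / H := by rw [div_le_div_iff₀ hP0 hH0]; linarith
  have g2 : 1 / h ≤ 1 / H := one_div_le_one_div_of_le hH0 hHh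
  have g3 : h / P ≤ 1 / H := by
    rw [div_le_div_iff₀ hP0 hH0]; nlinarith
  have g4 : 1 ≤ Y ^ 2 * (1 / H) := by rw [mul_one_div, le_div_iff₀ hH0]; linarith
  rw [e]
  calc _ ≤ 16 * C1 ^ 2 * Y ^ 2 * (1 / H) + 4 * C1 * Y ^ 2 * (1 / H) +
      4 * C1 * Y ^ 2 * (1 / H) + Y ^ 2 * (1 / H) := by gcongr
    _ = (16 * C1 ^ 2 + 8 * C1 + 1) * (Y ^ 2 * (1 / H)) := by ring
    _ ≤ (25 * C1 ^ 2) * (Y ^ 2 * (1 / H)) := by gcongr; nlinarith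
    _ = _ := by ring

lemma kcountL (P k : ℕ) (E : Finset ℕ) (hE : ∀ k ∈ E, k < P) (hP : 1 ≤ P) (X : ℤ) (hX : 1 ≤ X)
    (y1 y2 y1' y2' : ℤ) (hy1 : 0 ≤ y1') (hy12 : y1' ≤ y2') (hy2 : 1 ≤ y2') (hc : IsCoprime y1' y2')
    (hyX : y2' < X) [DecidablePred fun k' : ℕ => Close P X (k * y1 - k' * y1') ∧
      Close P X (k * y2 - k' * y2')] :
    ((E.filter fun k' : ℕ => Close P X (k * y1 - k' * y1') ∧
      Close P X (k * y2 - k' * y2')).card : ℝ) ≤ 2 * ((P : ℝ) / (2 * X * y2')) + 1 := by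
  have hXr : (1 : ℝ) ≤ X := by exact_mod_cast hX
  have hyr : (1 : ℝ) ≤ y2' := by exact_mod_cast hy2
  refine kcount P _ (fun k hk => hE k (Finset.mem_filter.1 hk).1) _ (by positivity) ?_
  intro k1 hk1 k2 hk2
  obtain ⟨-, ⟨v1, hv1, n1, e1⟩, ⟨v2, hv2, n2, e2⟩⟩ := Finset.mem_filter.1 hk1
  obtain ⟨-, ⟨w1, hw1, m1, f1⟩, ⟨w2, hw2, m2, f2⟩⟩ := Finset.mem_filter.1 hk2
  have g1 : ((k1 : ℤ) - k2) * y1' = P * (m1 - n1) + (w1 - v1) := by linear_combination f1 - e1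
  have g2 : ((k1 : ℤ) - k2) * y2' = P * (m2 - n2) + (w2 - v2) := by linear_combination f2 - e2
  have b1 : 2 * X * |w1 - v1| ≤ P := by have := abs_sub w1 v1; nlinarith
  have b2 : 2 * X * |w2 - v2| ≤ P := by have := abs_sub w2 v2; nlinarith
  set z1 := w1 - v1
  set z2 := w2 - v2
  have hz : (P : ℤ) * ((m1 - n1) * y2' - (m2 - n2) * y1') = z2 * y1' - z1 * y2' := by
    linear_combination y1' * g2 - y2' * g1
  have hlt : |z2 * y1' - z1 * y2'| < P := by
    have : X * |z2 * y1' - z1 * y2'| ≤ P * y2' := by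
      have h3 : |z2 * y1' - z1 * y2'| ≤ |z2| * y2' + |z1| * y2' := by
        refine (abs_sub _ _).trans ?_
        rw [abs_mul, abs_mul, abs_of_nonneg hy1, abs_of_nonneg (hy1.trans hy12)]
        gcongr
      nlinarith
    by_contra hcon
    push Not at hcon
    nlinarith
  have hz0 := Int.eq_zero_of_abs_lt_dvd (Dvd.intro _ hz) hlt
  rw [hz0] at hz
  have hw : (m1 - n1) * y2' = (m2 - n2) * y1' := by
    rcases mul_eq_zero.1 hz with h | h
    · exfalso; omega
    · linarith
  obtain ⟨s, hs⟩ : y2' ∣ m2 - n2 := hc.symm.dvd_of_dvd_mul_right ⟨m1 - n1, by linarith⟩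
  refine ⟨s, ?_⟩
  rw [le_div_iff₀ (by positivity)]
  have e : ((k1 : ℤ) - k2 - s * P) * y2' = z2 := by linear_combination g2 + P * hs
  have h3 : |(k1 : ℤ) - k2 - s * P| * y2' = |z2| := by
    rw [← e, abs_mul, abs_of_nonneg (by omega : 0 ≤ y2')]
  have h4 : |(k1 : ℤ) - k2 - s * P| * (2 * X * y2') ≤ P := by
    calc _ = 2 * X * (|(k1 : ℤ) - k2 - s * P| * y2') := by ring
      _ ≤ P := by rw [h3]; exact b2
  exact_mod_cast h4

open Classical in
lemma y_count (P k : ℕ) (q a r : ℤ) (A : Arc P k q a r) (hP : 1 ≤ P) (X Y C1 H : ℝ) (hX : 0 < X)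
    (hY : 0 < Y) (hC : 1 ≤ C1) (hXY : P ≤ C1 * X * Y) (hq2 : (q : ℝ) ^ 2 ≤ P) (hr2 : (r : ℝ) ^ 2 ≤ P)
    (hH : 1 ≤ H) (hqr : H ≤ q ∨ H ≤ |(r : ℝ)|) (hH2 : H ^ 2 ≤ P) (hYH : Y ^ 2 * H ≤ P) (hHY : H ≤ Y ^ 2)
    (y1' y2' : ℤ) (hy1 : 0 ≤ y1') (hy12 : y1' ≤ y2') (hy2 : 1 ≤ y2') (hc : IsCoprime y1' y2')
    (hyY : y2' ≤ Y) (hYy : Y ≤ C1 ^ 2 * y2')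
    (T : Finset (ℤ × ℤ)) (hT : ∀ y ∈ T, 0 ≤ y.1 ∧ y.1 ≤ y.2 ∧ y.2 ≤ Y ∧ ∃ n v : ℤ,
      k * (y.1 * y2' - y.2 * y1') = P * n + v ∧
      |(v : ℝ)| ≤ P * Y / (2 * X)) : (T.card : ℝ) ≤ 3 * C1 ^ 2 * (25 * C1 ^ 2 * Y ^ 2 / H) := by
  have hy2r : (1 : ℝ) ≤ y2' := by exact_mod_cast hy2
  refine card_fib T (fun y => y.1 * y2' - y.2 * y1') _ _ (by positivity) ?_
    (Dt_count P k q a r A hP X Y C1 H hX hY hC hXY hq2 hr2 hH hqr hH2 hYH hHY _ ?_)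
  · rintro ⟨u1, u2⟩ hu
    have hd : ∀ y ∈ T.filter (fun y => y.1 * y2' - y.2 * y1' = u1 * y2' - u2 * y1'), y2' ∣ y.2 - u2 := by
      intro y hy
      obtain ⟨hy, e⟩ := Finset.mem_filter.1 hy
      exact hc.symm.dvd_of_dvd_mul_right ⟨y.1 - u1, by linear_combination -e⟩
    refine (int_card _ (fun y => (y.2 - u2) / y2') (C1 ^ 2) (by positivity) ?_ ?_).trans (by nlinarith)
    · intro y hy
      obtain ⟨s, hs⟩ := hd y hy
      obtain ⟨hy, e⟩ := Finset.mem_filter.1 hy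
      simp only [hs, Int.mul_ediv_cancel_left _ (by omega : y2' ≠ 0)]
      have e1 : (y2' : ℝ) * s = y.2 - u2 := by exact_mod_cast hs.symm
      have e2 : (y2' : ℝ) * |(s : ℝ)| = |(y.2 - u2 : ℝ)| := by
        rw [← e1, abs_mul, abs_of_pos (by linarith : (0:ℝ) < y2')]
      obtain ⟨a1, a2, a3, -⟩ := hT y hy
      obtain ⟨c1, c2, c3, -⟩ := hT _ hu
      have a4 : (0 : ℝ) ≤ y.2 := by exact_mod_cast a1.trans a2
      have c4 : (0 : ℝ) ≤ u2 := by exact_mod_cast c1.trans c2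
      simp only at c3
      have : |(y.2 - u2 : ℝ)| ≤ Y := by rw [abs_le]; constructor <;> linarith
      rw [← e2] at this
      exact le_of_mul_le_mul_left (by linarith) (by linarith : (0:ℝ) < y2')
    · intro y hy w hw e
      have h1 := Int.ediv_mul_cancel (hd y hy)
      have h2 := Int.ediv_mul_cancel (hd w hw)
      rw [e] at h1
      have h3 : y.2 = w.2 := by omega
      have e1 := (Finset.mem_filter.1 hy).2
      have e2 := (Finset.mem_filter.1 hw).2
      rw [h3] at e1
      have h4 : y.1 = w.1 := mul_right_cancel₀ (by omega : y2' ≠ 0) (by linarith)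
      exact Prod.ext h4 h3
  · intro D hD
    obtain ⟨y, hy, rfl⟩ := Finset.mem_image.1 hD
    obtain ⟨a1, a2, a3, h⟩ := hT y hy
    refine ⟨?_, h⟩
    have a1r : (0 : ℝ) ≤ y.1 := by exact_mod_cast a1
    have a2r : (y.1 : ℝ) ≤ y.2 := by exact_mod_cast a2
    have hy1r : (0 : ℝ) ≤ y1' := by exact_mod_cast hy1
    have hy12r : (y1' : ℝ) ≤ y2' := by exact_mod_cast hy12
    push_cast
    rw [abs_le]
    have t1 : (y.1 : ℝ) * y2' ≤ Y * Y := by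
      apply mul_le_mul (by linarith) hyY (by linarith) hY.le
    have t2 : (y.2 : ℝ) * y1' ≤ Y * Y := by
      apply mul_le_mul (by linarith) (by linarith) (by linarith) hY.le
    have t3 : (0 : ℝ) ≤ y.1 * y2' := by apply mul_nonneg <;> linarith
    have t4 : (0 : ℝ) ≤ y.2 * y1' := by apply mul_nonneg <;> linarith
    constructor <;> nlinarith

open Classical in
lemma shellL {ι : Type*} (P : ℕ) (X : ℤ) (Y C1 H : ℝ) (U Λ : Finset (List ℤ)) (𝒢 : Finset ι)
    (g : ι → List ℤ) (E : Finset ℕ) (hX : 1 ≤ X) (hXP : X < P) (hC : 1 ≤ C1)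
    (hH : 1 ≤ H) (hH2 : H ^ 2 ≤ P) (hYH : Y ^ 2 * H ≤ P) (hHY : H ≤ Y ^ 2) (hY : Y < X)
    (hU : ∀ a ∈ U, Pos a ∧ Mt a 1 1 ≤ X) (hΛ : ∀ a ∈ Λ, Pos a) (hg : ∀ i ∈ 𝒢, Pos (g i))
    (hy : ∀ i ∈ 𝒢, ∀ b ∈ Λ, P ≤ C1 * X * Mt (g i ++ b.reverse) 1 1 ∧
      (Mt (g i ++ b.reverse) 1 1 : ℝ) ≤ Y) (hXY : X * Y ≤ C1 * P)
    (hE : ∀ k ∈ E, k < P ∧ ∃ q a r : ℤ, Arc P k q a r ∧ (q : ℝ) ^ 2 ≤ P ∧ (r : ℝ) ^ 2 ≤ P ∧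
      (H ≤ q ∨ H ≤ |(r : ℝ)|)) :
    ∑ k ∈ E, ‖∑ a ∈ U, ∑ b ∈ 𝒢 ×ˢ Λ, ec P (k * Mt (a ++ (g b.1 ++ b.2.reverse)) 1 1)‖ ^ 2 ≤
      1000000 * C1 ^ 5 * U.card * 𝒢.card * (𝒢.card * Λ.card) * (X ^ 2 * Y ^ 2) / H := by
  have hXr : (1 : ℝ) ≤ X := by exact_mod_cast hX
  have hP1 : 1 ≤ P := by omega
  have hPr : (1 : ℝ) ≤ P := by exact_mod_cast hP1
  have hpos : ∀ i ∈ 𝒢, ∀ b ∈ Λ, Pos (g i ++ b.reverse) := fun i hi b hb =>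
    (hg i hi).append (hΛ b hb).rev
  have main := LS P X hX hXP U (fun a => Mt a 1 0) (fun a => Mt a 1 1)
    (by
      intro a ha
      obtain ⟨-, b1, -, -, b3, -⟩ := Mt_basic (hU a ha).1
      have := (hU a ha).2
      exact ⟨b1, by omega⟩)
    (by
      intro a ha
      obtain ⟨-, b1, -, b2, b3, -⟩ := Mt_basic (hU a ha).1
      have := (hU a ha).2
      exact ⟨by omega, by omega⟩)
    (by
      intro u v
      refine (par_card _ (fun _ => ()) ?_).trans ?_
      · intro l hl t ht _ hpar
        obtain ⟨hl, l1, l2⟩ := Finset.mem_filter.1 hl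
        obtain ⟨ht, t1, t2⟩ := Finset.mem_filter.1 ht
        exact row_inj (hU l hl).1 (hU t ht).1 (l1.trans t1.symm) (l2.trans t2.symm) hpar
      · have := Finset.card_le_univ ((U.filter fun a => Mt a 1 0 = u ∧ Mt a 1 1 = v).image (fun _ => ()))
        simp at this ⊢
        omega)
    (𝒢 ×ˢ Λ) (fun b => Mt (g b.1 ++ b.2.reverse) 0 1) (fun b => Mt (g b.1 ++ b.2.reverse) 1 1) E
    ((𝒢.card * (2 * C1 * (2 * (3 * C1 ^ 2 * (25 * C1 ^ 2 * Y ^ 2 / H))))) * (𝒢 ×ˢ Λ).card)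
    (by positivity) (by
      intro k hk
      obtain ⟨hkP, q, a, r, A, hq2, hr2, hqr⟩ := hE k hk
      rw [Finset.sum_comm]
      refine (Finset.sum_le_sum (g := fun _ => (𝒢.card * (2 * C1 * (2 * (3 * C1 ^ 2 *
        (25 * C1 ^ 2 * Y ^ 2 / H))))) ) ?_).trans (by rw [Finset.sum_const, nsmul_eq_mul, mul_comm])
      rintro ⟨i', b'⟩ hb'
      obtain ⟨hi', hb'⟩ := Finset.mem_product.1 hb'
      simp only at hi' hb' ⊢
      obtain ⟨-, -, k2, k3, -, k5, -⟩ := Mt_basic (hpos i' hi' b' hb')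
      obtain ⟨l1, l2⟩ := hy i' hi' b' hb'
      set y1' := Mt (g i' ++ b'.reverse) 0 1 with hy1'
      set y2' := Mt (g i' ++ b'.reverse) 1 1 with hy2'
      have k3r : (1 : ℝ) ≤ y2' := by exact_mod_cast k3
      have hY0 : 0 < Y := by linarith
      have hyX : y2' < X := by have : (y2' : ℝ) < X := by linarith
                               exact_mod_cast this
      rw [Finset.sum_product, ← nsmul_eq_mul, ← Finset.sum_const]
      refine Finset.sum_le_sum fun i hi => ?_
      set T := Λ.filter fun b => ∃ k' ∈ E, Close P X (k * Mt (g i ++ b.reverse) 0 1 - k' * y1') ∧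
        Close P X (k * Mt (g i ++ b.reverse) 1 1 - k' * y2') with hT
      have t1 : ∀ b ∈ Λ, ((E.filter fun k' : ℕ =>
          Close P X (k * Mt (g i ++ b.reverse) 0 1 - k' * y1') ∧
          Close P X (k * Mt (g i ++ b.reverse) 1 1 - k' * y2')).card : ℝ) ≤
          2 * C1 * (if ∃ k' ∈ E, Close P X (k * Mt (g i ++ b.reverse) 0 1 - k' * y1') ∧
        Close P X (k * Mt (g i ++ b.reverse) 1 1 - k' * y2') then 1 else 0) := by
        intro b hb
        split_ifs with h
        · refine (kcountL P k E (fun k hk => (hE k hk).1) hP1 X hX _ _ y1' y2' k2 k5 k3 (col_cop _) hyX).trans ?_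
          have : (P : ℝ) / (2 * X * y2') ≤ C1 / 2 := by
            rw [div_le_div_iff₀ (by positivity) (by norm_num)]; linarith
          linarith
        · rw [mul_zero]
          push Not at h
          have : (E.filter fun k' : ℕ => Close P X (k * Mt (g i ++ b.reverse) 0 1 - k' * y1') ∧
            Close P X (k * Mt (g i ++ b.reverse) 1 1 - k' * y2')) = ∅ := by
            rw [Finset.filter_eq_empty_iff]
            intro k' hk' hcc
            exact h k' hk' hcc.1 hcc.2
          rw [this]; simp
      refine (Finset.sum_le_sum t1).trans ?_
      rw [← Finset.mul_sum, Finset.sum_boole]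
      refine mul_le_mul_of_nonneg_left ?_ (by positivity)
      have t2 := par_card T (fun b => (Mt (g i ++ b.reverse) 0 1, Mt (g i ++ b.reverse) 1 1)) (by
        intro l hl t ht e hpar
        simp only [Prod.mk.injEq] at e
        have := col_inj (hpos i hi l (Finset.mem_filter.1 hl).1) (hpos i hi t (Finset.mem_filter.1 ht).1)
          e.1 e.2 (by simp only [List.length_append, List.length_reverse]; omega)
        simpa using this)
      have t3 : (T.card : ℝ) ≤ 2 * (T.image fun b =>
        (Mt (g i ++ b.reverse) 0 1, Mt (g i ++ b.reverse) 1 1)).card := by exact_mod_cast t2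
      refine t3.trans (mul_le_mul_of_nonneg_left ?_ (by norm_num))
      refine y_count P k q a r A hP1 X Y C1 H (by linarith) hY0 hC (l1.trans (by gcongr)) hq2 hr2 hH hqr
        hH2 hYH hHY y1' y2' k2 k5 k3 (col_cop _) l2 ?_ _ ?_
      · have : X * Y ≤ X * (C1 ^ 2 * y2') := by nlinarith
        exact le_of_mul_le_mul_left this (by linarith)
      · intro y hyy
        obtain ⟨b, hb, rfl⟩ := Finset.mem_image.1 hyy
        obtain ⟨hb, k', hk', ⟨v1, hv1, n1, e1⟩, ⟨v2, hv2, n2, e2⟩⟩ := Finset.mem_filter.1 hb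
        obtain ⟨-, -, m2, m3, -, m5, -⟩ := Mt_basic (hpos i hi b hb)
        refine ⟨m2, m5, (hy i hi b hb).2, n1 * y2' - n2 * y1', v1 * y2' - v2 * y1', ?_, ?_⟩
        · linear_combination y2' * e1 - y1' * e2
        · have h3 : |v1 * y2' - v2 * y1'| ≤ |v1| * y2' + |v2| * y2' := by
            refine (abs_sub _ _).trans ?_
            rw [abs_mul, abs_mul, abs_of_nonneg k2, abs_of_nonneg (k2.trans k5)]
            gcongr
          have h4 : 2 * X * |v1 * y2' - v2 * y1'| ≤ P * y2' := by nlinarith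
          have h5 : 2 * X * |(v1 * y2' - v2 * y1' : ℝ)| ≤ P * y2' := by exact_mod_cast h4
          push_cast
          rw [le_div_iff₀ (by positivity)]
          nlinarith)
  simp only [Mt_app _ (g _ ++ _)]
  refine main.trans ?_
  rw [Finset.card_product]
  have : 0 ≤ C1 ^ 5 * U.card * 𝒢.card * (𝒢.card * Λ.card) * (X ^ 2 * Y ^ 2) / H := by positivity
  push_cast
  calc _ = 614400 * (C1 ^ 5 * U.card * 𝒢.card * (𝒢.card * Λ.card) * (X ^ 2 * Y ^ 2) / H) := by ring
    _ ≤ 1000000 * (C1 ^ 5 * U.card * 𝒢.card * (𝒢.card * Λ.card) * (X ^ 2 * Y ^ 2) / H) := by gcongr; norm_num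
    _ = _ := by ring

open Classical in
lemma orth {ι : Type*} (P : ℕ) (X : Finset ι) (f : ι → ℤ) (B : Finset ℤ) (hP : 1 ≤ P)
    (hB : ∀ n ∈ B, 0 ≤ n ∧ n < P) (hf : ∀ x ∈ X, 0 ≤ f x ∧ f x < P) :
    ∑ k ∈ Finset.range P, (∑ x ∈ X, ec P (k * f x)) * (∑ n ∈ B, ec P (k * -n)) =
      ((P * ∑ n ∈ B, ((X.filter fun x => f x = n).card : ℝ) : ℝ) : ℂ) := by
  simp_rw [Finset.sum_mul_sum, ← ec_add, ← mul_add]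
  rw [Finset.sum_comm]
  simp_rw [Finset.sum_comm (s := Finset.range P), ec_sum P hP]
  rw [Finset.sum_comm]
  push_cast
  rw [Finset.mul_sum]
  refine Finset.sum_congr rfl fun n hn => ?_
  rw [Finset.card_filter, Nat.cast_sum, Finset.mul_sum]
  refine Finset.sum_congr rfl fun x hx => ?_
  have h1 := hf x hx
  have h2 := hB n hn
  have : ((P : ℤ) ∣ f x + -n) ↔ f x = n := by
    refine ⟨fun h => ?_, fun h => by simp [h]⟩
    have := Int.eq_zero_of_abs_lt_dvd h (by rw [abs_lt]; constructor <;> linarith)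
    linarith
  simp only [this]
  split_ifs <;> simp

open Classical in
lemma small_count (P H0 : ℕ) (T : Finset ℕ) (h1 : 1 ≤ H0) (hH : H0 ≤ P)
    (hT : ∀ k ∈ T, k < P ∧ ∃ q a r : ℤ, Arc P k q a r ∧ q ≤ H0 ∧ |r| ≤ H0) :
    (T.card : ℝ) ≤ 9 * H0 ^ 3 := by
  choose! hk q a r hA hq hr using hT
  have hP : (1 : ℤ) ≤ P := by omega
  have hle : T.card ≤ (Finset.Icc (1 : ℤ) H0 ×ˢ Finset.Icc (-1 : ℤ) H0 ×ˢ
      Finset.Icc (-H0 : ℤ) H0).card := by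
    refine Finset.card_le_card_of_injOn (fun k => (q k, a k, r k)) ?_ ?_
    · intro k hkT
      have e := (hA k hkT).eq
      have q1 := (hA k hkT).q1
      have := hq k hkT
      have hr' := abs_le.1 (hr k hkT)
      have hkP : (k : ℤ) + 1 ≤ P := by have := hk k hkT; omega
      simp only [Finset.coe_product, Set.mem_prod, Finset.coe_Icc, Set.mem_Icc]
      refine ⟨⟨q1, this⟩, ⟨?_, ?_⟩, hr'⟩
      · by_contra hc
        have : (a k) * P ≤ -2 * P := mul_le_mul_of_nonneg_right (by omega) (by omega)
        have : 0 ≤ (k : ℤ) * q k := by positivity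
        zify at hH; linarith
      · by_contra hc
        have h3 : ((H0 : ℤ) + 1) * P ≤ a k * P := mul_le_mul_of_nonneg_right (by omega) (by omega)
        have h4 : (k : ℤ) * q k ≤ (P - 1) * H0 :=
          mul_le_mul (by omega) this (by omega) (by omega)
        nlinarith
    · intro k hkT k' hkT' he
      simp only [Prod.mk.injEq] at he
      obtain ⟨e1, e2, e3⟩ := he
      have e := (hA k hkT).eq
      have e' := (hA k' hkT').eq
      have q1 := (hA k hkT).q1
      rw [← e1, ← e2, ← e3] at e'
      have : ((k : ℤ) - k') * q k = 0 := by linarith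
      rcases mul_eq_zero.1 this with h | h <;> omega
  rw [Finset.card_product, Finset.card_product, Int.card_Icc, Int.card_Icc, Int.card_Icc] at hle
  have e1 : ((H0 : ℤ) + 1 - 1).toNat = H0 := by omega
  have e2 : ((H0 : ℤ) + 1 - -1).toNat = H0 + 2 := by omega
  have e3 : ((H0 : ℤ) + 1 - -H0).toNat = 2 * H0 + 1 := by omega
  rw [e1, e2, e3] at hle
  have h5 : (H0 + 2) * (2 * H0 + 1) ≤ (3 * H0) * (3 * H0) := Nat.mul_le_mul (by omega) (by omega)
  have : T.card ≤ 9 * H0 ^ 3 := hle.trans ((Nat.mul_le_mul_left _ h5).trans (by nlinarith))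
  exact_mod_cast this

open Classical in
lemma combine {Ω : Type*} (Om : Finset Ω) (d : Ω → ℤ) (P W Jk H0 : ℕ) (B : Finset ℤ)
    (E : Finset ℕ) (c1 θ : ℝ) (h1 : 1 ≤ H0) (hH : H0 ≤ P) (hJ : 1 ≤ Jk)
    (hB : ∀ n ∈ B, 0 ≤ n ∧ n < P) (hd : ∀ ω ∈ Om, 0 ≤ d ω ∧ ∀ j < Jk, d ω + j * W < P)
    (hne : ∀ ω ∈ Om, d ω ∉ B)
    (hc : ∀ n ∈ B, c1 ≤ ((Om ×ˢ Finset.range Jk).filter fun x => d x.1 + x.2 * W = n).card)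
    (hE : E ⊆ Finset.range P)
    (hEc : ∀ k < P, k ∉ E → ∃ q a r : ℤ, Arc P k q a r ∧ q ≤ H0 ∧ |r| ≤ H0)
    (hW : ∀ q : ℤ, 1 ≤ q → q ≤ H0 → q ∣ W) (hθ0 : 0 ≤ θ)
    (hθ : ∀ j < Jk, 2 * Real.pi * (H0 * j * W) ≤ θ * P) :
    P * (c1 * B.card) ≤ 9 * H0 ^ 3 * θ * Jk * (Om.card * B.card) +
      2 * Jk * (√(∑ k ∈ E, ‖∑ ω ∈ Om, ec P (k * d ω)‖ ^ 2) * √(P * B.card)) := by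
  have hP : 1 ≤ P := h1.trans hH
  have hP0 : (0 : ℝ) < P := by exact_mod_cast hP
  set S : ℕ → ℂ := fun k => ∑ ω ∈ Om, ec P (k * d ω) with hS
  set V : ℕ → ℂ := fun k => ∑ n ∈ B, ec P (k * -n) with hV
  set T : ℕ → ℂ := fun k => ∑ j ∈ Finset.range Jk, ec P (k * (j * W)) with hT
  have hd0 : ∀ ω ∈ Om, 0 ≤ d ω ∧ d ω < P := fun ω hω => ⟨(hd ω hω).1, by
    simpa using (hd ω hω).2 0 hJ⟩
  have oSV : ∑ k ∈ Finset.range P, S k * V k = 0 := by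
    rw [orth P Om d B hP hB hd0]
    norm_cast
    simp only [Nat.mul_eq_zero, Finset.sum_eq_zero_iff, Finset.card_eq_zero]
    refine Or.inr fun n hn => Finset.filter_eq_empty_iff.2 fun ω hω h => hne ω hω (h ▸ hn)
  have oSTV : ∑ k ∈ Finset.range P, S k * V k * T k = ((P * ∑ n ∈ B,
      (((Om ×ˢ Finset.range Jk).filter fun x => d x.1 + x.2 * W = n).card : ℝ) : ℝ) : ℂ) := by
    rw [← orth P (Om ×ˢ Finset.range Jk) (fun x => d x.1 + x.2 * W) B hP hB]
    · refine Finset.sum_congr rfl fun k _ => ?_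
      have : ∑ x ∈ Om ×ˢ Finset.range Jk, ec P (k * (d x.1 + x.2 * W)) = S k * T k := by
        simp only [hS, hT]
        rw [Finset.sum_mul_sum, Finset.sum_product]
        simp_rw [mul_add, ec_add]
      rw [this]; ring
    · intro x hx
      rw [Finset.mem_product, Finset.mem_range] at hx
      exact ⟨add_nonneg (hd x.1 hx.1).1 (by positivity), (hd x.1 hx.1).2 _ hx.2⟩
  have oV : ∑ k ∈ Finset.range P, ‖V k‖ ^ 2 = P * B.card := by
    have := orth P B (fun n => n) B hP hB hB
    have e : ∀ n ∈ B, ((B.filter fun x => x = n).card : ℝ) = 1 := by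
      intro n hn
      rw [Finset.filter_eq']; simp [hn]
    rw [Finset.sum_congr rfl e] at this
    have h3 : ∀ k ∈ Finset.range P, (∑ x ∈ B, ec P (k * x)) * (∑ n ∈ B, ec P (k * -n)) =
        ((‖V k‖ ^ 2 : ℝ) : ℂ) := by
      intro k _
      have : ∑ x ∈ B, ec P (k * x) = (starRingEnd ℂ) (V k) := by
        rw [hV, map_sum]
        refine Finset.sum_congr rfl fun n _ => ?_
        rw [ec_conj]; congr 1; ring
      rw [this, mul_comm, Complex.mul_conj, Complex.normSq_eq_norm_sq]
    rw [Finset.sum_congr rfl h3, ← Complex.ofReal_sum] at this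
    have := Complex.ofReal_injective this
    simpa using this
  have hbS : ∀ k, ‖S k‖ ≤ Om.card := fun k => (norm_sum_le _ _).trans (by simp [ec_norm])
  have hbV : ∀ k, ‖V k‖ ≤ B.card := fun k => (norm_sum_le _ _).trans (by simp [ec_norm])
  have hbT : ∀ k, ‖T k - Jk‖ ≤ 2 * Jk := fun k => by
    have : ‖T k‖ ≤ Jk := (norm_sum_le _ _).trans (by simp [ec_norm])
    refine (norm_sub_le _ _).trans ?_
    rw [Complex.norm_natCast]; linarith
  have hsT : ∀ k ∈ Finset.range P \ E, ‖T k - Jk‖ ≤ Jk * θ := by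
    intro k hk
    rw [Finset.mem_sdiff, Finset.mem_range] at hk
    obtain ⟨q, a, r, hA, hq, hr⟩ := hEc k hk.1 hk.2
    obtain ⟨w, hw⟩ := hW q hA.q1 hq
    have : T k - Jk = ∑ j ∈ Finset.range Jk, (ec P (k * (j * W)) - 1) := by
      simp [hT]
    rw [this]
    refine (norm_sum_le _ _).trans ((Finset.sum_le_card_nsmul _ _ θ ?_).trans (by simp))
    intro j hj
    have e1 : (k : ℤ) * (j * W) = j * w * r + P * (a * w * j) := by
      rw [hw, hA.eq]; ring
    rw [e1, ec_add, (ec_one_iff P hP _).2 (Dvd.intro _ rfl), mul_one]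
    unfold ec
    rw [mul_comm _ Complex.I]
    refine Real.norm_exp_I_mul_ofReal_sub_one_le.trans ?_
    have hw0 : 0 ≤ w := by
      by_contra hc
      have := hA.q1
      have : (0 : ℤ) ≤ W := by positivity
      nlinarith
    have hwW : w ≤ W := by have := hA.q1; nlinarith
    rw [Real.norm_eq_abs, abs_div, abs_mul, abs_of_pos (by positivity : 0 < 2 * Real.pi),
      abs_of_pos hP0, div_le_iff₀ hP0]
    refine le_trans ?_ (hθ j (Finset.mem_range.1 hj))
    gcongr
    have : |(j * w * r : ℤ)| ≤ H0 * j * W := by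
      rw [abs_mul, abs_of_nonneg (by positivity : 0 ≤ j * w)]
      calc j * w * |r| ≤ j * W * H0 := by gcongr
        _ = _ := by ring
    exact_mod_cast this
  have key : (P * ∑ n ∈ B, (((Om ×ˢ Finset.range Jk).filter fun x => d x.1 + x.2 * W = n).card :
      ℝ) : ℝ) ≤ ∑ k ∈ Finset.range P, ‖S k‖ * ‖V k‖ * ‖T k - Jk‖ := by
    have : ∑ k ∈ Finset.range P, S k * V k * (T k - Jk) = ((P * ∑ n ∈ B,
      (((Om ×ˢ Finset.range Jk).filter fun x => d x.1 + x.2 * W = n).card : ℝ) : ℝ) : ℂ) := by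
      simp_rw [mul_sub]
      rw [Finset.sum_sub_distrib, oSTV, ← Finset.sum_mul, oSV]; simp
    have h2 := norm_sum_le (Finset.range P) fun k => S k * V k * (T k - Jk)
    rw [this, Complex.norm_real, Real.norm_eq_abs] at h2
    simp_rw [norm_mul] at h2
    exact (le_abs_self _).trans h2
  have h2 : c1 * B.card ≤ ∑ n ∈ B,
      (((Om ×ˢ Finset.range Jk).filter fun x => d x.1 + x.2 * W = n).card : ℝ) := by
    rw [mul_comm, ← nsmul_eq_mul]
    exact Finset.card_nsmul_le_sum _ _ _ hc
  refine (mul_le_mul_of_nonneg_left h2 hP0.le).trans (key.trans ?_)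
  rw [← Finset.sum_sdiff hE]
  refine add_le_add ?_ ?_
  · have hcd := small_count P H0 (Finset.range P \ E) h1 hH (fun k hk => by
      rw [Finset.mem_sdiff, Finset.mem_range] at hk
      exact ⟨hk.1, hEc k hk.1 hk.2⟩)
    calc ∑ k ∈ Finset.range P \ E, ‖S k‖ * ‖V k‖ * ‖T k - Jk‖
        ≤ ∑ k ∈ Finset.range P \ E, (Om.card : ℝ) * B.card * (Jk * θ) := by
          refine Finset.sum_le_sum fun k hk => ?_
          have := hbS k
          have := hbV k
          have := hsT k hk
          gcongr
      _ = (Finset.range P \ E).card * ((Om.card : ℝ) * B.card * (Jk * θ)) := by simp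
      _ ≤ 9 * H0 ^ 3 * ((Om.card : ℝ) * B.card * (Jk * θ)) := by gcongr
      _ = _ := by ring
  · calc ∑ k ∈ E, ‖S k‖ * ‖V k‖ * ‖T k - Jk‖ ≤ ∑ k ∈ E, 2 * Jk * (‖S k‖ * ‖V k‖) := by
          refine Finset.sum_le_sum fun k _ => ?_
          have := mul_le_mul_of_nonneg_left (hbT k) (by positivity : 0 ≤ ‖S k‖ * ‖V k‖)
          linarith
      _ ≤ 2 * Jk * (√(∑ k ∈ E, ‖S k‖ ^ 2) * √(∑ k ∈ E, ‖V k‖ ^ 2)) := by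
          rw [← Finset.mul_sum]
          gcongr
          exact Real.sum_mul_le_sqrt_mul_sqrt _ _ _
      _ ≤ _ := by
          gcongr
          rw [← oV]
          exact Finset.sum_le_sum_of_subset_of_nonneg hE fun _ _ _ => by positivity

lemma CD.mono {A : Finset ℤ} (c : CD A) : Monotone c.P := monotone_nat_of_le_succ fun j => by
  have := c.hP1 j
  have := c.one_le j
  nlinarith

lemma Chn.bd {A : Finset ℤ} (hpos : ∀ a ∈ A, 1 ≤ a) {K j : ℕ} {Λ : Finset (List ℤ)} {P ρ : ℝ}
    (h : Chn A K j Λ P ρ) (hP0 : 0 ≤ P) : ∀ l ∈ Λ, Pos l ∧ P ≤ Mt l 1 1 ∧ Mt l 1 1 ≤ 2 * P := by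
  intro l hl
  refine ⟨fun a ha => hpos a (h.let_mem l hl a ha), h.hlow l hl, (h.hup l hl).trans ?_⟩
  have : 0 ≤ (1 / 2 : ℝ) ^ j := by positivity
  nlinarith

noncomputable def SS {ι : Type*} (P : ℕ) (U Λ : Finset (List ℤ)) (𝒢 : Finset ι) (g : ι → List ℤ)
    (k : ℕ) : ℂ := ∑ a ∈ U, ∑ b ∈ 𝒢 ×ˢ Λ, ec P (k * Mt (a ++ (g b.1 ++ b.2.reverse)) 1 1)

lemma S_one {ι : Type*} {A : Finset ℤ} (hpos : ∀ a ∈ A, 1 ≤ a) (c : CD A) (J : ℕ)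
    (X : Finset (List ℤ)) (hX : ∀ b ∈ X, ∀ a ∈ b, a ∈ A) (𝒢 : Finset ι) (g : ι → List ℤ)
    (hg : ∀ i ∈ 𝒢, Pos (g i)) (P : ℕ) (c0 : ℝ) (hc0 : 0 < c0) (hc1 : c0 ≤ 1)
    (hPJ : 2 * c.P J < P)
    (hD : ∀ u ∈ cat (c.Λ J) X, ∀ i ∈ 𝒢, ∀ b ∈ c.Λ J, c0 * P ≤ Mt (u ++ (g i ++ b.reverse)) 1 1 ∧
      Mt (u ++ (g i ++ b.reverse)) 1 1 ≤ (P : ℝ)) (H : ℝ) (hH : 1 ≤ H)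
    (hHJ : 9 * H ^ 2 < c.P (J - 1)) (hJ : 1 ≤ J) (E : Finset ℕ)
    (hE : ∀ k ∈ E, k < P ∧ ∃ q a r : ℤ, Arc P k q a r ∧ q ≤ 2 * H ∧ |r| ≤ 2 * H ∧
      (H ≤ q ∨ H ≤ |r|)) :
    ∑ k ∈ E, ‖SS P (cat (c.Λ J) X) (c.Λ J) 𝒢 g k‖ ^ 2 ≤ 162000000 * c.C ^ 3 / c0 ^ 2 *
      ((cat (c.Λ J) X).card * (𝒢.card * (c.Λ J).card)) ^ 2 * H ^ (-(9 / 50) : ℝ) := by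
  obtain ⟨j', hj1, hj2⟩ := c.exists_max (x := 9 * H ^ 2) (by nlinarith)
  have hlt : j' < J - 1 := by
    by_contra hc
    have := c.mono (not_lt.1 hc)
    linarith
  set j := j' + 1 with hj
  obtain ⟨S1, hS1, e1⟩ := c.fac (j + 1) (J - (j + 1))
  obtain ⟨S2, hS2, e2⟩ := c.fac j (J - j)
  rw [show j + 1 + (J - (j + 1)) = J by omega] at e1
  rw [show j + (J - j) = J by omega] at e2
  have pj := (c.chn j).pf
  have pj1 := (c.chn (j + 1)).pf
  have eU : cat (c.Λ J) X = cat (c.Λ (j + 1)) (cat S1 X) := by rw [e1, cat_assoc]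
  have hPos : ∀ {S : Finset (List ℤ)}, (∀ b ∈ S, ∀ a ∈ b, a ∈ A) → ∀ b ∈ S, Pos b :=
    fun h b hb a ha => hpos a (h b hb a ha)
  have hCr : (1 : ℝ) ≤ c.C := by exact_mod_cast c.hC
  have hp1 := c.one_le j
  have main := shellS P (c.P j) H c0 c.C (c.Λ j) (c.Ξ j) (cat S1 X ×ˢ 𝒢 ×ˢ S2)
    (fun t => t.1 ++ (g t.2.1 ++ t.2.2.reverse)) E hH hj2 hc0 hc1 hCr
    (by have := c.mono (show j ≤ J by omega); linarith)
    ((c.chn j).bd hpos (by linarith))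
    (fun l hl => ⟨hPos (c.hΞm j) l hl, c.hΞ1 j l hl, c.hΞ2 j l hl⟩)
    (by
      rintro ⟨t, i, b⟩ ht
      simp only [Finset.mem_product] at ht
      refine Pos.append ?_ ((hg i ht.2.1).append (hPos hS2 b ht.2.2).rev)
      obtain ⟨s, hs, x, hx, rfl⟩ := mem_cat.1 ht.1
      exact (hPos hS1 s hs).append (hPos hX x hx))
    (c.chn j).hcard (c.hΞc j)
    (by
      rintro a ha ξ hξ ⟨t, i, b⟩ ht b1 hb1
      simp only [Finset.mem_product] at ht
      have := hD (a ++ ξ ++ t) (by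
        rw [eU, c.hΛ]
        exact mem_cat.2 ⟨_, mem_cat.2 ⟨a, ha, ξ, hξ, rfl⟩, t, ht.1, rfl⟩) i ht.2.1 (b1 ++ b)
        (by rw [e2]; exact mem_cat.2 ⟨b1, hb1, b, ht.2.2, rfl⟩)
      simpa only [List.append_assoc, List.reverse_append] using this) hE
  have hSS : ∀ k, SS P (cat (c.Λ J) X) (c.Λ J) 𝒢 g k = ∑ a ∈ c.Λ j,
      ∑ b ∈ c.Ξ j ×ˢ (cat S1 X ×ˢ 𝒢 ×ˢ S2) ×ˢ c.Λ j, ec P (k * Mt (a ++ (b.1 ++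
        ((b.2.1.1 ++ (g b.2.1.2.1 ++ b.2.1.2.2.reverse)) ++ b.2.2.reverse))) 1 1) := by
    intro k
    unfold SS
    rw [eU, pj1.sum_cat, c.hΛ, pj.sum_cat]
    refine Finset.sum_congr rfl fun a _ => ?_
    rw [Finset.sum_product]
    refine Finset.sum_congr rfl fun ξ _ => ?_
    rw [Finset.sum_product, Finset.sum_product]
    refine Finset.sum_congr rfl fun t _ => ?_
    rw [Finset.sum_product, Finset.sum_product]
    refine Finset.sum_congr rfl fun i _ => ?_
    rw [e2, pj.sum_cat, Finset.sum_comm]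
    simp only [List.append_assoc, List.reverse_append]
  have hcards : ((c.Λ j).card * ((c.Ξ j).card * ((cat S1 X ×ˢ 𝒢 ×ˢ S2).card * (c.Λ j).card)) : ℝ) =
      (cat (c.Λ J) X).card * (𝒢.card * (c.Λ J).card) := by
    rw [eU, pj1.card_cat, c.hΛ j, pj.card_cat, e2, pj.card_cat, Finset.card_product,
      Finset.card_product]
    push_cast; ring
  simp_rw [hSS]
  refine main.trans ?_
  rw [hcards, mul_div_assoc]
  have hH0 : 0 < H := by linarith
  have hpb : c.P j ≤ 81 * c.C * H ^ 4 := by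
    have := c.one_le j'
    calc c.P j ≤ c.C * c.P j' ^ 2 := c.hP2 j'
      _ ≤ c.C * (9 * H ^ 2) ^ 2 := by gcongr
      _ = _ := by ring
  have h4 : c.P j ^ (2 / 25 : ℝ) / √H ≤ 81 * c.C * H ^ (-(9 / 50) : ℝ) := by
    have h81 : (1 : ℝ) ≤ 81 * c.C := by linarith
    have e3 : (H ^ 4) ^ (2 / 25 : ℝ) = H ^ (8 / 25 : ℝ) := by
      rw [← Real.rpow_natCast, ← Real.rpow_mul hH0.le]; norm_num
    have e4 : H ^ (-(9 / 50) : ℝ) = H ^ (8 / 25 : ℝ) / √H := by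
      rw [Real.sqrt_eq_rpow, ← Real.rpow_sub hH0]; norm_num
    rw [e4, ← mul_div_assoc]
    gcongr
    calc c.P j ^ (2 / 25 : ℝ) ≤ (81 * c.C * H ^ 4) ^ (2 / 25 : ℝ) := by gcongr
      _ = (81 * c.C) ^ (2 / 25 : ℝ) * H ^ (8 / 25 : ℝ) := by
        rw [Real.mul_rpow (by positivity) (by positivity), e3]
      _ ≤ _ := by
        gcongr
        calc (81 * c.C : ℝ) ^ (2 / 25 : ℝ) ≤ (81 * c.C : ℝ) ^ (1 : ℝ) :=
              Real.rpow_le_rpow_of_exponent_le h81 (by norm_num)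
          _ = _ := Real.rpow_one _
  calc _ ≤ _ := mul_le_mul_of_nonneg_left h4 (by positivity)
    _ = _ := by ring

open Classical in
lemma S_all (F : ℕ → ℝ) (hF : ∀ k, 0 ≤ F k) (P : ℕ) (B H0 H1 : ℝ) (hB : 0 ≤ B) (hH0 : 1 ≤ H0)
    (h1 : ∀ H, H0 ≤ H → H ≤ H1 → ∀ E : Finset ℕ,
      (∀ k ∈ E, k < P ∧ ∃ q a r : ℤ, Arc P k q a r ∧ q ≤ 2 * H ∧ |r| ≤ 2 * H ∧
      (H ≤ q ∨ H ≤ |r|)) → ∑ k ∈ E, F k ≤ B * H ^ (-(9 / 50) : ℝ)) (E : Finset ℕ)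
    (hE : ∀ k ∈ E, k < P ∧ ∃ q a r : ℤ, Arc P k q a r ∧ (H0 ≤ q ∨ H0 ≤ |r|) ∧ q ≤ H1 ∧ |r| ≤ H1) :
    ∑ k ∈ E, F k ≤ 9 * B * H0 ^ (-(9 / 50) : ℝ) := by
  have hH00 : 0 < H0 := by linarith
  set y : ℝ := (2 : ℝ) ^ (-(9 / 50) : ℝ) with hy
  have hy0 : 0 < y := by positivity
  have hy1 : y ≤ 8 / 9 := by
    have : y ^ (50 : ℕ) ≤ (8 / 9 : ℝ) ^ (50 : ℕ) := by
      rw [hy, ← Real.rpow_natCast, ← Real.rpow_mul (by norm_num)]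
      rw [show (-(9 / 50) * (50 : ℕ) : ℝ) = -((9 : ℕ) : ℝ) by norm_num, Real.rpow_neg (by norm_num),
        Real.rpow_natCast]
      norm_num
    exact le_of_pow_le_pow_left₀ (by norm_num) (by norm_num) this
  obtain ⟨S, hS⟩ := pow_unbounded_of_one_lt (H1 / H0) (one_lt_two)
  set Es : ℕ → Finset ℕ := fun s => E.filter fun k => H0 * 2 ^ s ≤ H1 ∧
    ∃ q a r : ℤ, Arc P k q a r ∧ q ≤ 2 * (H0 * 2 ^ s) ∧ |r| ≤ 2 * (H0 * 2 ^ s) ∧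
      (H0 * 2 ^ s ≤ q ∨ H0 * 2 ^ s ≤ |r|) with hEs
  have hcov : E ⊆ (Finset.range S).biUnion Es := by
    intro k hk
    obtain ⟨hkP, q, a, r, hA, hh, hq, hr⟩ := hE k hk
    set h : ℝ := max (q : ℝ) (|r| : ℤ) with hh'
    have hl : H0 ≤ h := le_max_iff.2 hh
    have hu : h ≤ H1 := max_le hq hr
    obtain ⟨s, hs1, hs2⟩ := exists_nat_pow_near (one_le_div hH00 |>.2 hl) one_lt_two
    rw [le_div_iff₀ hH00] at hs1
    rw [div_lt_iff₀ hH00, pow_succ] at hs2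
    have hsS : s < S := by
      by_contra hc
      have : (2 : ℝ) ^ S ≤ 2 ^ s := pow_le_pow_right₀ (by norm_num) (not_lt.1 hc)
      rw [div_lt_iff₀ hH00] at hS
      nlinarith
    rw [Finset.mem_biUnion]
    refine ⟨s, Finset.mem_range.2 hsS, Finset.mem_filter.2 ⟨hk, by linarith, q, a, r, hA, ?_, ?_, ?_⟩⟩
    · linarith [le_max_left (q : ℝ) (|r| : ℤ)]
    · linarith [le_max_right (q : ℝ) (|r| : ℤ)]
    · exact le_max_iff.1 (by linarith)
  have hgeo : ∑ s ∈ Finset.range S, y ^ s ≤ 9 := by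
    rw [geom_sum_eq (by linarith), ← neg_div_neg_eq, div_le_iff₀ (by linarith)]
    have : 0 ≤ y ^ S := by positivity
    linarith
  calc ∑ k ∈ E, F k ≤ ∑ k ∈ E, ∑ s ∈ Finset.range S, (if k ∈ Es s then F k else 0) := by
        refine Finset.sum_le_sum fun k hk => ?_
        obtain ⟨s, hs, hks⟩ := Finset.mem_biUnion.1 (hcov hk)
        refine le_trans (by rw [if_pos hks]) (Finset.single_le_sum
          (f := fun s => if k ∈ Es s then F k else 0) (fun s _ => ?_) hs)
        split_ifs
        · exact hF k
        · exact le_rfl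
    _ = ∑ s ∈ Finset.range S, ∑ k ∈ Es s, F k := by
        rw [Finset.sum_comm]
        refine Finset.sum_congr rfl fun s _ => ?_
        rw [← Finset.sum_filter]
        refine Finset.sum_congr ?_ fun _ _ => rfl
        ext k; simp [hEs]
    _ ≤ ∑ s ∈ Finset.range S, B * H0 ^ (-(9 / 50) : ℝ) * y ^ s := by
        refine Finset.sum_le_sum fun s _ => ?_
        have e : (H0 * 2 ^ s) ^ (-(9 / 50) : ℝ) = H0 ^ (-(9 / 50) : ℝ) * y ^ s := by
          rw [Real.mul_rpow hH00.le (by positivity), hy, ← Real.rpow_natCast, ← Real.rpow_mul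
            (by norm_num), ← Real.rpow_natCast, ← Real.rpow_mul (by norm_num), mul_comm (s : ℝ)]
        by_cases hs : H0 * 2 ^ s ≤ H1
        · rw [mul_assoc, ← e]
          refine h1 _ (le_mul_of_one_le_right hH00.le (one_le_pow₀ (by norm_num))) hs _ fun k hk => ?_
          obtain ⟨hk, -, h⟩ := Finset.mem_filter.1 hk
          exact ⟨(hE k hk).1, h⟩
        · have : Es s = ∅ := Finset.filter_eq_empty_iff.2 fun k _ h => hs h.1
          rw [this, Finset.sum_empty]; positivity
    _ = B * H0 ^ (-(9 / 50) : ℝ) * ∑ s ∈ Finset.range S, y ^ s := by rw [Finset.mul_sum]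
    _ ≤ B * H0 ^ (-(9 / 50) : ℝ) * 9 := by gcongr
    _ = _ := by ring

lemma setup {A : Finset ℤ} (c : CD A) (N t L G : ℝ) (hL : 1 ≤ L) (hG : 1 ≤ G)
    (ht : t ^ 1000 = N) (ht1 : 6562 * (c.C : ℝ) ^ 3 ≤ t) (ht2 : 288 * L * c.C * c.K ≤ t)
    (ht3 : 288 * L * c.C * (5 * G) ≤ t) :
    ∃ (J : ℕ) (X : Finset (List ℤ)) (M' ρ' : ℝ), 1 ≤ J ∧ 9 * (t ^ 41) ^ 2 < c.P (J - 1) ∧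
      (∀ b ∈ X, ∀ a ∈ b, a ∈ A) ∧ Chn A c.K (J + 1) (cat (c.Λ J) X) (c.P J * M') ρ' ∧
      N / (288 * L * c.C) ≤ c.P J ^ 2 * M' ∧ c.P J ^ 2 * M' ≤ N / (144 * L) ∧ 5 * G ≤ M' ∧
      t ^ 41 ≤ c.P J ^ 2 ∧ c.P J ≤ t ^ 330 := by
  have hC : (1 : ℝ) ≤ c.C := by exact_mod_cast c.hC
  have hC3 : (1 : ℝ) ≤ (c.C : ℝ) ^ 3 := one_le_pow₀ hC
  have t1 : 1 ≤ t := by linarith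
  have t0 : 0 < t := by linarith
  obtain ⟨J, hJ1, hJ2⟩ := c.exists_max (x := t ^ 330) (one_le_pow₀ t1)
  have hJ3 : t ^ 330 < c.C * c.P J ^ 2 := hJ2.trans_le (c.hP2 J)
  have p1 := c.one_le J
  have hCt : (c.C : ℝ) < t := by nlinarith [pow_le_pow_right₀ hC (show 1 ≤ 3 by norm_num)]
  have hJ0 : 1 ≤ J := by
    by_contra hc
    have : J = 0 := by omega
    rw [this, c.hP0] at hJ3
    have : t ^ 1 ≤ t ^ 330 := pow_le_pow_right₀ t1 (by norm_num)
    linarith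
  set D : ℝ := 288 * L * c.C with hD
  have hD1 : 288 ≤ D := by nlinarith
  set M0 : ℝ := N / (D * c.P J ^ 2) with hM0
  have hM0e : D * c.P J ^ 2 * M0 = N := by rw [hM0]; field_simp
  have hM0l : t ^ 340 ≤ D * M0 := by
    have h2 : c.P J ^ 2 ≤ (t ^ 330) ^ 2 := by gcongr
    have h3 : t ^ 340 * c.P J ^ 2 ≤ D * M0 * c.P J ^ 2 := by
      calc t ^ 340 * c.P J ^ 2 ≤ t ^ 340 * (t ^ 330) ^ 2 := by gcongr
        _ = N := by rw [← ht]; ring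
        _ = _ := by rw [← hM0e]; ring
    exact le_of_mul_le_mul_right h3 (by positivity)
  have hlo : ∀ x, 0 ≤ x → D * x ≤ t → x * t ^ 330 ≤ M0 := by
    intro x hx h
    have h3 : D * (x * t ^ 330) ≤ D * M0 := by
      refine le_trans ?_ hM0l
      calc D * (x * t ^ 330) = D * x * t ^ 330 := by ring
        _ ≤ t * t ^ 330 := by gcongr
        _ = t ^ 331 := by ring
        _ ≤ _ := pow_le_pow_right₀ t1 (by norm_num)
    exact le_of_mul_le_mul_left h3 (by linarith)
  have hGM : 5 * G ≤ M0 := le_trans (le_mul_of_one_le_right (by linarith) (one_le_pow₀ t1))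
    (hlo _ (by linarith) ht3)
  have hKM : c.K * c.P J ≤ M0 := le_trans (by gcongr) (hlo _ (by positivity) ht2)
  have hce : M0 ≤ (⌈M0⌉₊ : ℝ) := Nat.le_ceil _
  have hce2 : (⌈M0⌉₊ : ℝ) ≤ 2 * M0 := by
    have := Nat.ceil_lt_add_one (show 0 ≤ M0 by linarith)
    linarith
  obtain ⟨X, M', ρ', a1, a2, a3, a4⟩ := c.tuned J ⌈M0⌉₊ (hKM.trans hce)
  refine ⟨J, X, M', ρ', hJ0, ?_, a3, a4, ?_, ?_, by linarith, ?_, hJ1⟩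
  · have e := c.hP2 (J - 1)
    rw [show J - 1 + 1 = J by omega] at e
    have q1 := c.one_le (J - 1)
    have h5 : t ^ 330 < c.C ^ 3 * c.P (J - 1) ^ 4 := by
      refine hJ3.trans_le ?_
      calc c.C * c.P J ^ 2 ≤ c.C * (c.C * c.P (J - 1) ^ 2) ^ 2 := by gcongr
        _ = _ := by ring
    have h6 : (9 * (t ^ 41) ^ 2) ^ 4 < c.P (J - 1) ^ 4 := by
      have : c.C ^ 3 * (9 * (t ^ 41) ^ 2) ^ 4 < c.C ^ 3 * c.P (J - 1) ^ 4 := by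
        refine lt_of_le_of_lt ?_ h5
        calc c.C ^ 3 * (9 * (t ^ 41) ^ 2) ^ 4 = 6561 * c.C ^ 3 * t ^ 328 := by ring
          _ ≤ t * t ^ 328 := by gcongr; linarith
          _ = t ^ 329 := by ring
          _ ≤ _ := pow_le_pow_right₀ t1 (by norm_num)
      exact lt_of_mul_lt_mul_left this (by positivity)
    exact lt_of_pow_lt_pow_left₀ 4 (by linarith) h6
  · rw [div_le_iff₀ (by linarith), ← hM0e]
    have : M0 ≤ M' := hce.trans a1
    nlinarith [mul_le_mul_of_nonneg_left this (by positivity : 0 ≤ D * c.P J ^ 2)]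
  · rw [le_div_iff₀ (by linarith), ← hM0e, hD]
    have : M' ≤ c.C * (2 * M0) := a2.trans (by gcongr)
    have := mul_le_mul_of_nonneg_left this (by positivity : 0 ≤ c.P J ^ 2 * (144 * L))
    linarith
  · have h7 : c.C * t ^ 41 ≤ c.C * c.P J ^ 2 := by
      calc c.C * t ^ 41 ≤ t * t ^ 41 := by gcongr
        _ = t ^ 42 := by ring
        _ ≤ t ^ 330 := pow_le_pow_right₀ t1 (by norm_num)
        _ ≤ _ := hJ3.le
    exact le_of_mul_le_mul_left h7 (by linarith)

set_option maxHeartbeats 800000 in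
lemma L_bound {ι : Type*} {A : Finset ℤ} (hpos : ∀ a ∈ A, 1 ≤ a) (c : CD A) (N : ℕ) (t L G : ℝ)
    (hL : 1 ≤ L) (hG : 1 ≤ G) (ht : t ^ 1000 = N) (ht4 : 16 * G ^ 2 ≤ t) (J : ℕ)
    (X : Finset (List ℤ)) (M' ρ' : ℝ) (hch : Chn A c.K (J + 1) (cat (c.Λ J) X) (c.P J * M') ρ')
    (hB1 : N / (288 * L * c.C) ≤ c.P J ^ 2 * M') (hB2 : c.P J ^ 2 * M' ≤ N / (144 * L))
    (hM : 5 * G ≤ M') (hPJ : t ^ 41 ≤ c.P J ^ 2) (hPJ2 : c.P J ≤ t ^ 330)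
    (𝒢 : Finset ι) (g : ι → List ℤ)
    (hg : ∀ i ∈ 𝒢, Pos (g i) ∧ Mt (g i) 1 1 ≤ G) (E : Finset ℕ)
    (hE : ∀ k ∈ E, k < 300 * c.C * N ∧ ∃ q a r : ℤ, Arc (300 * c.C * N) k q a r ∧
      (q : ℝ) ^ 2 ≤ (300 * c.C * N : ℕ) ∧ (r : ℝ) ^ 2 ≤ (300 * c.C * N : ℕ) ∧
      (t ^ 41 ≤ q ∨ t ^ 41 ≤ |(r : ℝ)|)) :
    ∑ k ∈ E, ‖SS (300 * c.C * N) (cat (c.Λ J) X) (c.Λ J) 𝒢 g k‖ ^ 2 ≤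
      64000000 * (86400 * L * c.C ^ 2 + G) ^ 5 * G ^ 2 *
      ((cat (c.Λ J) X).card * (𝒢.card * (c.Λ J).card)) ^ 2 / t := by
  have hC : (1 : ℝ) ≤ c.C := by exact_mod_cast c.hC
  have t1 : 1 ≤ t := by nlinarith
  have t0 : 0 < t := by linarith
  have p1 := c.one_le J
  set p := c.P J with hp
  have hN1 : (1 : ℝ) ≤ N := by rw [← ht]; exact one_le_pow₀ t1
  have hM1 : 1 ≤ M' := by linarith
  have hpM : 1 ≤ p * M' := by nlinarith
  set C1 : ℝ := 86400 * L * c.C ^ 2 + G with hC1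
  have hC2 : (1 : ℝ) ≤ (c.C : ℝ) ^ 2 := one_le_pow₀ hC
  have hLC : 1 ≤ L * (c.C : ℝ) ^ 2 := by nlinarith
  have hC11 : 1 ≤ C1 := by nlinarith
  have hGC : G ≤ C1 := by rw [hC1]; linarith
  set XX : ℤ := ⌊2 * (p * M')⌋ with hXX
  have x1 : (XX : ℝ) ≤ 2 * (p * M') := Int.floor_le _
  have x2 : p * M' ≤ XX := by have := Int.lt_floor_add_one (2 * (p * M')); linarith
  have hB3 : p ^ 2 * M' ≤ N / 144 := hB2.trans (by gcongr; linarith)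
  have hpp : p * M' ≤ p ^ 2 * M' := by nlinarith
  have hPr : ((300 * c.C * N : ℕ) : ℝ) = 300 * c.C * N := by push_cast; ring
  have hP300 : (300 * N : ℝ) ≤ 300 * c.C * N := by nlinarith
  have bd := hch.bd hpos (by linarith)
  have bdΛ := (c.chn J).bd hpos (by linarith)
  have hgen : ∀ m, m ≤ 1000 → t ^ m ≤ N := fun m hm => ht ▸ pow_le_pow_right₀ t1 hm
  have main := shellL (300 * c.C * N) XX (4 * G * p) C1 (t ^ 41) (cat (c.Λ J) X) (c.Λ J) 𝒢 g E
    (by exact_mod_cast hpM.trans x2)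
    (by
      have : (XX : ℝ) < (300 * c.C * N : ℕ) := by rw [hPr]; linarith
      exact_mod_cast this) hC11 (one_le_pow₀ t1)
    (by rw [hPr, ← pow_mul]; linarith [hgen (41 * 2) (by norm_num)])
    (by
      rw [hPr]
      calc (4 * G * p) ^ 2 * t ^ 41 = 16 * G ^ 2 * p ^ 2 * t ^ 41 := by ring
        _ ≤ t * (t ^ 330) ^ 2 * t ^ 41 := by gcongr
        _ = t ^ 702 := by ring
        _ ≤ _ := by linarith [hgen 702 (by norm_num)])
    (by
      refine hPJ.trans ?_
      have : 1 ≤ G ^ 2 := one_le_pow₀ hG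
      nlinarith [sq_nonneg p])
    (by nlinarith)
    (fun a ha => ⟨(bd a ha).1, by
      rw [hXX, Int.le_floor]; exact (bd a ha).2.2⟩) (fun a ha => (bdΛ a ha).1)
    (fun i hi => (hg i hi).1)
    (by
      intro i hi b hb
      obtain ⟨b1, b2, b3⟩ := bdΛ b hb
      obtain ⟨g1, g2⟩ := hg i hi
      have b4 : (0 : ℝ) ≤ Mt b 1 1 := by linarith
      have hd := D_append g1 b1.rev
      have er : Mt b.reverse 1 1 = Mt b 1 1 := by rw [Mt_reverse]; rfl
      rw [er] at hd
      obtain ⟨d1, d2⟩ := hd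
      have d1' : (Mt (g i) 1 1 * Mt b 1 1 : ℝ) ≤ Mt (g i ++ b.reverse) 1 1 := by exact_mod_cast d1
      have d2' : (Mt (g i ++ b.reverse) 1 1 : ℝ) ≤ 2 * (Mt (g i) 1 1 * Mt b 1 1) := by
        exact_mod_cast d2
      have g3 : (1 : ℝ) ≤ Mt (g i) 1 1 := by exact_mod_cast (Mt_basic g1).2.2.2.1
      constructor
      · have h1 : p ≤ Mt (g i ++ b.reverse) 1 1 := by nlinarith
        have h2 : p ^ 2 * M' ≤ XX * Mt (g i ++ b.reverse) 1 1 := by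
          calc p ^ 2 * M' = (p * M') * p := by ring
            _ ≤ _ := by gcongr
        have h3 : (300 * c.C * N : ℝ) ≤ 86400 * L * c.C ^ 2 * (p ^ 2 * M') := by
          rw [div_le_iff₀ (by positivity)] at hB1
          nlinarith
        rw [hPr]
        calc (300 * c.C * N : ℝ) ≤ C1 * (p ^ 2 * M') := h3.trans (by gcongr; linarith)
          _ ≤ C1 * (XX * Mt (g i ++ b.reverse) 1 1) := by gcongr
          _ = _ := by ring
      · calc (Mt (g i ++ b.reverse) 1 1 : ℝ) ≤ 2 * (G * (2 * p)) := d2'.trans (by gcongr)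
          _ = _ := by ring)
    (by
      rw [hPr]
      calc (XX * (4 * G * p) : ℝ) ≤ 2 * (p * M') * (4 * G * p) := by gcongr
        _ = 8 * G * (p ^ 2 * M') := by ring
        _ ≤ 8 * G * (N / 144) := by gcongr
        _ ≤ G * N := by nlinarith
        _ ≤ C1 * (300 * c.C * N) := mul_le_mul hGC (by linarith) (by linarith) (by linarith)) hE
  refine main.trans ?_
  have y1 := split_p p (c.Λ J).card p1 (c.chn J).hcard
  have y2 := split_p (p * M') (cat (c.Λ J) X).card hpM hch.hcard
  have hN25 : p ^ (1 / 25 : ℝ) * (p * M') ^ (1 / 25 : ℝ) ≤ t ^ 40 := by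
    rw [← Real.mul_rpow (by linarith) (by linarith)]
    have : (t ^ 1000) ^ (1 / 25 : ℝ) = t ^ 40 := by
      rw [← Real.rpow_natCast, ← Real.rpow_mul t0.le, ← Real.rpow_natCast]; norm_num
    rw [← this, ht]
    gcongr
    nlinarith
  have hXY : ((XX : ℝ) ^ 2 * (4 * G * p) ^ 2) ≤
      64 * G ^ 2 * (t ^ 40 * ((cat (c.Λ J) X).card * (c.Λ J).card)) := by
    calc ((XX : ℝ) ^ 2 * (4 * G * p) ^ 2) ≤ (2 * (p * M')) ^ 2 * (4 * G * p) ^ 2 := by gcongr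
      _ = 64 * G ^ 2 * ((p * M') ^ 2 * p ^ 2) := by ring
      _ ≤ 64 * G ^ 2 * (((p * M') ^ (1 / 25 : ℝ) * (cat (c.Λ J) X).card) *
          (p ^ (1 / 25 : ℝ) * (c.Λ J).card)) := by gcongr
      _ = 64 * G ^ 2 * (p ^ (1 / 25 : ℝ) * (p * M') ^ (1 / 25 : ℝ) *
          ((cat (c.Λ J) X).card * (c.Λ J).card)) := by ring
      _ ≤ _ := by gcongr
  rw [div_le_div_iff₀ (by positivity) t0]
  calc _ ≤ 1000000 * C1 ^ 5 * (cat (c.Λ J) X).card * 𝒢.card * (𝒢.card * (c.Λ J).card) *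
        (64 * G ^ 2 * (t ^ 40 * ((cat (c.Λ J) X).card * (c.Λ J).card))) * t := by gcongr
    _ = _ := by ring

noncomputable def cc (u b : List ℤ) : ℝ :=
  (Mt u 1 0 + fi * Mt u 1 1) * (Mt b 1 0 + fi * Mt b 1 1)

lemma d_bd {u b g : List ℤ} (hu : Pos u) (hb : Pos b) {τ η : ℝ}
    (hg : ∀ i j, τ * (xi i * xi j) ≤ Mt g i j ∧ Mt g i j ≤ (1 + η) * τ * (xi i * xi j)) :
    τ * cc u b ≤ Mt (u ++ (g ++ b.reverse)) 1 1 ∧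
      Mt (u ++ (g ++ b.reverse)) 1 1 ≤ (1 + η) * τ * cc u b := by
  obtain ⟨-, u0, -, u1, -⟩ := Mt_basic hu
  obtain ⟨-, b0, -, b1, -⟩ := Mt_basic hb
  have u0' : (0 : ℝ) ≤ Mt u 1 0 := by exact_mod_cast u0
  have u1' : (0 : ℝ) ≤ Mt u 1 1 := by exact_mod_cast (by linarith : 0 ≤ Mt u 1 1)
  have b0' : (0 : ℝ) ≤ Mt b 1 0 := by exact_mod_cast b0
  have b1' : (0 : ℝ) ≤ Mt b 1 1 := by exact_mod_cast (by linarith : 0 ≤ Mt b 1 1)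
  have x0 : xi 0 = 1 := by simp [xi]
  have x1 : xi 1 = fi := by simp [xi]
  have r0 : Mt b.reverse 0 1 = Mt b 1 0 := by rw [Mt_reverse]; rfl
  have r1 : Mt b.reverse 1 1 = Mt b 1 1 := by rw [Mt_reverse]; rfl
  have e : ((Mt (u ++ (g ++ b.reverse)) 1 1 : ℤ) : ℝ) =
      Mt u 1 0 * Mt b 1 0 * Mt g 0 0 + Mt u 1 0 * Mt b 1 1 * Mt g 0 1 +
      Mt u 1 1 * Mt b 1 0 * Mt g 1 0 + Mt u 1 1 * Mt b 1 1 * Mt g 1 1 := by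
    rw [Mt_app, Mt_app g, Mt_app g, r0, r1]; push_cast; ring
  obtain ⟨l00, h00⟩ := hg 0 0
  obtain ⟨l01, h01⟩ := hg 0 1
  obtain ⟨l10, h10⟩ := hg 1 0
  obtain ⟨l11, h11⟩ := hg 1 1
  rw [x0] at *
  rw [x1] at *
  have m00 := mul_nonneg u0' b0'
  have m01 := mul_nonneg u0' b1'
  have m10 := mul_nonneg u1' b0'
  have m11 := mul_nonneg u1' b1'
  rw [e]; unfold cc
  constructor
  · have := mul_le_mul_of_nonneg_left l00 m00
    have := mul_le_mul_of_nonneg_left l01 m01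
    have := mul_le_mul_of_nonneg_left l10 m10
    have := mul_le_mul_of_nonneg_left l11 m11
    linarith
  · have := mul_le_mul_of_nonneg_left h00 m00
    have := mul_le_mul_of_nonneg_left h01 m01
    have := mul_le_mul_of_nonneg_left h10 m10
    have := mul_le_mul_of_nonneg_left h11 m11
    linarith

lemma cc_bd {u b : List ℤ} (hu : Pos u) (hb : Pos b) {p q : ℝ} (hp : 0 ≤ p) (hq : 0 ≤ q)
    (hup : p ≤ Mt u 1 1 ∧ Mt u 1 1 ≤ 2 * p) (hbq : q ≤ Mt b 1 1 ∧ Mt b 1 1 ≤ 2 * q) :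
    p * q ≤ cc u b ∧ cc u b ≤ 36 * (p * q) := by
  have key : ∀ {l : List ℤ} {r : ℝ}, Pos l → 0 ≤ r → (r ≤ Mt l 1 1 ∧ Mt l 1 1 ≤ 2 * r) →
      r ≤ Mt l 1 0 + fi * Mt l 1 1 ∧ Mt l 1 0 + fi * Mt l 1 1 ≤ 6 * r := by
    intro l r hl hr h
    obtain ⟨-, u0, -, u1, u2, -⟩ := Mt_basic hl
    have u0' : (0 : ℝ) ≤ Mt l 1 0 := by exact_mod_cast u0
    have u2' : (Mt l 1 0 : ℝ) ≤ Mt l 1 1 := by exact_mod_cast u2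
    have := fi_gt
    have := fi_lt
    constructor <;> nlinarith
  obtain ⟨k1, k2⟩ := key hu hp hup
  obtain ⟨k3, k4⟩ := key hb hq hbq
  unfold cc
  exact ⟨mul_le_mul k1 k3 hq (by linarith), (mul_le_mul k2 k4 (by linarith) (by linarith)).trans (by linarith)⟩

open Classical in
lemma count_k (W : ℕ) [NeZero W] (u v : List ℤ) (n : ℕ) (hn : 1 ≤ n) (g : Kg W → List ℤ)
    (hg : ∀ κ : Kg W, ((g κ).map fun a : ℤ => uA W a).prod = κ) :
    Fintype.card (Kg W) * Nat.totient n ≤ n * W *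
      (Finset.univ.filter fun κ : Kg W => ((Mt (u ++ (g κ ++ v)) 1 1 : ℤ) : ZMod W) = n).card := by
  refine (Kg_count W n hn).trans (le_of_eq ?_)
  congr 1
  let U : Kg W := ⟨_, Mt_Kg W u⟩
  let V : Kg W := ⟨_, Mt_Kg W v⟩
  symm
  refine Finset.card_equiv ((Equiv.mulLeft U).trans (Equiv.mulRight V)) fun κ => ?_
  simp only [Finset.mem_filter, Finset.mem_univ, true_and]
  have e : ((Mt (u ++ (g κ ++ v)) 1 1 : ℤ) : ZMod W) =
      (((U * κ * V : Kg W) : (M2 W)ˣ) : M2 W) 1 1 := by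
    have h := congrFun (congrFun (Mt_mod W (u ++ (g κ ++ v))) 1) 1
    rw [Matrix.map_apply] at h
    rw [h, List.map_append, List.map_append, List.prod_append, List.prod_append, hg, ← mul_assoc]
    rfl
  rw [e]; rfl

open Classical in
lemma cover_count (W : ℕ) [NeZero W] (U Λ : Finset (List ℤ)) (I Jk : ℕ) (g : ℕ × Kg W → List ℤ)
    (n : ℕ) (κ0 : ℝ) (hn : 1 ≤ n) (hφ : κ0 * n ≤ Nat.totient n)
    (hg : ∀ i, ∀ κ : Kg W, ((g (i, κ)).map fun a : ℤ => uA W a).prod = κ)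
    (hi : ∀ u ∈ U, ∀ b ∈ Λ, ∃ i ≤ I, ∀ κ : Kg W, Mt (u ++ (g (i, κ) ++ b.reverse)) 1 1 ≤ (n : ℤ) ∧
      (n : ℤ) - Mt (u ++ (g (i, κ) ++ b.reverse)) 1 1 < Jk * W) :
    κ0 * (U.card * Λ.card * Fintype.card (Kg W)) / W ≤
      (((U ×ˢ ((Finset.range (I + 1) ×ˢ (Finset.univ : Finset (Kg W))) ×ˢ Λ)) ×ˢ
        Finset.range Jk).filter fun x =>
        Mt (x.1.1 ++ (g x.1.2.1 ++ x.1.2.2.reverse)) 1 1 + x.2 * W = (n : ℤ)).card := by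
  have hW : 0 < W := Nat.pos_of_ne_zero (NeZero.ne W)
  have hWr : (0 : ℝ) < W := by exact_mod_cast hW
  choose! i hiI hi2 using hi
  set src := ((U ×ˢ Λ) ×ˢ (Finset.univ : Finset (Kg W))).filter fun x =>
    ((Mt (x.1.1 ++ (g (i x.1.1 x.1.2, x.2) ++ x.1.2.reverse)) 1 1 : ℤ) : ZMod W) = n with hsrc
  have h1 : κ0 * (U.card * Λ.card * Fintype.card (Kg W)) / W ≤ src.card := by
    have : (src.card : ℝ) = ∑ x ∈ U ×ˢ Λ, ((Finset.univ.filter fun κ : Kg W =>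
        ((Mt (x.1 ++ (g (i x.1 x.2, κ) ++ x.2.reverse)) 1 1 : ℤ) : ZMod W) = n).card : ℝ) := by
      rw [hsrc, Finset.card_filter, Finset.sum_product]
      push_cast
      refine Finset.sum_congr rfl fun x _ => ?_
      rw [Finset.card_filter]; push_cast; rfl
    rw [this]
    have h2 : ∀ x ∈ U ×ˢ Λ, κ0 * Fintype.card (Kg W) / W ≤ ((Finset.univ.filter fun κ : Kg W =>
        ((Mt (x.1 ++ (g (i x.1 x.2, κ) ++ x.2.reverse)) 1 1 : ℤ) : ZMod W) = n).card : ℝ) := by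
      intro x _
      have := count_k W x.1 x.2.reverse n hn (fun κ => g (i x.1 x.2, κ)) (hg _)
      have h3 : (Fintype.card (Kg W) * Nat.totient n : ℝ) ≤ n * W * ((Finset.univ.filter
        fun κ : Kg W => ((Mt (x.1 ++ (g (i x.1 x.2, κ) ++ x.2.reverse)) 1 1 : ℤ) : ZMod W)
          = n).card : ℝ) := by exact_mod_cast this
      have hn0 : (0 : ℝ) < n := by exact_mod_cast hn
      rw [div_le_iff₀ hWr]
      refine le_of_mul_le_mul_left ?_ hn0
      calc n * (κ0 * Fintype.card (Kg W)) = Fintype.card (Kg W) * (κ0 * n) := by ring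
        _ ≤ Fintype.card (Kg W) * Nat.totient n := by gcongr
        _ ≤ _ := h3
        _ = _ := by ring
    refine le_trans (le_of_eq ?_) (Finset.card_nsmul_le_sum _ _ _ h2)
    rw [Finset.card_product, nsmul_eq_mul]; push_cast; ring
  refine h1.trans ?_
  norm_cast
  set dd : (List ℤ × List ℤ) × Kg W → ℤ := fun x =>
    Mt (x.1.1 ++ (g (i x.1.1 x.1.2, x.2) ++ x.1.2.reverse)) 1 1 with hdd
  refine Finset.card_le_card_of_injOn (fun x =>
    ((x.1.1, ((i x.1.1 x.1.2, x.2), x.1.2)), (((n : ℤ) - dd x) / W).toNat)) ?_ ?_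
  · rintro ⟨⟨u, b⟩, κ⟩ hx
    rw [Finset.mem_coe, hsrc, Finset.mem_filter] at hx
    obtain ⟨hx, hc⟩ := hx
    simp only [Finset.mem_product, Finset.mem_univ, and_true] at hx
    obtain ⟨l1, l2⟩ := hi2 u hx.1 b hx.2 κ
    have hdv : (W : ℤ) ∣ (n : ℤ) - dd ((u, b), κ) := by
      rw [← ZMod.intCast_zmod_eq_zero_iff_dvd, Int.cast_sub, sub_eq_zero]
      simpa using hc.symm
    have hW' : (0 : ℤ) < W := by exact_mod_cast hW
    have hq0 : 0 ≤ ((n : ℤ) - dd ((u, b), κ)) / W := Int.ediv_nonneg (by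
      simp only [hdd]; linarith) hW'.le
    rw [Finset.mem_coe, Finset.mem_filter]
    simp only [Finset.mem_product, Finset.mem_univ, and_true, Finset.mem_range]
    refine ⟨⟨⟨hx.1, Nat.lt_succ_of_le (hiI u hx.1 b hx.2), hx.2⟩, ?_⟩, ?_⟩
    · rw [← Nat.cast_lt (α := ℤ), Int.toNat_of_nonneg hq0]
      exact Int.ediv_lt_of_lt_mul hW' l2
    · rw [Nat.cast_mul, Int.toNat_of_nonneg hq0, Int.ediv_mul_cancel hdv]; simp only [hdd]; ring
  · rintro ⟨⟨u, b⟩, κ⟩ _ ⟨⟨u', b'⟩, κ'⟩ _ h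
    simp only [Prod.mk.injEq] at h ⊢
    tauto

open Classical in
lemma E_split (F : ℕ → ℝ) (P H0 : ℕ) (H1 x y : ℝ) (hP : 1 ≤ P)
    (hS : ∀ E : Finset ℕ, (∀ k ∈ E, k < P ∧ ∃ q a r : ℤ, Arc P k q a r ∧
      ((H0 : ℝ) ≤ q ∨ (H0 : ℝ) ≤ |r|) ∧ q ≤ H1 ∧ |r| ≤ H1) → ∑ k ∈ E, F k ≤ x)
    (hL : ∀ E : Finset ℕ, (∀ k ∈ E, k < P ∧ ∃ q a r : ℤ, Arc P k q a r ∧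
      (q : ℝ) ^ 2 ≤ P ∧ (r : ℝ) ^ 2 ≤ P ∧ (H1 ≤ q ∨ H1 ≤ |(r : ℝ)|)) → ∑ k ∈ E, F k ≤ y) :
    ∑ k ∈ (Finset.range P).filter (fun k => ¬ ∃ q a r : ℤ, Arc P k q a r ∧ q ≤ H0 ∧ |r| ≤ H0),
      F k ≤ x + y := by
  rw [← Finset.sum_filter_add_sum_filter_not _ fun k => ∃ q a r : ℤ, Arc P k q a r ∧
      ((H0 : ℝ) ≤ q ∨ (H0 : ℝ) ≤ |r|) ∧ q ≤ H1 ∧ |r| ≤ H1]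
  refine add_le_add (hS _ fun k hk => ?_) (hL _ fun k hk => ?_)
  · simp only [Finset.mem_filter, Finset.mem_range] at hk
    exact ⟨hk.1.1, hk.2⟩
  · simp only [Finset.mem_filter, Finset.mem_range] at hk
    obtain ⟨⟨hkP, h1⟩, h2⟩ := hk
    obtain ⟨q, a, r, hA, hq, hr⟩ := arc_exists P hP k
    refine ⟨hkP, q, a, r, hA, by exact_mod_cast hq, by exact_mod_cast hr, ?_⟩
    by_contra! h3
    refine h2 ⟨q, a, r, hA, ?_, h3.1.le, by push_cast; exact h3.2.le⟩
    by_contra! h4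
    exact h1 ⟨q, a, r, hA, by exact_mod_cast h4.1.le, by exact_mod_cast h4.2.le⟩

lemma alg1 {P c1 b κ Om Jk Sg σ : ℝ} {s : ℝ} (hb : 0 < b) (hOm : 0 < Om) (hJ : 0 < Jk) (hκ : 0 < κ)
    (hP : 0 ≤ P) (hS0 : 0 ≤ Sg) (hs : s * 8 = κ)
    (h1 : Jk * Om * κ / 4 ≤ P * c1)
    (h2 : P * (c1 * b) ≤ s * Jk * (Om * b) + 2 * Jk * (√Sg * √(P * b)))
    (h3 : Sg ≤ σ * Om ^ 2) : b * κ ^ 2 ≤ 256 * P * σ := by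
  have h4 : Jk * (Om * κ * b) ≤ Jk * (16 * (√Sg * √(P * b))) := by
    have := mul_le_mul_of_nonneg_right h1 hb.le
    rw [← hs] at this ⊢
    linarith
  have h5 := le_of_mul_le_mul_left h4 hJ
  have h6 : (Om * κ * b) ^ 2 ≤ (16 * (√Sg * √(P * b))) ^ 2 := by gcongr
  rw [mul_pow 16, mul_pow √Sg, Real.sq_sqrt hS0, Real.sq_sqrt (by positivity)] at h6
  have h7 : Om ^ 2 * b * (b * κ ^ 2) ≤ Om ^ 2 * b * (256 * P * σ) := by
    have := mul_le_mul_of_nonneg_right h3 (by positivity : 0 ≤ P * b)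
    nlinarith
  exact le_of_mul_le_mul_left h7 (by positivity)

lemma pos_k (C : ℝ) (hC : 0 ≤ C) : 0 ≤ 162000000 * C ^ 3 / (1 / (100000 * C ^ 2)) ^ 2 := by
  positivity

lemma pos_fin (C N H L G t : ℝ) (hC : 0 ≤ C) (hN : 0 ≤ N) (hH : 0 ≤ H) (hL : 0 ≤ L) (hG : 0 ≤ G)
    (ht : 0 ≤ t) : 0 ≤ 256 * (300 * C * N) *
      (9 * (162000000 * C ^ 3 / (1 / (100000 * C ^ 2)) ^ 2) * H ^ (-(9 / 50) : ℝ) +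
        64000000 * (86400 * L * C ^ 2 + G) ^ 5 * G ^ 2 / t) := by
  positivity

lemma cover_idx {η y L C m N : ℝ} {n0 : ℕ} (hη0 : 0 < η) (hη1 : η ≤ 1) (hL : 0 < L) (hC : 1 ≤ C)
    (hN : 0 < N) (c1 : N / (288 * L * C) ≤ y) (c2 : y ≤ N / (4 * L)) (hm1 : N ≤ 2 * m)
    (hm2 : m ≤ N) (hn2 : 288 * C < (1 + η) ^ (n0 + 1)) :
    ∃ i ≤ n0 + 1, (1 + η) * (L * (1 + η) ^ i) * y ≤ m ∧ m - L * (1 + η) ^ i * y ≤ 2 * η * N := by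
  have c0 : 0 < y := lt_of_lt_of_le (by positivity) c1
  have hm0 : (0 : ℝ) < m := by linarith
  rw [div_le_iff₀ (by positivity)] at c1
  rw [le_div_iff₀ (by positivity)] at c2
  have hden : 0 < L * (y * (1 + η)) := by positivity
  obtain ⟨i, hi1, hi2⟩ := exists_nat_pow_near (x := m / (L * (y * (1 + η)))) (by
    rw [one_le_div hden]
    have : y * L * η ≤ y * L := mul_le_of_le_one_right (by positivity) hη1
    linarith) (show 1 < 1 + η by linarith)
  rw [le_div_iff₀ hden] at hi1
  rw [div_lt_iff₀ hden] at hi2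
  have hiI : i < n0 + 1 := by
    by_contra hc
    have h1 : (1 + η) ^ (n0 + 1) ≤ (1 + η) ^ i := pow_le_pow_right₀ (by linarith) (not_lt.1 hc)
    have h2 : 288 * C * (L * y) < (1 + η) ^ i * (L * y) :=
      mul_lt_mul_of_pos_right (hn2.trans_le h1) (by positivity)
    have h3 : 0 ≤ (1 + η) ^ i * (L * y) * η := by positivity
    linarith
  refine ⟨i, hiI.le, by linarith, ?_⟩
  have h4 : m < (1 + η) ^ 2 * (L * (1 + η) ^ i * y) := hi2.trans_le (le_of_eq (by ring))
  have hDm : (1 + η) * (L * (1 + η) ^ i * y) ≤ m := by linarith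
  generalize L * (1 + η) ^ i * y = D at *
  have : η * ((1 + η) * D) ≤ η * m := by gcongr
  have : η * m ≤ η * N := by gcongr
  have : (1 + η) ^ 2 * D = (1 + η) * D + η * ((1 + η) * D) := by ring
  by_cases hD0 : 0 ≤ D
  · have : η * D ≤ η * ((1 + η) * D) := by
      gcongr; nlinarith
    linarith
  · nlinarith

set_option maxHeartbeats 1000000 in
open Classical in
lemma dens1 {A : Finset ℤ} (hpos : ∀ a ∈ A, 1 ≤ a) (hA1 : 1 ∈ A) (hA2 : 2 ∈ A) (c : CD A)
    (κ : ℝ) (hκ : 0 < κ) (hκ1 : κ ≤ 1) (H0 : ℕ) (hH0 : 1 ≤ H0) :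
    ∃ Cst : ℝ, ∀ᶠ N : ℕ in atTop, ∀ B : Finset ℕ, (∀ n ∈ B, N ≤ 2 * n ∧ n ≤ N ∧
      (n : ℤ) ∉ DA (A : Set ℤ) ∧ κ * n ≤ Nat.totient n) →
      B.card * κ ^ 2 ≤ 256 * (300 * c.C * N) *
        (9 * (162000000 * c.C ^ 3 / (1 / (100000 * c.C ^ 2)) ^ 2) * (H0 : ℝ) ^ (-(9 / 50) : ℝ) +
          Cst / (N : ℝ) ^ (1 / 1000 : ℝ)) := by
  have hC : (1 : ℝ) ≤ c.C := by exact_mod_cast c.hC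
  have hH0r : (1 : ℝ) ≤ H0 := by exact_mod_cast hH0
  set η : ℝ := κ / (72 * H0 ^ 4) with hη
  have hη0 : 0 < η := by positivity
  have hηe : 9 * (H0 : ℝ) ^ 3 * (η * H0) * 8 = κ := by rw [hη]; field_simp; norm_num
  have hη1 : η ≤ 1 := by
    rw [hη, div_le_one (by positivity)]
    have : (1 : ℝ) ≤ (H0 : ℝ) ^ 4 := one_le_pow₀ hH0r
    linarith
  set W : ℕ := Nat.factorial H0 with hW
  have hW0 : 0 < W := Nat.factorial_pos _
  have hWr : (0 : ℝ) < W := by exact_mod_cast hW0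
  haveI : NeZero W := ⟨hW0.ne'⟩
  obtain ⟨L0, hL0⟩ := gwords W η hη0
  set L := max L0 1 with hL
  have hL1 : 1 ≤ L := le_max_right _ _
  obtain ⟨n0, hn1, hn2⟩ := exists_nat_pow_near (show (1 : ℝ) ≤ 288 * c.C by linarith)
    (show 1 < 1 + η by linarith)
  set I := n0 + 1 with hI
  have hIη : ((I + 1 : ℕ) : ℝ) * η ≤ 290 * c.C := by
    have := one_add_mul_le_pow (show (-2 : ℝ) ≤ η by linarith) n0
    rw [hI]; push_cast; linarith
  have hIu : (1 + η) ^ I ≤ 576 * c.C := by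
    rw [hI, pow_succ]
    calc _ ≤ 288 * (c.C : ℝ) * 2 := by gcongr; linarith
      _ = _ := by ring
  have hgex : ∀ x : ℕ × Kg W, ∃ g : List ℤ, (∀ a ∈ g, a = 1 ∨ a = 2) ∧
      (g.map fun a : ℤ => uA W a).prod = x.2 ∧
      ∀ i j, L * (1 + η) ^ x.1 * (xi i * xi j) ≤ Mt g i j ∧
        Mt g i j ≤ (1 + η) * (L * (1 + η) ^ x.1) * (xi i * xi j) := fun x =>
    hL0 _ ((le_max_left L0 1).trans (le_mul_of_one_le_right (by linarith)
      (one_le_pow₀ (by linarith)))) _ x.2.2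
  choose g hg12 hgκ hgb using hgex
  set G : ℝ := 4608 * c.C * L with hG
  have hG1 : 1 ≤ G := by rw [hG]; nlinarith
  refine ⟨64000000 * (86400 * L * c.C ^ 2 + G) ^ 5 * G ^ 2, ?_⟩
  have htt : Tendsto (fun N : ℕ => (N : ℝ) ^ (1 / 1000 : ℝ)) atTop atTop :=
    (tendsto_rpow_atTop (by norm_num)).comp tendsto_natCast_atTop_atTop
  filter_upwards [htt.eventually_ge_atTop (6562 * (c.C : ℝ) ^ 3),
    htt.eventually_ge_atTop (288 * L * c.C * c.K),
    htt.eventually_ge_atTop (288 * L * c.C * (5 * G)), htt.eventually_ge_atTop (16 * G ^ 2),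
    tendsto_natCast_atTop_atTop.eventually_ge_atTop (W / (2 * η)),
    eventually_ge_atTop H0] with N ht1 ht2 ht3 ht4 hNW hNH B hB
  set t := (N : ℝ) ^ (1 / 1000 : ℝ) with ht
  have htN : t ^ 1000 = N := by
    rw [ht, ← Real.rpow_natCast, ← Real.rpow_mul (by positivity)]; norm_num
  rcases B.eq_empty_or_nonempty with rfl | hBne
  · simp only [Finset.card_empty, Nat.cast_zero, zero_mul]
    exact pos_fin _ _ _ _ _ _ (Nat.cast_nonneg _) (Nat.cast_nonneg _) (Nat.cast_nonneg _)
      (zero_le_one.trans hL1) (zero_le_one.trans hG1) (Real.rpow_nonneg (Nat.cast_nonneg _) _)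
  have hN1 : 1 ≤ N := hH0.trans hNH
  have hNr : (1 : ℝ) ≤ N := by exact_mod_cast hN1
  obtain ⟨J, X, M', ρ', hJ0, hPJ1, hX, hch, hB1, hB2, hM, hPJ2, hPJ3⟩ :=
    setup c N t L G hL1 hG1 htN ht1 ht2 ht3
  have p1 := c.one_le J
  have hM1 : 1 < M' := by linarith
  have hPM : 1 < c.P J * M' := one_lt_mul_of_le_of_lt p1 hM1
  have bdU := hch.bd hpos (zero_le_one.trans hPM.le)
  have bdΛ := (c.chn J).bd hpos (by linarith)
  have hcc : ∀ u ∈ cat (c.Λ J) X, ∀ b ∈ c.Λ J, N / (288 * L * c.C) ≤ cc u b ∧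
      cc u b ≤ N / (4 * L) := by
    intro u hu b hb
    obtain ⟨h1, h2⟩ := cc_bd (bdU u hu).1 (bdΛ b hb).1 (zero_le_one.trans hPM.le) (zero_le_one.trans p1)
      (bdU u hu).2 (bdΛ b hb).2
    rw [show c.P J * M' * c.P J = c.P J ^ 2 * M' by ring] at h1 h2
    refine ⟨hB1.trans h1, h2.trans ?_⟩
    calc 36 * (c.P J ^ 2 * M') ≤ 36 * (N / (144 * L)) := by gcongr
      _ = _ := by field_simp; norm_num
  set 𝒢 : Finset (ℕ × Kg W) := Finset.range (I + 1) ×ˢ Finset.univ with h𝒢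
  have hgP : ∀ x, Pos (g x) := fun x a ha => by rcases hg12 x a ha with h | h <;> omega
  have hτ : ∀ x ∈ 𝒢, L * (1 + η) ^ x.1 ≤ L * (576 * c.C) := by
    intro x hx
    rw [h𝒢, Finset.mem_product, Finset.mem_range] at hx
    gcongr
    exact (pow_le_pow_right₀ (by linarith) (by omega)).trans hIu
  have hgG : ∀ x ∈ 𝒢, Pos (g x) ∧ Mt (g x) 1 1 ≤ G := by
    intro x hx
    refine ⟨hgP x, (hgb x 1 1).2.trans ?_⟩
    have x1 : xi 1 = fi := by simp [xi]
    have := fi_gt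
    have := fi_lt
    calc (1 + η) * (L * (1 + η) ^ x.1) * (xi 1 * xi 1) ≤ 2 * (L * (576 * c.C)) * (2 * 2) := by
          rw [x1]; have := hτ x hx; gcongr; linarith
      _ = G := by rw [hG]; ring
  have hdd : ∀ u ∈ cat (c.Λ J) X, ∀ x ∈ 𝒢, ∀ b ∈ c.Λ J,
      (N : ℝ) / (288 * c.C) ≤ Mt (u ++ (g x ++ b.reverse)) 1 1 ∧
      Mt (u ++ (g x ++ b.reverse)) 1 1 ≤ 288 * c.C * (N : ℝ) := by
    intro u hu x hx b hb
    obtain ⟨h1, h2⟩ := d_bd (bdU u hu).1 (bdΛ b hb).1 (hgb x)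
    obtain ⟨h3, h4⟩ := hcc u hu b hb
    constructor
    · refine le_trans ?_ h1
      calc (N : ℝ) / (288 * c.C) = L * 1 * (N / (288 * L * c.C)) := by field_simp
        _ ≤ _ := by gcongr; exact one_le_pow₀ (by linarith)
    · refine h2.trans ?_
      have := hτ x hx
      have hc0 : 0 ≤ cc u b := le_trans (by positivity) h3
      calc (1 + η) * (L * (1 + η) ^ x.1) * cc u b ≤ 2 * (L * (576 * c.C)) * (N / (4 * L)) := by
            gcongr; linarith
        _ = _ := by field_simp; norm_num
  have hPr : ((300 * c.C * N : ℕ) : ℝ) = 300 * c.C * N := by push_cast; ring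
  have hP300 : (300 * N : ℝ) ≤ 300 * c.C * N := by
    have : 1 * (N : ℝ) ≤ c.C * N := by gcongr
    linarith
  have hPN : N ≤ 300 * c.C * N := Nat.le_mul_of_pos_left _ (by have := c.hC; positivity)
  set Om := cat (c.Λ J) X ×ˢ (𝒢 ×ˢ c.Λ J) with hOm
  set d : List ℤ × (ℕ × Kg W) × List ℤ → ℤ := fun x =>
    Mt (x.1 ++ (g x.2.1 ++ x.2.2.reverse)) 1 1 with hd
  have hSS : ∀ k : ℕ, ∑ ω ∈ Om, ec (300 * c.C * N) (k * d ω) =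
      SS (300 * c.C * N) (cat (c.Λ J) X) (c.Λ J) 𝒢 g k := fun k => by
    rw [hOm, Finset.sum_product]; rfl
  have hOmc : (Om.card : ℝ) = (cat (c.Λ J) X).card * (𝒢.card * (c.Λ J).card) := by
    rw [hOm, Finset.card_product, Finset.card_product]; push_cast; ring
  set Jk : ℕ := ⌊2 * η * N / W⌋₊ + 1 with hJk
  have hJ1 : 2 * η * N < Jk * W := by
    have := Nat.lt_floor_add_one (2 * η * N / W)
    rw [div_lt_iff₀ hWr] at this
    rw [hJk]; push_cast; exact this
  have hJ2 : ∀ j < Jk, (j * W : ℝ) ≤ 2 * η * N := by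
    intro j hj
    have h1 : j ≤ ⌊2 * η * N / W⌋₊ := by omega
    rw [Nat.le_floor_iff (by positivity), le_div_iff₀ hWr] at h1
    exact h1
  have hJ3 : (Jk * W : ℝ) ≤ 4 * η * N := by
    have h1 := hJ2 ⌊2 * η * N / W⌋₊ (by omega)
    rw [div_le_iff₀ (by positivity)] at hNW
    rw [hJk]; push_cast; linarith
  have hUne : 0 < (cat (c.Λ J) X).card := by
    have : (0 : ℝ) < (cat (c.Λ J) X).card := lt_of_lt_of_le (by
      have : 0 < c.P J * M' := zero_lt_one.trans hPM
      positivity) hch.hcard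
    exact_mod_cast this
  have hΛne : 0 < (c.Λ J).card := by
    have : (0 : ℝ) < (c.Λ J).card := lt_of_lt_of_le (by positivity) (c.chn J).hcard
    exact_mod_cast this
  have h𝒢c : 𝒢.card = (I + 1) * Fintype.card (Kg W) := by
    rw [h𝒢, Finset.card_product, Finset.card_range, Finset.card_univ]
  have hOm0 : (0 : ℝ) < Om.card := by
    rw [hOmc, h𝒢c]
    have : 0 < Fintype.card (Kg W) := Fintype.card_pos
    exact_mod_cast Nat.mul_pos hUne (Nat.mul_pos (Nat.mul_pos I.succ_pos this) hΛne)
  set E := (Finset.range (300 * c.C * N)).filter (fun k => ¬ ∃ q a r : ℤ,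
    Arc (300 * c.C * N) k q a r ∧ q ≤ H0 ∧ |r| ≤ H0) with hE
  have hlt : 288 * c.C * (N : ℝ) + 2 * η * N < (300 * c.C * N : ℕ) := by
    rw [hPr]
    have h1 : η * N ≤ 1 * N := by gcongr
    have h2 : 1 * (N : ℝ) ≤ c.C * N := by gcongr
    linarith
  have q_B : ∀ n ∈ B.map Nat.castEmbedding, 0 ≤ n ∧ n < ((300 * c.C * N : ℕ) : ℤ) := by
    intro n hn
    obtain ⟨m, hm, rfl⟩ := Finset.mem_map.1 hn
    have := (hB m hm).2.1
    simp only [Nat.castEmbedding_apply]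
    refine ⟨by positivity, ?_⟩
    have : m < 300 * c.C * N := by
      have h1 : 1 * N ≤ c.C * N := Nat.mul_le_mul_right _ c.hC
      rw [mul_assoc]; omega
    exact_mod_cast this
  have q_d : ∀ ω ∈ Om, 0 ≤ d ω ∧ ∀ j < Jk, d ω + j * W < (300 * c.C * N : ℕ) := by
    rintro ⟨u, x, b⟩ hω
    obtain ⟨hω1, hω2⟩ := Finset.mem_product.1 hω
    obtain ⟨hω3, hω4⟩ := Finset.mem_product.1 hω2
    obtain ⟨h1, h2⟩ := hdd u hω1 x hω3 b hω4
    constructor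
    · have : (0 : ℝ) ≤ d (u, x, b) := le_trans (by positivity) h1
      exact_mod_cast this
    · intro j hj
      have h3 := hJ2 j hj
      have : (d (u, x, b) + j * W : ℝ) < (300 * c.C * N : ℕ) :=
        (add_le_add h2 h3).trans_lt hlt
      exact_mod_cast this
  have q_ne : ∀ ω ∈ Om, d ω ∉ B.map Nat.castEmbedding := by
    rintro ⟨u, x, b⟩ hω hmem
    simp only [hOm, Finset.mem_product] at hω
    obtain ⟨n, hn, he⟩ := Finset.mem_map.1 hmem
    refine (hB n hn).2.2.1 ⟨u ++ (g x ++ b.reverse), ?_, ?_, ?_⟩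
    · intro h0
      have hu0 : u = [] := (List.append_eq_nil_iff.1 h0).1
      have := (bdU u hω.1).2.1
      rw [hu0, Mt_nil] at this
      simp only [Matrix.one_apply_eq, Int.cast_one] at this
      exact absurd this (not_le.2 hPM)
    · intro a ha
      simp only [List.mem_append, List.mem_reverse] at ha
      rcases ha with ha | ha | ha
      · exact hch.let_mem u hω.1 a ha
      · rcases hg12 x a ha with h | h <;> rw [h] <;> assumption
      · exact (c.chn J).let_mem b hω.2.2 a ha
    · exact he.symm
  have q_c : ∀ n ∈ B.map Nat.castEmbedding,
      κ * ((cat (c.Λ J) X).card * (c.Λ J).card * Fintype.card (Kg W)) / W ≤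
      ((Om ×ˢ Finset.range Jk).filter fun x => d x.1 + x.2 * W = n).card := by
    intro n hn
    obtain ⟨m, hm, rfl⟩ := Finset.mem_map.1 hn
    obtain ⟨hm1, hm2, hm3, hm4⟩ := hB m hm
    have hm1r : (N : ℝ) ≤ 2 * m := by exact_mod_cast hm1
    have hm2r : (m : ℝ) ≤ N := by exact_mod_cast hm2
    refine cover_count W (cat (c.Λ J) X) (c.Λ J) I Jk g m κ (by omega) hm4
      (fun i κ' => hgκ (i, κ')) ?_
    intro u hu b hb
    obtain ⟨c1, c2⟩ := hcc u hu b hb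
    obtain ⟨i, hiI, f1, f2⟩ := cover_idx hη0 hη1 (by linarith : 0 < L) hC
      (by linarith) c1 c2 hm1r hm2r hn2
    refine ⟨i, hiI, fun κ' => ?_⟩
    obtain ⟨e1, e2⟩ := d_bd (bdU u hu).1 (bdΛ b hb).1 (hgb (i, κ'))
    constructor
    · have : (Mt (u ++ (g (i, κ') ++ b.reverse)) 1 1 : ℝ) ≤ m := e2.trans f1
      exact_mod_cast this
    · have : (m : ℝ) - Mt (u ++ (g (i, κ') ++ b.reverse)) 1 1 < Jk * W :=
        lt_of_le_of_lt ((sub_le_sub_left e1 _).trans f2) hJ1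
      exact_mod_cast this
  have q_E : ∀ k < 300 * c.C * N, k ∉ E → ∃ q a r : ℤ, Arc (300 * c.C * N) k q a r ∧ q ≤ H0 ∧
      |r| ≤ H0 := by
    intro k hk hkE
    rw [hE, Finset.mem_filter, not_and_not_right] at hkE
    exact hkE (Finset.mem_range.2 hk)
  have q_W : ∀ q : ℤ, 1 ≤ q → q ≤ H0 → q ∣ W := by
    intro q hq1 hq2
    lift q to ℕ using by omega
    have : q ∣ W := Nat.dvd_factorial (by omega) (by omega)
    exact_mod_cast this
  have q_θ : ∀ j < Jk, 2 * Real.pi * (H0 * j * W) ≤ (η * H0) * (300 * c.C * N : ℕ) := by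
    intro j hj
    have h3 := hJ2 j hj
    have hpi : 2 * Real.pi ≤ 8 := by linarith [Real.pi_le_four]
    rw [hPr]
    calc 2 * Real.pi * (H0 * j * W) = 2 * Real.pi * (H0 * (j * W)) := by ring
      _ ≤ 8 * (H0 * (2 * η * N)) := by gcongr
      _ = 16 * (η * H0) * N := by ring
      _ ≤ η * H0 * (300 * N) := by
        have : 0 ≤ η * H0 * N := by positivity
        linarith
      _ ≤ _ := by gcongr
  have main := combine Om d (300 * c.C * N) W Jk H0 (B.map Nat.castEmbedding) E
    (κ * ((cat (c.Λ J) X).card * (c.Λ J).card * Fintype.card (Kg W)) / W) (η * H0) hH0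
    (hNH.trans hPN) (Nat.succ_pos _) q_B q_d q_ne q_c (Finset.filter_subset _ _) q_E q_W
    (by positivity) q_θ
  simp_rw [hSS] at main
  rw [Finset.card_map, hPr] at main
  have hOmr : (Om.card : ℝ) = ((I + 1 : ℕ) : ℝ) *
      ((cat (c.Λ J) X).card * (c.Λ J).card * Fintype.card (Kg W)) := by
    rw [hOmc, h𝒢c]; push_cast; ring
  refine alg1 (by exact_mod_cast hBne.card_pos) hOm0 (by positivity) hκ (by positivity)
    (Finset.sum_nonneg fun k _ => by positivity) hηe ?_ main ?_
  · rw [hOmr, ← mul_div_assoc, div_le_div_iff₀ (by norm_num) hWr]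
    have h1 : Jk * W * ((I + 1 : ℕ) : ℝ) ≤ 4 * N * (290 * c.C) := by
      calc Jk * W * ((I + 1 : ℕ) : ℝ) ≤ 4 * η * N * ((I + 1 : ℕ) : ℝ) := by gcongr
        _ = 4 * N * (((I + 1 : ℕ) : ℝ) * η) := by ring
        _ ≤ _ := by gcongr
    have h0 : 0 ≤ κ * ((cat (c.Λ J) X).card * (c.Λ J).card * Fintype.card (Kg W) : ℝ) :=
      mul_nonneg hκ.le (by exact_mod_cast Nat.zero_le _)
    have h2 := mul_le_mul_of_nonneg_right h1 h0
    have h3 := mul_nonneg (mul_nonneg (Nat.cast_nonneg (α := ℝ) N) (Nat.cast_nonneg (α := ℝ) c.C)) h0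
    linarith
  · rw [add_mul, hOmc, hE]
    refine E_split _ (300 * c.C * N) H0 (t ^ 41) _ _ (hN1.trans hPN) ?_ ?_
    · intro E' hE'
      refine (S_all _ (fun k => by positivity) (300 * c.C * N)
        (162000000 * c.C ^ 3 / (1 / (100000 * c.C ^ 2)) ^ 2 *
          ((cat (c.Λ J) X).card * (𝒢.card * (c.Λ J).card)) ^ 2) H0 (t ^ 41)
        (mul_nonneg (pos_k _ (Nat.cast_nonneg _)) (sq_nonneg _)) hH0r
        ?_ E' hE').trans (le_of_eq (by ring))
      intro H hHl hHu E2 hE2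
      refine S_one hpos c J X hX 𝒢 g (fun i _ => hgP i) (300 * c.C * N) (1 / (100000 * c.C ^ 2))
        (by positivity) ?_ ?_ ?_ H (hH0r.trans hHl) ?_ hJ0 E2 hE2
      · rw [div_le_one (by positivity)]
        have : (1 : ℝ) ≤ (c.C : ℝ) ^ 2 := one_le_pow₀ hC
        linarith
      · rw [hPr]
        have : c.P J ^ 2 * M' ≤ N / 144 := hB2.trans (by gcongr; linarith)
        have : c.P J * 1 ≤ c.P J * (c.P J * M') := by gcongr
        rw [← mul_assoc, ← sq] at this
        linarith
      · intro u hu x hx b hb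
        obtain ⟨h1, h2⟩ := hdd u hu x hx b hb
        rw [hPr]
        refine ⟨le_trans ?_ h1, h2.trans (by gcongr; norm_num)⟩
        rw [div_mul_eq_mul_div, div_le_div_iff₀ (by positivity) (by positivity)]
        have : 0 ≤ c.C ^ 2 * (N : ℝ) := by positivity
        linarith
      · refine lt_of_le_of_lt ?_ hPJ1
        have : 0 ≤ H := by linarith
        gcongr
    · intro E' hE'
      exact (L_bound hpos c N t L G hL1 hG1 htN ht4 J X M' ρ' hch hB1 hB2 hM hPJ2 hPJ3 𝒢 g
        hgG E' hE').trans (le_of_eq (by ring))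

lemma tot_lb (n : ℕ) : Real.exp (-(2 * ∑ p ∈ n.primeFactors, (p : ℝ)⁻¹)) * n ≤ Nat.totient n := by
  have h : (Nat.totient n : ℝ) = n * ∏ p ∈ n.primeFactors, (1 - (p : ℝ)⁻¹) := by
    have := congrArg (fun x : ℚ => (x : ℝ)) (Nat.totient_eq_mul_prod_factors n)
    push_cast at this
    exact this
  rw [h, mul_comm, Finset.mul_sum, ← Finset.sum_neg_distrib, Real.exp_sum]
  refine mul_le_mul_of_nonneg_left ?_ (by positivity)
  refine Finset.prod_le_prod (fun p _ => (Real.exp_pos _).le) fun p hp => ?_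
  have hp2 : (2 : ℝ) ≤ p := by exact_mod_cast (Nat.prime_of_mem_primeFactors hp).two_le
  set x := (p : ℝ)⁻¹ with hx
  have hx0 : 0 < x := by positivity
  have hx1 : x ≤ 1 / 2 := by
    rw [hx, inv_eq_one_div]; exact one_div_le_one_div_of_le (by norm_num) hp2
  have h1 : (1 - x)⁻¹ ≤ Real.exp (2 * x) := by
    refine le_trans ?_ (Real.add_one_le_exp _)
    rw [inv_eq_one_div, div_le_iff₀ (by linarith)]
    nlinarith
  rw [Real.exp_neg]
  exact inv_le_of_inv_le₀ (by linarith) h1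

lemma tot_sum (N : ℕ) : ∑ n ∈ Finset.Ioc 0 N, ∑ p ∈ n.primeFactors, (p : ℝ)⁻¹ ≤ N := by
  rcases Nat.eq_zero_or_pos N with rfl | hN
  · simp
  calc _ ≤ ∑ n ∈ Finset.Ioc 0 N, ∑ p ∈ Finset.Ioc 1 N, if p ∣ n then (p : ℝ)⁻¹ else 0 := by
        refine Finset.sum_le_sum fun n hn => ?_
        rw [← Finset.sum_filter]
        refine Finset.sum_le_sum_of_subset_of_nonneg (fun p hp => ?_) fun _ _ _ => by positivity
        have h1 := Finset.mem_Ioc.1 hn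
        have h2 := Nat.dvd_of_mem_primeFactors hp
        have h3 := (Nat.prime_of_mem_primeFactors hp).two_le
        have h4 := Nat.le_of_dvd h1.1 h2
        rw [Finset.mem_filter, Finset.mem_Ioc]
        exact ⟨by omega, h2⟩
    _ = ∑ p ∈ Finset.Ioc 1 N, (((Finset.Ioc 0 N).filter fun n => p ∣ n).card : ℝ) * (p : ℝ)⁻¹ := by
        rw [Finset.sum_comm]
        refine Finset.sum_congr rfl fun p _ => ?_
        rw [← Finset.sum_filter, Finset.sum_const, nsmul_eq_mul]
    _ ≤ ∑ p ∈ Finset.Ioc 1 N, N * ((p : ℝ) ^ 2)⁻¹ := by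
        refine Finset.sum_le_sum fun p _ => ?_
        rw [Nat.Ioc_filter_dvd_card_eq_div]
        calc ((N / p : ℕ) : ℝ) * (p : ℝ)⁻¹ ≤ N / p * (p : ℝ)⁻¹ := by
              gcongr; exact Nat.cast_div_le
          _ = _ := by rw [sq, mul_inv, div_eq_mul_inv, mul_assoc]
    _ ≤ N * 1 := by
        rw [← Finset.mul_sum]
        gcongr
        refine (sum_Ioc_inv_sq_le_sub one_ne_zero hN).trans ?_
        rw [Nat.cast_one, inv_one]
        have : (0 : ℝ) ≤ (N : ℝ)⁻¹ := by positivity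
        linarith
    _ = N := mul_one _

lemma tot_count (ε : ℝ) (hε : 0 < ε) : ∃ κ : ℝ, 0 < κ ∧ κ ≤ 1 ∧ ∀ N : ℕ,
    (((Finset.Ioc 0 N).filter fun n => ¬ κ * n ≤ Nat.totient n).card : ℝ) ≤ ε * N := by
  refine ⟨Real.exp (-(2 * ε⁻¹)), Real.exp_pos _, ?_, fun N => ?_⟩
  · rw [Real.exp_le_one_iff]
    have : 0 < ε⁻¹ := by positivity
    linarith
  set T := (Finset.Ioc 0 N).filter fun n => ¬ Real.exp (-(2 * ε⁻¹)) * n ≤ Nat.totient n with hT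
  have h1 : (T.card : ℝ) * ε⁻¹ ≤ N := by
    refine le_trans ?_ (tot_sum N)
    rw [← nsmul_eq_mul, ← Finset.sum_const]
    refine le_trans (Finset.sum_le_sum (g := fun n : ℕ => ∑ p ∈ n.primeFactors, (p : ℝ)⁻¹) ?_)
      (Finset.sum_le_sum_of_subset_of_nonneg (Finset.filter_subset _ _)
        fun _ _ _ => Finset.sum_nonneg fun _ _ => by positivity)
    intro n hn
    rw [hT, Finset.mem_filter] at hn
    by_contra! hc
    refine hn.2 (le_trans ?_ (tot_lb n))
    gcongr
  rw [← div_eq_mul_inv, div_le_iff₀ hε] at h1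
  linarith

open Classical in
lemma dens2 {A : Finset ℤ} (hpos : ∀ a ∈ A, 1 ≤ a) (hA1 : 1 ∈ A) (hA2 : 2 ∈ A) (c : CD A)
    (κ : ℝ) (hκ : 0 < κ) (hκ1 : κ ≤ 1) (ε : ℝ) (hε : 0 < ε) :
    ∀ᶠ N : ℕ in atTop, ∀ B : Finset ℕ, (∀ n ∈ B, N ≤ 2 * n ∧ n ≤ N ∧
      (n : ℤ) ∉ DA (A : Set ℤ) ∧ κ * n ≤ Nat.totient n) → (B.card : ℝ) ≤ ε * N := by
  have hC : (1 : ℝ) ≤ c.C := by exact_mod_cast c.hC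
  set K1 : ℝ := 256 * (300 * c.C) with hK1
  have hK10 : 0 < K1 := by positivity
  set K2 : ℝ := 9 * (162000000 * c.C ^ 3 / (1 / (100000 * c.C ^ 2)) ^ 2) with hK2
  have t0 : ∀ e : ℝ, 0 < e → Tendsto (fun N : ℕ => (N : ℝ) ^ (-e)) atTop (nhds 0) := fun e he =>
    (tendsto_rpow_neg_atTop he).comp tendsto_natCast_atTop_atTop
  set δ := ε * κ ^ 2 / (2 * K1) with hδ
  have hδ0 : 0 < δ := by positivity
  have t1 : ∀ᶠ H : ℕ in atTop, K2 * (H : ℝ) ^ (-(9 / 50) : ℝ) < δ := by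
    have := (t0 (9 / 50) (by norm_num)).const_mul K2
    rw [mul_zero] at this
    exact this.eventually_lt_const hδ0
  obtain ⟨H0, hH1, hH2⟩ := (t1.and (eventually_ge_atTop 1)).exists
  obtain ⟨Cst, hCst⟩ := dens1 hpos hA1 hA2 c κ hκ hκ1 H0 hH2
  have t2 : ∀ᶠ N : ℕ in atTop, Cst * (N : ℝ) ^ (-(1 / 1000) : ℝ) < δ := by
    have := (t0 (1 / 1000) (by norm_num)).const_mul Cst
    rw [mul_zero] at this
    exact this.eventually_lt_const hδ0
  filter_upwards [hCst, t2] with N h1 h2 B hB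
  have h3 := h1 B hB
  rw [div_eq_mul_inv Cst, ← Real.rpow_neg (by positivity)] at h3
  have h4 : (B.card : ℝ) * κ ^ 2 ≤ ε * N * κ ^ 2 := by
    refine h3.trans ?_
    calc _ ≤ 256 * (300 * c.C * N) * (δ + δ) := by gcongr
      _ = K1 * (2 * δ) * N := by rw [hK1]; ring
      _ = _ := by rw [hδ]; field_simp
  exact le_of_mul_le_mul_right h4 (by positivity)

open Classical in
lemma dens3 {A : Finset ℤ} (hpos : ∀ a ∈ A, 1 ≤ a) (hs : (sN : ENNReal) < dimH (CA (A : Set ℤ)))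
    (ε : ℝ) (hε : 0 < ε) : ∀ᶠ N : ℕ in atTop,
      (((Finset.Ioc 0 N).filter fun n : ℕ => (n : ℤ) ∉ DA (A : Set ℤ)).card : ℝ) ≤ ε * N := by
  obtain ⟨hA1, hA2⟩ := one_two_mem hpos hs
  obtain ⟨c⟩ := CD.exists hpos hs
  obtain ⟨κ, hκ, hκ1, hκ2⟩ := tot_count (ε / 4) (by positivity)
  obtain ⟨N0, hN0⟩ := eventually_atTop.1
    (dens2 hpos hA1 hA2 c κ hκ hκ1 (ε / 4) (by positivity))
  set f : ℕ → Finset ℕ := fun N => (Finset.Ioc 0 N).filter fun n : ℕ =>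
    (n : ℤ) ∉ DA (A : Set ℤ) ∧ κ * n ≤ Nat.totient n with hf
  have key : ∀ N : ℕ, ((f N).card : ℝ) ≤ ε / 2 * N + (N0 + 1) := by
    intro N
    induction N using Nat.strong_induction_on with
    | _ N ih =>
    by_cases hN : N < N0 + 1
    · have h1 : (f N).card ≤ N := (Finset.card_filter_le _ _).trans (by simp)
      have h2 : ((f N).card : ℝ) ≤ N0 + 1 := by exact_mod_cast h1.trans hN.le
      have : 0 ≤ ε / 2 * N := by positivity
      linarith
    · have h1 := ih (N / 2) (by omega)
      have h2 := hN0 N (by omega) ((f N).filter fun n => N ≤ 2 * n) (by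
        intro n hn
        simp only [hf, Finset.mem_filter, Finset.mem_Ioc] at hn
        exact ⟨hn.2, hn.1.1.2, hn.1.2⟩)
      have h3 : (f N).card ≤ ((f N).filter fun n => N ≤ 2 * n).card + (f (N / 2)).card := by
        rw [← Finset.card_filter_add_card_filter_not (s := f N) fun n => N ≤ 2 * n]
        gcongr
        intro n hn
        simp only [hf, Finset.mem_filter, Finset.mem_Ioc] at hn ⊢
        exact ⟨⟨hn.1.1.1, by omega⟩, hn.1.2⟩
      have h4 : ((f N).card : ℝ) ≤
          ((f N).filter fun n => N ≤ 2 * n).card + (f (N / 2)).card := by exact_mod_cast h3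
      have h5 : ε / 2 * ((N / 2 : ℕ) : ℝ) ≤ ε / 2 * (N / 2) := by
        gcongr; exact Nat.cast_div_le
      linarith
  filter_upwards [tendsto_natCast_atTop_atTop.eventually_ge_atTop ((N0 + 1) / (ε / 4))] with N hN
  rw [div_le_iff₀ (by positivity)] at hN
  have h1 : (((Finset.Ioc 0 N).filter fun n : ℕ => (n : ℤ) ∉ DA (A : Set ℤ)).card : ℝ) ≤
      (f N).card + ((Finset.Ioc 0 N).filter fun n => ¬ κ * n ≤ Nat.totient n).card := by
    rw [← Nat.cast_add, Nat.cast_le]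
    refine le_trans (Finset.card_le_card fun n hn => ?_) (Finset.card_union_le _ _)
    rw [Finset.mem_filter] at hn
    rw [Finset.mem_union, hf, Finset.mem_filter, Finset.mem_filter]
    by_cases h : κ * n ≤ Nat.totient n
    · exact Or.inl ⟨hn.1, hn.2, h⟩
    · exact Or.inr ⟨hn.1, h⟩
  linarith [key N, hκ2 N]

theorem stmt4 (A : Set ℤ) (hfin : A.Finite) (hpos : ∀ a ∈ A, 1 ≤ a)
    (hdim : 1 - 5 / 312 < dimH (CA A)) :
    Tendsto
      (fun N : ℕ =>
        (Nat.card {d : ℤ | 1 ≤ d ∧ d ≤ (N : ℤ) ∧ AdmissibleZ A d ∧ d ∉ DA A} : ℝ)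
          / (N : ℝ))
      atTop (nhds 0) := by
  classical
  lift A to Finset ℤ using hfin
  have hpos' : ∀ a ∈ A, 1 ≤ a := fun a ha => hpos a (by exact_mod_cast ha)
  have hsN : (sN : ENNReal) = 1 - 5 / 312 := by
    have h1 : (5 / 312 : ENNReal) = ((5 / 312 : NNReal) : ENNReal) := by
      rw [ENNReal.coe_div (by norm_num)]; norm_num
    rw [h1, ← ENNReal.coe_one, ← ENNReal.coe_sub, ENNReal.coe_inj]
    apply NNReal.eq
    rw [NNReal.coe_sub (by rw [div_le_one₀ (by norm_num)]; norm_num), sN]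
    push_cast
    norm_num
  rw [← hsN] at hdim
  rw [Metric.tendsto_atTop]
  intro ε hε
  obtain ⟨N1, hN1⟩ := eventually_atTop.1
    (dens3 hpos' hdim (ε / 2) (by positivity))
  refine ⟨N1 + 1, fun N hN => ?_⟩
  have hN0 : (0 : ℝ) < N := by exact_mod_cast (by omega : 0 < N)
  have h1 := hN1 N (by omega)
  rw [Real.dist_eq, sub_zero, abs_of_nonneg (by positivity), div_lt_iff₀ hN0]
  refine lt_of_le_of_lt (le_trans ?_ h1) (by nlinarith)
  rw [Nat.cast_le, Nat.card_coe_set_eq]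
  set T := (Finset.Ioc 0 N).filter fun n : ℕ => (n : ℤ) ∉ DA (A : Set ℤ) with hT
  rw [← Finset.card_map Nat.castEmbedding (s := T) (β := ℤ), ← Set.ncard_coe_finset]
  refine Set.ncard_le_ncard ?_ (Finset.finite_toSet _)
  rintro d ⟨h1, h2, -, h4⟩
  lift d to ℕ using by omega
  rw [Finset.mem_coe, Finset.mem_map]
  refine ⟨d, ?_, rfl⟩
  rw [hT, Finset.mem_filter, Finset.mem_Ioc]
  exact ⟨by omega, h4⟩
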